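/- arXiv:1505.00574 — 7 statements merged into one kernel-verified Lean document; each statement's English description precedes it below -/
import Mathlib

section
/- Let n ≥ 1 and let X be a finite set of nodes in ℝ² that is n-independent and satisfies #X ≤ 2n+1. Then for each node A ∈ X there exists an n-fundamental polynomial of A (a polynomial of total degree at most n equal to 1 at A and 0 at all other nodes of X) which is a product of polynomials of degree 1. -/
open MvPolynomial
open scoped Classical

noncomputable section

/-- A point (node) in the plane `ℝ²`. -/
abbrev Pt : Type := Fin 2 → ℝ

/-- A bivariate real polynomial. -/
abbrev BivPoly : Type := MvPolynomial (Fin 2) ℝ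

/-- `p` is an `n`-fundamental polynomial of the node `A` with respect to the node set `X`:
it has total degree at most `n`, equals `1` at `A` and vanishes at all other nodes of `X`. -/
def IsFundamental (n : ℕ) (X : Finset Pt) (A : Pt) (p : BivPoly) : Prop :=
  p.totalDegree ≤ n ∧ eval A p = 1 ∧ ∀ B ∈ X, B ≠ A → eval B p = 0

/-- `X` is `n`-independent: every node of `X` has an `n`-fundamental polynomial. -/
def IsIndependent (n : ℕ) (X : Finset Pt) : Prop :=
  ∀ A ∈ X, ∃ p : BivPoly, IsFundamental n X A p

/-- `p` is a product of finitely many polynomials each of total degree `1`. -/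
def IsProductOfLines (p : BivPoly) : Prop :=
  ∃ L : Multiset BivPoly, (∀ q ∈ L, q.totalDegree = 1) ∧ p = L.prod

/-- The affine polynomial `a + b x + c y`. -/
def affinePoly (a b c : ℝ) : BivPoly := C a + C b * X 0 + C c * X 1

lemma eval_affinePoly (a b c : ℝ) (P : Pt) :
    eval P (affinePoly a b c) = a + b * P 0 + c * P 1 := by
  simp [affinePoly]

lemma totalDegree_affinePoly_le (a b c : ℝ) : (affinePoly a b c).totalDegree ≤ 1 := by
  have monomial_le (r : ℝ) (i : Fin 2) : (C r * X i : BivPoly).totalDegree ≤ 1 := by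
    refine (totalDegree_mul _ _).trans ?_
    simp
  refine (totalDegree_add _ _).trans (max_le ((totalDegree_add _ _).trans (max_le ?_ ?_)) ?_)
  · simp
  · exact monomial_le b 0
  · exact monomial_le c 1

lemma totalDegree_affinePoly_eq_one {a b c : ℝ} {P Q : Pt}
    (h : eval P (affinePoly a b c) ≠ eval Q (affinePoly a b c)) :
    (affinePoly a b c).totalDegree = 1 := by
  refine le_antisymm (totalDegree_affinePoly_le a b c) (Nat.one_le_iff_ne_zero.mpr fun h0 => h ?_)
  rw [totalDegree_eq_zero_iff_eq_C.mp h0]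
  simp

/-- The slope of the line through `A` and `P`, with `none` for a vertical line. -/
def slopeFrom (A P : Pt) : Option ℝ :=
  if P 0 = A 0 then none else some ((P 1 - A 1) / (P 0 - A 0))

lemma ne_iff_coord {P A : Pt} : P ≠ A ↔ P 0 ≠ A 0 ∨ P 1 ≠ A 1 := by
  rw [Ne, funext_iff, Fin.forall_fin_two]
  tauto

lemma slopeFrom_eq_iff {A P Q : Pt} (hP : P ≠ A) (hQ : Q ≠ A) :
    slopeFrom A P = slopeFrom A Q ↔
      (P 0 - A 0) * (Q 1 - A 1) - (P 1 - A 1) * (Q 0 - A 0) = 0 := by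
  rw [ne_iff_coord] at hP hQ
  unfold slopeFrom
  by_cases hp : P 0 = A 0 <;> by_cases hq : Q 0 = A 0
  · simp [hp, hq]
  · simpa [hp, hq, sub_eq_zero] using hP
  · simpa [hp, hq, sub_eq_zero] using hQ
  · have hp' := sub_ne_zero.mpr hp
    have hq' := sub_ne_zero.mpr hq
    simp only [hp, hq, if_false, Option.some.injEq]
    rw [div_eq_div_iff hp' hq']
    constructor <;> intro h <;> linarith

lemma exists_line_through_pair {A P Q : Pt} (hP : P ≠ A) (hQ : Q ≠ A)
    (h : slopeFrom A P ≠ slopeFrom A Q) :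
    ∃ q : BivPoly, q.totalDegree = 1 ∧ eval A q = 1 ∧ eval P q = 0 ∧ eval Q q = 0 := by
  rw [Ne, slopeFrom_eq_iff hP hQ] at h
  set d := (P 0 - A 0) * (Q 1 - A 1) - (P 1 - A 1) * (Q 0 - A 0) with hd
  let l := affinePoly ((P 0 * Q 1 - P 1 * Q 0) / d) ((P 1 - Q 1) / d) ((Q 0 - P 0) / d)
  have hlA : eval A l = 1 := by
    rw [eval_affinePoly]
    field_simp
    rw [hd]
    ring
  have hlP : eval P l = 0 := by
    rw [eval_affinePoly]
    field_simp
    ring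
  have hlQ : eval Q l = 0 := by
    rw [eval_affinePoly]
    field_simp
    ring
  exact ⟨l, totalDegree_affinePoly_eq_one (P := A) (Q := P) (by rw [hlA, hlP]; exact one_ne_zero),
    hlA, hlP, hlQ⟩

lemma exists_line_through_point {A P : Pt} (hP : P ≠ A) :
    ∃ q : BivPoly, q.totalDegree = 1 ∧ eval A q = 1 ∧ eval P q = 0 := by
  have hd : (P 0 - A 0) ^ 2 + (P 1 - A 1) ^ 2 ≠ 0 := by
    rcases ne_iff_coord.mp hP with h | h
    · have := pow_pos (abs_pos.mpr (sub_ne_zero.mpr h)) 2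
      rw [sq_abs] at this
      positivity
    · have := pow_pos (abs_pos.mpr (sub_ne_zero.mpr h)) 2
      rw [sq_abs] at this
      positivity
  set d := (P 0 - A 0) ^ 2 + (P 1 - A 1) ^ 2 with hd'
  let l := affinePoly (((P 0 - A 0) * P 0 + (P 1 - A 1) * P 1) / d)
    (-(P 0 - A 0) / d) (-(P 1 - A 1) / d)
  have hlA : eval A l = 1 := by
    rw [eval_affinePoly]
    field_simp
    rw [hd']
    ring
  have hlP : eval P l = 0 := by
    rw [eval_affinePoly]
    field_simp
    ring
  exact ⟨l, totalDegree_affinePoly_eq_one (P := A) (Q := P) (by rw [hlA, hlP]; exact one_ne_zero),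
    hlA, hlP⟩

/-- A finite set of at most `2n + 2` elements whose fibres under `f` have at most `n + 1` elements
has one element, or two in different fibres, whose removal leaves at most `2n` elements and
fibres of size at most `n`. -/
lemma exists_pair_reducing_fibres {α β : Type*} [DecidableEq α] [DecidableEq β] (f : α → β)
    {n : ℕ} {Y : Finset α} (hY : Y.Nonempty) (hcard : Y.card ≤ 2 * (n + 1))
    (hfib : ∀ g, (Y.filter (f · = g)).card ≤ n + 1) :
    ∃ a ∈ Y, ∃ b ∈ Y, (a = b ∨ f a ≠ f b) ∧ ((Y.erase a).erase b).card ≤ 2 * n ∧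
      ∀ g, (((Y.erase a).erase b).filter (f · = g)).card ≤ n := by
  obtain ⟨a, ha, hamax⟩ := Y.exists_max_image (fun x => (Y.filter (f · = f x)).card) hY
  have fibre_lt {Z : Finset α} (hZ : Z ⊆ Y) {x : α} (hx : x ∈ Y) (hxZ : x ∉ Z) :
      (Z.filter (f · = f x)).card ≤ n := by
    refine Nat.lt_succ_iff.mp (lt_of_lt_of_le (Finset.card_lt_card ?_) (hfib (f x)))
    refine Finset.ssubset_iff_subset_ne.mpr ⟨Finset.filter_subset_filter _ hZ, fun h => hxZ ?_⟩
    have : x ∈ Y.filter (f · = f x) := by simp [hx]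
    rw [← h] at this
    exact (Finset.mem_filter.mp this).1
  by_cases hother : (Y.filter (f · ≠ f a)).Nonempty
  · obtain ⟨b, hb, hbmax⟩ :=
      (Y.filter (f · ≠ f a)).exists_max_image (fun x => (Y.filter (f · = f x)).card) hother
    obtain ⟨hbY, hba⟩ := Finset.mem_filter.mp hb
    have hb' : b ∈ Y.erase a := Finset.mem_erase.mpr ⟨fun h => hba (h ▸ rfl), hbY⟩
    have hsub : (Y.erase a).erase b ⊆ Y :=
      (Finset.erase_subset _ _).trans (Finset.erase_subset _ _)
    refine ⟨a, ha, b, hbY, Or.inr hba.symm, ?_, fun g => ?_⟩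
    · rw [Finset.card_erase_of_mem hb', Finset.card_erase_of_mem ha]
      omega
    by_cases hga : g = f a
    · subst hga
      exact fibre_lt hsub ha (by simp)
    by_cases hgb : g = f b
    · subst hgb
      exact fibre_lt hsub hbY (by simp)
    rcases (((Y.erase a).erase b).filter (f · = g)).eq_empty_or_nonempty with he | ⟨c, hc⟩
    · simp [he]
    obtain ⟨hcZ, rfl⟩ := Finset.mem_filter.mp hc
    have hcY := hsub hcZ
    have h₁ := hamax c hcY
    have h₂ := hbmax c (Finset.mem_filter.mpr ⟨hcY, hga⟩)
    have h₃ := Finset.card_le_card (Finset.filter_subset_filter (f · = f c) hsub)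
    have hsum : (Y.filter (f · = f a)).card + (Y.filter (f · = f b)).card +
        (Y.filter (f · = f c)).card ≤ Y.card := by
      rw [← Finset.card_union_of_disjoint, ← Finset.card_union_of_disjoint]
      · exact Finset.card_le_card (by intro x; simp; tauto)
      · simp only [Finset.disjoint_left, Finset.mem_union, Finset.mem_filter]
        rintro x (⟨-, hx⟩ | ⟨-, hx⟩) ⟨-, hx'⟩
        · exact hga (hx'.symm.trans hx)
        · exact hgb (hx'.symm.trans hx)
      · simp only [Finset.disjoint_left, Finset.mem_filter]
        rintro x ⟨-, hx⟩ ⟨-, hx'⟩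
        exact hba (hx'.symm.trans hx)
    omega
  · have hall : Y.filter (f · = f a) = Y := by
      refine Finset.filter_true_of_mem fun x hx => by_contra fun h => hother ⟨x, ?_⟩
      exact Finset.mem_filter.mpr ⟨hx, h⟩
    have hle := hfib (f a)
    rw [hall] at hle
    have hcard' : ((Y.erase a).erase a).card ≤ n := by
      rw [Finset.erase_idem, Finset.card_erase_of_mem ha]
      omega
    exact ⟨a, ha, a, ha, Or.inl rfl, by omega,
      fun g => (Finset.card_filter_le _ _).trans hcard'⟩

lemma exists_lines_avoiding (A : Pt) (n : ℕ) (Y : Finset Pt) (hA : A ∉ Y)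
    (hcard : Y.card ≤ 2 * n) (hfib : ∀ g, (Y.filter (slopeFrom A · = g)).card ≤ n) :
    ∃ L : Multiset BivPoly, L.card ≤ n ∧ (∀ q ∈ L, q.totalDegree = 1 ∧ eval A q = 1) ∧
      ∀ B ∈ Y, ∃ q ∈ L, eval B q = 0 := by
  induction n generalizing Y with
  | zero =>
    have : Y = ∅ := Finset.card_eq_zero.mp (by omega)
    exact ⟨0, by simp [this]⟩
  | succ n ih =>
    rcases Y.eq_empty_or_nonempty with rfl | hY
    · exact ⟨0, by simp⟩
    obtain ⟨a, ha, b, hb, hab, hcard', hfib'⟩ :=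
      exists_pair_reducing_fibres (slopeFrom A) hY hcard hfib
    obtain ⟨L, hL, hlines, hcover⟩ := ih ((Y.erase a).erase b) (by simp [hA]) hcard' hfib'
    have haA : a ≠ A := fun h => hA (h ▸ ha)
    have hbA : b ≠ A := fun h => hA (h ▸ hb)
    obtain ⟨q, hq, hqA, hqa, hqb⟩ : ∃ q : BivPoly,
        q.totalDegree = 1 ∧ eval A q = 1 ∧ eval a q = 0 ∧ eval b q = 0 := by
      rcases hab with rfl | hab
      · obtain ⟨q, h₁, h₂, h₃⟩ := exists_line_through_point haA
        exact ⟨q, h₁, h₂, h₃, h₃⟩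
      · exact exists_line_through_pair haA hbA hab
    refine ⟨q ::ₘ L, by simpa using hL, ?_, fun B hB => ?_⟩
    · intro r hr
      rcases Multiset.mem_cons.mp hr with rfl | hr
      · exact ⟨hq, hqA⟩
      · exact hlines r hr
    · by_cases hBa : B = a
      · exact ⟨q, Multiset.mem_cons_self q L, hBa ▸ hqa⟩
      by_cases hBb : B = b
      · exact ⟨q, Multiset.mem_cons_self q L, hBb ▸ hqb⟩
      obtain ⟨r, hr, hrB⟩ := hcover B (by simp [hBa, hBb, hB])
      exact ⟨r, Multiset.mem_cons_of_mem hr, hrB⟩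

/-- The restriction of a bivariate polynomial to the line `t ↦ A + t v`. -/
def restrictToLine (A v : Pt) (p : BivPoly) : Polynomial ℝ :=
  aeval (fun i => Polynomial.C (A i) + Polynomial.C (v i) * Polynomial.X) p

lemma eval_restrictToLine (A v : Pt) (p : BivPoly) (t : ℝ) :
    (restrictToLine A v p).eval t = eval (A + t • v) p := by
  induction p using MvPolynomial.induction_on with
  | C a => simp [restrictToLine]
  | add p q hp hq => simpa [restrictToLine] using congrArg₂ (· + ·) hp hq
  | mul_X p i hp =>
    have := congrArg (· * (A i + t * v i)) hp
    simpa [restrictToLine, mul_comm (v i)] using this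

lemma natDegree_restrictToLine_le (A v : Pt) (p : BivPoly) :
    (restrictToLine A v p).natDegree ≤ p.totalDegree := by
  refine (aeval_natDegree_le p le_rfl _ fun i => ?_).trans_eq (mul_one _)
  rw [add_comm]
  exact Polynomial.natDegree_linear_le

lemma card_slope_fibre_le {n : ℕ} {X : Finset Pt} {A : Pt} {p : BivPoly}
    (hp : IsFundamental n X A p) (g : Option ℝ) :
    ((X.erase A).filter (slopeFrom A · = g)).card ≤ n := by
  obtain ⟨hdeg, hone, hzero⟩ := hp
  rcases ((X.erase A).filter (slopeFrom A · = g)).eq_empty_or_nonempty with he | ⟨B, hB⟩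
  · simp [he]
  obtain ⟨hBX, rfl⟩ := Finset.mem_filter.mp hB
  have hBA := (Finset.mem_erase.mp hBX).1
  have hparam : ∀ P ∈ (X.erase A).filter (slopeFrom A · = slopeFrom A B),
      ∃ t : ℝ, P = A + t • (B - A) := by
    intro P hP
    obtain ⟨hPX, hPB⟩ := Finset.mem_filter.mp hP
    rw [slopeFrom_eq_iff (Finset.mem_erase.mp hPX).1 hBA] at hPB
    rcases ne_iff_coord.mp hBA with h | h
    · have h' := sub_ne_zero.mpr h
      refine ⟨(P 0 - A 0) / (B 0 - A 0), ?_⟩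
      rw [funext_iff, Fin.forall_fin_two]
      constructor <;> simp <;> field_simp <;> linarith
    · have h' := sub_ne_zero.mpr h
      refine ⟨(P 1 - A 1) / (B 1 - A 1), ?_⟩
      rw [funext_iff, Fin.forall_fin_two]
      constructor <;> simp <;> field_simp <;> linarith
  choose! t ht using hparam
  let r := restrictToLine A (B - A) p
  have hr : r ≠ 0 := by
    intro h
    have := eval_restrictToLine A (B - A) p 0
    rw [show restrictToLine A (B - A) p = 0 from h] at this
    simp [hone] at this
  refine le_trans ?_ ((natDegree_restrictToLine_le A (B - A) p).trans hdeg)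
  refine le_trans ?_ (r.card_roots'.trans' r.roots.toFinset_card_le)
  refine Finset.card_le_card_of_injOn t (fun P hP => ?_) (fun P hP Q hQ h => ?_)
  · obtain ⟨hPA, hPX⟩ := Finset.mem_erase.mp (Finset.mem_filter.mp hP).1
    rw [Finset.mem_coe, Multiset.mem_toFinset, Polynomial.mem_roots hr, Polynomial.IsRoot.def,
      eval_restrictToLine, ← ht P hP]
    exact hzero P hPX hPA
  · rw [ht P hP, ht Q hQ, h]

/-- Every node of an `n`-independent set of at most `2n+1` nodes has an
`n`-fundamental polynomial which is a product of polynomials of degree 1. -/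
theorem fundamental_product_of_lines (n : ℕ) (hn : 1 ≤ n) (X : Finset Pt)
    (hind : IsIndependent n X) (hcard : X.card ≤ 2 * n + 1) :
    ∀ A ∈ X, ∃ p : BivPoly, IsFundamental n X A p ∧ IsProductOfLines p := by
  intro A hA
  obtain ⟨p, hp⟩ := hind A hA
  obtain ⟨L, hL, hlines, hcover⟩ := exists_lines_avoiding A n (X.erase A) (by simp)
    (by rw [Finset.card_erase_of_mem hA]; omega) (card_slope_fibre_le hp)
  refine ⟨L.prod, ⟨?_, ?_, fun B hB hBA => ?_⟩, L, fun q hq => (hlines q hq).1, rfl⟩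
  · refine (totalDegree_multiset_prod L).trans ?_
    rw [Multiset.map_congr rfl fun q hq => (hlines q hq).1]
    simpa using hL
  · rw [map_multiset_prod, Multiset.map_congr rfl fun q hq => (hlines q hq).2]
    simp
  · obtain ⟨q, hq, hqB⟩ := hcover B (Finset.mem_erase.mpr ⟨hBA, hB⟩)
    rw [map_multiset_prod]
    exact Multiset.prod_eq_zero (Multiset.mem_map.mpr ⟨q, hq, hqB⟩)
end
end

section
/- For every n ≥ 2 there exists an n-independent set X of nodes in ℝ² with #X = 2n+2 and a node A ∈ X such that no n-fundamental polynomial of A is a product of polynomials of degree 1; i.e., the conclusion of the previous theorem fails in general for n-independent node sets with at least 2n+2 nodes. -/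
open MvPolynomial
open scoped Classical

noncomputable section

/-- The point of the parabola `y = x²` with abscissa `x`. -/
def parabolaPt (x : ℝ) : Pt := ![x, x ^ 2]

/-- The univariate polynomial `p(x, x²)` obtained by restricting `p` to the parabola `y = x²`. -/
def restrictParabola : BivPoly →ₐ[ℝ] Polynomial ℝ :=
  aeval ![Polynomial.X, Polynomial.X ^ 2]

theorem eval_restrictParabola (p : BivPoly) (x : ℝ) :
    (restrictParabola p).eval x = eval (parabolaPt x) p := by
  induction p using MvPolynomial.induction_on with
  | C a => simp [restrictParabola]
  | add p q hp hq => simp [hp, hq]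
  | mul_X p i hp =>
    rw [map_mul, Polynomial.eval_mul, hp, map_mul]
    fin_cases i <;> simp [restrictParabola, parabolaPt]

theorem natDegree_restrictParabola_le (p : BivPoly) :
    (restrictParabola p).natDegree ≤ p.totalDegree * 2 := by
  refine aeval_natDegree_le p le_rfl _ fun i ↦ ?_
  fin_cases i <;> simp

theorem eq_affine_of_totalDegree_le_one {p : BivPoly} (hp : p.totalDegree ≤ 1) :
    ∃ a b c : ℝ, p = C a + C b * X 0 + C c * X 1 := by
  refine ⟨coeff 0 p, coeff (Finsupp.single 0 1) p, coeff (Finsupp.single 1 1) p, ?_⟩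
  ext m
  simp only [coeff_add, coeff_C_mul, coeff_C, coeff_X]
  by_cases h0 : m = 0
  · subst h0; simp
  by_cases h1 : m = Finsupp.single 0 1
  · subst h1; simp [Finsupp.single_left_inj, Ne.symm h0]
  by_cases h2 : m = Finsupp.single 1 1
  · subst h2; simp [Finsupp.single_left_inj, Ne.symm h0]
  rw [if_neg (Ne.symm h0), if_neg (Ne.symm h1), if_neg (Ne.symm h2)]
  simp only [mul_zero, add_zero]
  by_contra hm
  have hle := (le_totalDegree (mem_support_iff.2 hm)).trans hp
  rw [Finsupp.sum_fintype _ _ fun _ ↦ rfl, Fin.sum_univ_two] at hle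
  have hcases : (m 0 = 0 ∧ m 1 = 0) ∨ (m 0 = 1 ∧ m 1 = 0) ∨ (m 0 = 0 ∧ m 1 = 1) := by omega
  rcases hcases with ⟨h, h'⟩ | ⟨h, h'⟩ | ⟨h, h'⟩
  · exact h0 (by ext i; fin_cases i <;> simp [h, h'])
  · exact h1 (by ext i; fin_cases i <;> simp [h, h'])
  · exact h2 (by ext i; fin_cases i <;> simp [h, h'])

/-- No line is contained in the parabola. -/
theorem restrictParabola_ne_zero {q : BivPoly} (hq : q.totalDegree = 1) :
    restrictParabola q ≠ 0 := by
  intro h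
  obtain ⟨a, b, c, rfl⟩ := eq_affine_of_totalDegree_le_one hq.le
  have key (x : ℝ) : a + b * x + c * x ^ 2 = 0 := by
    have hx := eval_restrictParabola (C a + C b * X 0 + C c * X 1) x
    rw [h] at hx
    simpa [parabolaPt] using hx.symm
  have ha : a = 0 := by linarith [key 0]
  have hb : b = 0 := by linarith [key 1, key (-1)]
  have hc : c = 0 := by linarith [key 1]
  simp [ha, hb, hc] at hq

/-- Every univariate polynomial of degree at most `2n` is the restriction to the parabola of a
bivariate polynomial of total degree at most `n`. -/
theorem exists_totalDegree_le_eval_parabolaPt (f : Polynomial ℝ) (n : ℕ)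
    (hf : f.natDegree ≤ 2 * n) :
    ∃ g : BivPoly, g.totalDegree ≤ n ∧ ∀ x, eval (parabolaPt x) g = f.eval x := by
  refine ⟨∑ k ∈ Finset.range (f.natDegree + 1), C (f.coeff k) * (X 1 ^ (k / 2) * X 0 ^ (k % 2)),
    (totalDegree_finsetSum _ _).trans (Finset.sup_le fun k hk ↦ ?_), fun x ↦ ?_⟩
  · rw [Finset.mem_range] at hk
    refine (totalDegree_mul _ _).trans ?_
    rw [totalDegree_C, zero_add]
    refine (totalDegree_mul _ _).trans ?_
    rw [totalDegree_X_pow, totalDegree_X_pow]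
    omega
  · rw [Polynomial.eval_eq_sum_range, map_sum]
    refine Finset.sum_congr rfl fun k _ ↦ ?_
    simp only [map_mul, map_pow, eval_C, eval_X, parabolaPt, Matrix.cons_val_zero,
      Matrix.cons_val_one]
    rw [← pow_mul, ← pow_add, Nat.div_add_mod]

/-- For every `n ≥ 2` there is an `n`-independent set of `2n+2` nodes with a node
none of whose `n`-fundamental polynomials is a product of degree-1 polynomials. -/
theorem exists_independent_no_line_product (n : ℕ) (hn : 2 ≤ n) :
    ∃ (X : Finset Pt) (A : Pt), A ∈ X ∧ X.card = 2 * n + 2 ∧ IsIndependent n X ∧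
      ∀ p : BivPoly, IsFundamental n X A p → ¬ IsProductOfLines p := by
  set s : Finset ℕ := Finset.range (2 * n + 1)
  have hA (x : ℝ) : parabolaPt x ≠ ![0, 1] := fun h ↦ by
    have h0 : x = 0 := congrFun h 0
    have h1 : x ^ 2 = 1 := congrFun h 1
    simp [h0] at h1
  have hinj : Function.Injective fun i : ℕ ↦ parabolaPt (i : ℝ) := fun i j h ↦
    Nat.cast_injective (R := ℝ) (congrFun h 0)
  have hmem : ![0, 1] ∉ s.image fun i : ℕ ↦ parabolaPt (i : ℝ) := by
    simp only [Finset.mem_image, not_exists, not_and]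
    exact fun i _ ↦ hA i
  have hconic : (X 1 - X 0 ^ 2 : BivPoly).totalDegree ≤ n := by
    refine (totalDegree_sub _ _).trans (max_le ?_ ?_)
    · rw [totalDegree_X]; omega
    · rw [totalDegree_X_pow]; exact hn
  have hconic_eval (x : ℝ) : eval (parabolaPt x) (X 1 - X 0 ^ 2 : BivPoly) = 0 := by
    simp [parabolaPt]
  refine ⟨insert ![0, 1] (s.image fun i : ℕ ↦ parabolaPt (i : ℝ)), ![0, 1],
    Finset.mem_insert_self _ _, ?_, ?_, ?_⟩
  · rw [Finset.card_insert_of_notMem hmem, Finset.card_image_of_injective _ hinj,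
      Finset.card_range]
  · intro B hB
    rcases Finset.mem_insert.1 hB with rfl | hB
    · refine ⟨X 1 - X 0 ^ 2, hconic, by simp, fun B hB hne ↦ ?_⟩
      obtain ⟨i, -, rfl⟩ := Finset.mem_image.1 ((Finset.mem_insert.1 hB).resolve_left hne)
      exact hconic_eval i
    · obtain ⟨i, hi, rfl⟩ := Finset.mem_image.1 hB
      have hcast : Set.InjOn (fun j : ℕ ↦ (j : ℝ)) s := Nat.cast_injective.injOn
      obtain ⟨g, hg, hgeval⟩ := exists_totalDegree_le_eval_parabolaPt
        (Lagrange.basis s (fun j : ℕ ↦ (j : ℝ)) i) n (by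
          rw [Lagrange.natDegree_basis hcast hi, Finset.card_range]; omega)
      refine ⟨g - C (eval ![0, 1] g) * (X 1 - X 0 ^ 2), ?_, ?_, fun B hB hne ↦ ?_⟩
      · refine (totalDegree_sub _ _).trans (max_le hg ((totalDegree_mul _ _).trans ?_))
        rwa [totalDegree_C, zero_add]
      · rw [map_sub, map_mul, hconic_eval, mul_zero, sub_zero, hgeval]
        exact Lagrange.eval_basis_self hcast hi
      · rcases Finset.mem_insert.1 hB with rfl | hB
        · simp
        · obtain ⟨j, hj, rfl⟩ := Finset.mem_image.1 hB
          rw [map_sub, map_mul, hconic_eval, mul_zero, sub_zero, hgeval]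
          exact Lagrange.eval_basis_of_ne (v := fun j : ℕ ↦ (j : ℝ))
            (fun h ↦ hne (by rw [h])) hj
  · rintro p ⟨hdeg, -, hzero⟩ ⟨L, hL, rfl⟩
    have hres : restrictParabola L.prod = 0 := by
      refine Polynomial.eq_zero_of_natDegree_lt_card_of_eval_eq_zero' _
        (s.image fun i : ℕ ↦ (i : ℝ)) (fun x hx ↦ ?_) ?_
      · obtain ⟨i, hi, rfl⟩ := Finset.mem_image.1 hx
        rw [eval_restrictParabola]
        exact hzero _ (Finset.mem_insert_of_mem (Finset.mem_image_of_mem _ hi)) (hA i)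
      · rw [Finset.card_image_of_injective _ Nat.cast_injective, Finset.card_range]
        have := natDegree_restrictParabola_le L.prod
        omega
    rw [map_multiset_prod, Multiset.prod_eq_zero_iff, Multiset.mem_map] at hres
    obtain ⟨q, hq, hq0⟩ := hres
    exact restrictParabola_ne_zero (hL q hq) hq0
end
end

section
/- Let n ≥ 1, let X be a finite set of nodes in ℝ² with #X ≤ 2n+1, and let A ∈ X. Then the following three statements are equivalent: (i) the node A has an n-fundamental polynomial; (ii) the node A has an n-fundamental polynomial which is a product of polynomials of degree 1; (iii) there is no line containing A together with at least n+1 nodes of X \ {A} (i.e., no n+1 nodes of X \ {A} are collinear together with A). -/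
open MvPolynomial
open scoped Classical

noncomputable section

/-- A finite set of at most `2 * n` elements whose `f`-fibres have at most `n` elements is covered
by `n` pairs, each either degenerate or separated by `f`. -/
theorem exists_cover_by_separated_pairs {α β : Type*} (f : α → β) (n : ℕ) (s : Finset α)
    (hs : s.card ≤ 2 * n) (hf : ∀ b, (s.filter (f · = b)).card ≤ n) :
    ∃ P : Multiset (α × α), P.card ≤ n ∧
      (∀ e ∈ P, e.1 ∈ s ∧ e.2 ∈ s ∧ (e.1 = e.2 ∨ f e.1 ≠ f e.2)) ∧
      ∀ x ∈ s, ∃ e ∈ P, x = e.1 ∨ x = e.2 := by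
  induction n generalizing s with
  | zero =>
    obtain rfl : s = ∅ := Finset.card_eq_zero.mp (by omega)
    exact ⟨0, by simp⟩
  | succ n ih =>
    obtain rfl | hne := s.eq_empty_or_nonempty
    · exact ⟨0, by simp⟩
    suffices h : ∃ a ∈ s, ∃ b ∈ s, (a = b ∨ f a ≠ f b) ∧ ((s.erase a).erase b).card ≤ 2 * n ∧
        ∀ c, (((s.erase a).erase b).filter (f · = c)).card ≤ n by
      obtain ⟨a, ha, b, hb, hab, hcard, hfib⟩ := h
      obtain ⟨P, hP, hPs, hcov⟩ := ih _ hcard hfib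
      refine ⟨(a, b) ::ₘ P, by simpa using hP, ?_, fun x hx => ?_⟩
      · intro e he
        rcases Multiset.mem_cons.mp he with rfl | he
        · exact ⟨ha, hb, hab⟩
        · obtain ⟨h₁, h₂, h₃⟩ := hPs e he
          exact ⟨Finset.mem_of_mem_erase (Finset.mem_of_mem_erase h₁),
            Finset.mem_of_mem_erase (Finset.mem_of_mem_erase h₂), h₃⟩
      · by_cases hxab : x = a ∨ x = b
        · exact ⟨(a, b), Multiset.mem_cons_self _ _, hxab⟩
        · obtain ⟨e, he, hxe⟩ := hcov x (by simp_all)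
          exact ⟨e, Multiset.mem_cons_of_mem he, hxe⟩
    obtain ⟨a, ha, hamax⟩ := s.exists_max_image (fun x => (s.filter (f · = f x)).card) hne
    obtain hempty | hne' := (s.filter (f · ≠ f a)).eq_empty_or_nonempty
    · have hall : s.filter (f · = f a) = s :=
        Finset.filter_true_of_mem fun x hx => by
          simpa using Finset.filter_eq_empty_iff.mp hempty hx
      have hsn : s.card ≤ n + 1 := hall ▸ hf (f a)
      have herase : ((s.erase a).erase a).card ≤ n := by
        rw [Finset.erase_idem, Finset.card_erase_of_mem ha]
        omega
      exact ⟨a, ha, a, ha, Or.inl rfl, by omega,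
        fun c => (Finset.card_filter_le _ _).trans herase⟩
    · obtain ⟨b, hb, hbmax⟩ :=
        (s.filter (f · ≠ f a)).exists_max_image (fun x => (s.filter (f · = f x)).card) hne'
      obtain ⟨hbs, hba⟩ := Finset.mem_filter.mp hb
      have hbea : b ∈ s.erase a := Finset.mem_erase.mpr ⟨fun h => hba (h ▸ rfl), hbs⟩
      refine ⟨a, ha, b, hbs, Or.inr (Ne.symm hba), ?_, fun c => ?_⟩
      · rw [Finset.card_erase_of_mem hbea, Finset.card_erase_of_mem ha]
        omega
      have hsub : ((s.erase a).erase b).filter (f · = c) ⊆ s.filter (f · = c) :=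
        Finset.filter_subset_filter _ ((Finset.erase_subset _ _).trans (Finset.erase_subset _ _))
      by_cases hc : f a = c ∨ f b = c
      · have hlt : (((s.erase a).erase b).filter (f · = c)).card < (s.filter (f · = c)).card := by
          apply Finset.card_lt_card
          refine (Finset.ssubset_iff_of_subset hsub).mpr ?_
          rcases hc with hc | hc
          · exact ⟨a, by simp [ha, hc], by simp⟩
          · exact ⟨b, by simp [hbs, hc], by simp⟩
        have := hf c
        omega
      · push Not at hc
        refine (Finset.card_le_card hsub).trans ?_
        obtain h0 | ⟨x, hx⟩ := (s.filter (f · = c)).eq_empty_or_nonempty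
        · simp [h0]
        obtain ⟨hxs, rfl⟩ := Finset.mem_filter.mp hx
        have h₁ := hamax b hbs
        have h₂ := hbmax x (Finset.mem_filter.mpr ⟨hxs, hc.1.symm⟩)
        have h₃ : (s.filter (f · = f a)).card + (s.filter (f · = f b)).card +
            (s.filter (f · = f x)).card ≤ s.card := by
          rw [← Finset.card_union_of_disjoint, ← Finset.card_union_of_disjoint]
          · apply Finset.card_le_card
            simp [Finset.union_subset_iff]
          · rw [Finset.disjoint_left]
            intro y hy hy'
            simp only [Finset.mem_union, Finset.mem_filter] at hy hy'
            rcases hy with hy | hy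
            · exact hc.1 (hy.2.symm.trans hy'.2)
            · exact hc.2 (hy.2.symm.trans hy'.2)
          · rw [Finset.disjoint_left]
            intro y hy hy'
            exact hba ((Finset.mem_filter.mp hy').2.symm.trans (Finset.mem_filter.mp hy).2)
        omega

/-- In the plane, vectors with vanishing determinant are proportional. -/
theorem mem_span_singleton_of_det_eq_zero {b c : Pt} (hc : c ≠ 0)
    (h : b 0 * c 1 - b 1 * c 0 = 0) : b ∈ Submodule.span ℝ {c} := by
  have hpos : c 0 ^ 2 + c 1 ^ 2 ≠ 0 := by
    intro h0
    apply hc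
    ext i
    fin_cases i
    · change c 0 = 0
      nlinarith [sq_nonneg (c 0), sq_nonneg (c 1)]
    · change c 1 = 0
      nlinarith [sq_nonneg (c 0), sq_nonneg (c 1)]
  refine Submodule.mem_span_singleton.mpr
    ⟨(b 0 * c 0 + b 1 * c 1) / (c 0 ^ 2 + c 1 ^ 2), ?_⟩
  ext i
  fin_cases i
  · change _ * c 0 = b 0
    field_simp
    linear_combination -c 1 * h
  · change _ * c 1 = b 1
    field_simp
    linear_combination c 0 * h

theorem det_ne_zero_of_span_singleton_ne {b c : Pt} (hb : b ≠ 0) (hc : c ≠ 0)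
    (h : Submodule.span ℝ {b} ≠ Submodule.span ℝ {c}) : b 0 * c 1 - b 1 * c 0 ≠ 0 := by
  intro h0
  apply h
  apply le_antisymm <;> rw [Submodule.span_singleton_le_iff_mem]
  · exact mem_span_singleton_of_det_eq_zero hc h0
  · exact mem_span_singleton_of_det_eq_zero hb (by linear_combination -h0)

/-- An affine function with value `1` at `A` and a zero is given by a polynomial of degree `1`. -/
theorem exists_totalDegree_eq_one_of_affine (A B : Pt) (u w : ℝ)
    (hB : u * (B 0 - A 0) + w * (B 1 - A 1) = 1) :
    ∃ q : BivPoly, q.totalDegree = 1 ∧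
      ∀ x : Pt, eval x q = 1 - (u * (x 0 - A 0) + w * (x 1 - A 1)) := by
  set q : BivPoly := C (1 + u * A 0 + w * A 1) - (C u * X 0 + C w * X 1) with hq
  have heval : ∀ x : Pt, eval x q = 1 - (u * (x 0 - A 0) + w * (x 1 - A 1)) := by
    intro x
    simp only [hq, map_sub, map_add, map_mul, eval_C, eval_X]
    ring
  refine ⟨q, le_antisymm ?_ ?_, heval⟩
  · have hmon : ∀ (r : ℝ) (i : Fin 2), (C r * X i : BivPoly).totalDegree ≤ 1 := fun r i =>
      (totalDegree_mul _ _).trans (by simp)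
    refine (totalDegree_sub _ _).trans (max_le (by simp only [totalDegree_C, zero_le]) ?_)
    exact (totalDegree_add _ _).trans (max_le (hmon _ _) (hmon _ _))
  · rw [Nat.one_le_iff_ne_zero]
    intro h0
    rw [totalDegree_eq_zero_iff_eq_C] at h0
    have hA' := heval A
    have hB' := heval B
    rw [h0, eval_C] at hA' hB'
    rw [hA', hB] at hB'
    exact absurd hB' (by norm_num)

/-- If `B` and `D` coincide or are seen from `A` in different directions, some line through
both of them misses `A`. -/
theorem exists_line_through_pair_s2 {A B D : Pt} (hB : B ≠ A) (hD : D ≠ A)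
    (h : B = D ∨ Submodule.span ℝ {B - A} ≠ Submodule.span ℝ {D - A}) :
    ∃ q : BivPoly, q.totalDegree = 1 ∧ eval A q = 1 ∧ eval B q = 0 ∧ eval D q = 0 := by
  suffices h' : ∃ u w : ℝ, u * (B 0 - A 0) + w * (B 1 - A 1) = 1 ∧
      u * (D 0 - A 0) + w * (D 1 - A 1) = 1 by
    obtain ⟨u, w, hB', hD'⟩ := h'
    obtain ⟨q, hq, heval⟩ := exists_totalDegree_eq_one_of_affine A B u w hB'
    exact ⟨q, hq, by simp [heval], by simp [heval, hB'], by simp [heval, hD']⟩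
  rcases h with rfl | h
  · have hne : B 0 - A 0 ≠ 0 ∨ B 1 - A 1 ≠ 0 := by
      by_contra! h0
      apply hB
      ext i
      fin_cases i
      · exact sub_eq_zero.mp h0.1
      · exact sub_eq_zero.mp h0.2
    rcases hne with hne | hne
    · exact ⟨(B 0 - A 0)⁻¹, 0, by simp [hne], by simp [hne]⟩
    · exact ⟨0, (B 1 - A 1)⁻¹, by simp [hne], by simp [hne]⟩
  · have hdet := det_ne_zero_of_span_singleton_ne (sub_ne_zero.mpr hB) (sub_ne_zero.mpr hD) h
    simp only [Pi.sub_apply] at hdet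
    set d := (B 0 - A 0) * (D 1 - A 1) - (B 1 - A 1) * (D 0 - A 0)
    refine ⟨((D 1 - A 1) - (B 1 - A 1)) / d, ((B 0 - A 0) - (D 0 - A 0)) / d, ?_, ?_⟩
    · rw [div_mul_eq_mul_div, div_mul_eq_mul_div, ← add_div, div_eq_one_iff_eq hdet]
      ring
    · rw [div_mul_eq_mul_div, div_mul_eq_mul_div, ← add_div, div_eq_one_iff_eq hdet]
      ring

/-- Points seen from `A` in the same direction are collinear together with `A`. -/
theorem collinear_insert_of_span_singleton_eq {A : Pt} {S : Set Pt} {K : Submodule ℝ Pt}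
    (hS : ∀ B ∈ S, Submodule.span ℝ {B - A} = K) : Collinear ℝ (insert A S) := by
  rw [collinear_iff_of_mem (Set.mem_insert A S)]
  obtain rfl | ⟨D, hD⟩ := S.eq_empty_or_nonempty
  · exact ⟨0, by simp⟩
  refine ⟨D - A, fun B hB => ?_⟩
  rcases hB with rfl | hB
  · exact ⟨0, by simp⟩
  · have hmem : B - A ∈ Submodule.span ℝ {D - A} := by
      rw [hS D hD, ← hS B hB]
      exact Submodule.mem_span_singleton_self _
    obtain ⟨r, hr⟩ := Submodule.mem_span_singleton.mp hmem
    exact ⟨r, by rw [hr, vadd_eq_add, sub_add_cancel]⟩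

theorem exists_isFundamental_isProductOfLines {n : ℕ} {X : Finset Pt} {A : Pt} (hA : A ∈ X)
    (hcard : X.card ≤ 2 * n + 1)
    (h : ¬ ∃ S ⊆ X.erase A, n + 1 ≤ S.card ∧ Collinear ℝ (insert A (S : Set Pt))) :
    ∃ p : BivPoly, IsFundamental n X A p ∧ IsProductOfLines p := by
  obtain ⟨P, hPn, hP, hcov⟩ := exists_cover_by_separated_pairs
    (fun B : Pt => Submodule.span ℝ {B - A}) n (X.erase A)
    (by rw [Finset.card_erase_of_mem hA]; omega)
    (fun K => by
      by_contra! hK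
      refine h ⟨_, Finset.filter_subset _ _, hK, ?_⟩
      exact collinear_insert_of_span_singleton_eq (K := K) fun B hB =>
        (Finset.mem_filter.mp (Finset.mem_coe.mp hB)).2)
  have hline : ∀ e : Pt × Pt, ∃ q : BivPoly, e ∈ P →
      q.totalDegree = 1 ∧ eval A q = 1 ∧ eval e.1 q = 0 ∧ eval e.2 q = 0 := by
    intro e
    by_cases he : e ∈ P
    · obtain ⟨h₁, h₂, h₃⟩ := hP e he
      obtain ⟨q, hq⟩ := exists_line_through_pair_s2 (Finset.ne_of_mem_erase h₁)
        (Finset.ne_of_mem_erase h₂) h₃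
      exact ⟨q, fun _ => hq⟩
    · exact ⟨0, fun h => absurd h he⟩
  choose q hq using hline
  refine ⟨(P.map q).prod, ⟨?_, ?_, fun B hB hBA => ?_⟩, P.map q, ?_, rfl⟩
  · refine (totalDegree_multiset_prod _).trans ?_
    rw [Multiset.map_map,
      Multiset.map_congr (f := totalDegree ∘ q) (g := fun _ => 1) rfl (fun e he => (hq e he).1)]
    simpa using hPn
  · rw [map_multiset_prod, Multiset.map_map,
      Multiset.map_congr (f := eval A ∘ q) (g := fun _ => 1) rfl (fun e he => (hq e he).2.1)]
    simp
  · obtain ⟨e, he, hBe⟩ := hcov B (Finset.mem_erase.mpr ⟨hBA, hB⟩)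
    rw [map_multiset_prod, Multiset.map_map]
    refine Multiset.prod_eq_zero (Multiset.mem_map.mpr ⟨e, he, ?_⟩)
    rcases hBe with rfl | rfl
    · exact (hq e he).2.2.1
    · exact (hq e he).2.2.2
  · intro r hr
    obtain ⟨e, he, rfl⟩ := Multiset.mem_map.mp hr
    exact (hq e he).1

/-- A polynomial of degree at most `n` vanishing at `n + 1` points of a line vanishes on it. -/
theorem eval_eq_zero_of_collinear {n : ℕ} {p : BivPoly} (hp : p.totalDegree ≤ n) {A : Pt}
    {S : Finset Pt} (hS : n + 1 ≤ S.card) (hcol : Collinear ℝ (insert A (S : Set Pt)))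
    (hzero : ∀ B ∈ S, eval B p = 0) : eval A p = 0 := by
  obtain ⟨v, hv⟩ := (collinear_iff_of_mem (Set.mem_insert A _)).mp hcol
  have hv' : ∀ B : S, ∃ r : ℝ, (B : Pt) = r • v + A := fun B => by
    simpa using hv B (Set.mem_insert_of_mem _ B.2)
  choose t ht using hv'
  set g : Polynomial ℝ :=
    aeval (fun i => Polynomial.C (v i) * Polynomial.X + Polynomial.C (A i)) p with hg
  have heval : ∀ r : ℝ, g.eval r = eval (r • v + A) p := by
    intro r
    rw [hg, ← Polynomial.coe_aeval_eq_eval, ← MvPolynomial.aeval_eq_eval]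
    change ((Polynomial.aeval r).comp (aeval _)) p = _
    rw [MvPolynomial.comp_aeval]
    congr 2
    ext i
    simp only [map_add, map_mul, Polynomial.aeval_C, Polynomial.aeval_X, Algebra.algebraMap_self,
      RingHom.id_apply, Pi.add_apply, Pi.smul_apply, smul_eq_mul]
    ring
  have hdeg : g.natDegree ≤ n := by
    simpa using MvPolynomial.aeval_natDegree_le (n := 1) p hp _
      fun i => Polynomial.natDegree_linear_le
  have hinj : Function.Injective t := fun B D hBD => Subtype.ext (by rw [ht B, ht D, hBD])
  have hg0 : g = 0 :=
    Polynomial.eq_zero_of_natDegree_lt_card_of_eval_eq_zero g hinj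
      (fun B => by rw [heval, ← ht B]; exact hzero B B.2)
      (by rw [Fintype.card_coe]; omega)
  have h0 := heval 0
  rw [hg0] at h0
  simpa using h0.symm

/-- For a node set of at most `2n+1` nodes the following are equivalent:
(i) `A` has an `n`-fundamental polynomial; (ii) `A` has an `n`-fundamental polynomial
which is a product of degree-1 polynomials; (iii) no `n+1` nodes of `X \ {A}` are
collinear together with `A`. -/
theorem fundamental_tfae_lines (n : ℕ) (hn : 1 ≤ n) (X : Finset Pt)
    (hcard : X.card ≤ 2 * n + 1) (A : Pt) (hA : A ∈ X) :
    ((∃ p : BivPoly, IsFundamental n X A p) ↔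
      (∃ p : BivPoly, IsFundamental n X A p ∧ IsProductOfLines p)) ∧
    ((∃ p : BivPoly, IsFundamental n X A p) ↔
      ¬ ∃ S ⊆ X.erase A, n + 1 ≤ S.card ∧ Collinear ℝ (insert A (S : Set Pt))) := by
  have hnec : (∃ p : BivPoly, IsFundamental n X A p) →
      ¬ ∃ S ⊆ X.erase A, n + 1 ≤ S.card ∧ Collinear ℝ (insert A (S : Set Pt)) := by
    rintro ⟨p, hdeg, hpA, hpX⟩ ⟨S, hSX, hS, hcol⟩
    have h0 : eval A p = 0 := eval_eq_zero_of_collinear hdeg hS hcol fun B hB =>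
      hpX B (Finset.mem_of_mem_erase (hSX hB)) (Finset.ne_of_mem_erase (hSX hB))
    exact one_ne_zero (hpA.symm.trans h0)
  have hsuff := exists_isFundamental_isProductOfLines hA hcard
  exact ⟨⟨fun h => hsuff (hnec h), fun ⟨p, hp, _⟩ => ⟨p, hp⟩⟩,
    ⟨hnec, fun h => (hsuff h).imp fun _ hp => hp.1⟩⟩
end
end

section
/- Let n ≥ 1, let X be a finite set of nodes in ℝ² with #X ≤ 2n+1, and let A ∈ X. If no n+1 nodes of X \ {A} are collinear together with A (i.e., no affine line contains A and at least n+1 points of X \ {A}), then A has an n-fundamental polynomial which is a product of polynomials of degree 1. -/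
open MvPolynomial
open scoped Classical

noncomputable section

/-- If a nonempty set of at most `2 (n + 1)` coloured points has no colour class of more than
`n + 1` points, then one can remove a point, or two points of distinct colours, so that at most
`2 n` points are left and no colour class has more than `n` points. -/
lemma exists_pair_card_filter_erase_le {α β : Type*} [DecidableEq α] [DecidableEq β]
    (c : α → β) (n : ℕ) (Y : Finset α) (hY : Y.Nonempty) (hcard : Y.card ≤ 2 * (n + 1))
    (hc : ∀ k, (Y.filter (c · = k)).card ≤ n + 1) :
    ∃ a ∈ Y, ∃ b ∈ Y, (a = b ∨ c a ≠ c b) ∧ ((Y.erase a).erase b).card ≤ 2 * n ∧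
      ∀ k, (((Y.erase a).erase b).filter (c · = k)).card ≤ n := by
  obtain ⟨a, ha, hamax⟩ := Y.exists_max_image (fun x => (Y.filter (c · = c x)).card) hY
  have hle : ∀ (x y : α) (k : β),
      (((Y.erase x).erase y).filter (c · = k)).card ≤ (Y.filter (c · = k)).card := fun x y k =>
    Finset.card_le_card (Finset.filter_subset_filter _
      ((Finset.erase_subset _ _).trans (Finset.erase_subset _ _)))
  have hlt : ∀ (x y z : α), z ∈ Y → z = x ∨ z = y →
      (((Y.erase x).erase y).filter (c · = c z)).card < (Y.filter (c · = c z)).card := by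
    intro x y z hz hxy
    apply Finset.card_lt_card
    rw [Finset.ssubset_iff_of_subset (Finset.filter_subset_filter _
      ((Finset.erase_subset _ _).trans (Finset.erase_subset _ _)))]
    refine ⟨z, by simp [hz], ?_⟩
    rcases hxy with rfl | rfl <;> simp
  by_cases hZ : (Y.filter (c · ≠ c a)).Nonempty
  · obtain ⟨b, hb, hbmax⟩ :=
      (Y.filter (c · ≠ c a)).exists_max_image (fun x => (Y.filter (c · = c x)).card) hZ
    rw [Finset.mem_filter] at hb
    obtain ⟨hbY, hab⟩ := hb
    have hba : b ≠ a := fun h => hab (by rw [h])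
    refine ⟨a, ha, b, hbY, Or.inr (Ne.symm hab), ?_, fun k => ?_⟩
    · rw [Finset.card_erase_of_mem (by simp [hba, hbY]), Finset.card_erase_of_mem ha]
      omega
    · by_cases hka : k = c a
      · subst hka
        have := hlt a b a ha (Or.inl rfl)
        have := hc (c a)
        omega
      by_cases hkb : k = c b
      · subst hkb
        have := hlt a b b hbY (Or.inr rfl)
        have := hc (c b)
        omega
      refine (hle a b k).trans ?_
      by_contra! hk
      obtain ⟨d, hd⟩ : (Y.filter (c · = k)).Nonempty := Finset.card_pos.mp (by omega)
      rw [Finset.mem_filter] at hd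
      obtain ⟨hdY, rfl⟩ := hd
      have h₁ := hamax d hdY
      have h₂ := hbmax d (by simp [hdY, hka])
      have hsum : (∑ k ∈ {c a, c b, c d}, (Y.filter (c · = k)).card) ≤ Y.card := by
        rw [← Finset.card_biUnion]
        · exact Finset.card_le_card (by
            intro x hx
            simp only [Finset.mem_biUnion, Finset.mem_filter] at hx
            obtain ⟨_, _, h, _⟩ := hx
            exact h)
        · intro i _ j _ hij
          refine Finset.disjoint_left.mpr fun x hx hx' => ?_
          rw [Finset.mem_filter] at hx hx'
          exact hij (hx.2.symm.trans hx'.2)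
      rw [Finset.sum_insert (by simp [Ne.symm hab, Ne.symm hka]),
        Finset.sum_insert (by simpa using Ne.symm hkb), Finset.sum_singleton] at hsum
      omega
  · have hall : ∀ x ∈ Y, c x = c a := by
      intro x hx
      by_contra h
      exact hZ ⟨x, by simp [hx, h]⟩
    have hYa : Y.card ≤ n + 1 := by
      have := hc (c a)
      rwa [Finset.filter_true_of_mem hall] at this
    have hcard' : ((Y.erase a).erase a).card ≤ n := by
      rw [Finset.erase_idem, Finset.card_erase_of_mem ha]
      omega
    exact ⟨a, ha, a, ha, Or.inl rfl, by omega,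
      fun k => (Finset.card_filter_le _ _).trans hcard'⟩

/-- A polynomial of total degree at most one which vanishes at some point but not at `A` can be
rescaled to a polynomial of total degree one with value `1` at `A`. -/
lemma exists_totalDegree_eq_one_eval_eq_one {A a : Pt} {q : BivPoly} (hq : q.totalDegree ≤ 1)
    (ha : eval a q = 0) (hA : eval A q ≠ 0) :
    ∃ p : BivPoly, p.totalDegree = 1 ∧ eval A p = 1 ∧ ∀ B, eval B q = 0 → eval B p = 0 := by
  have hA' : eval A (C (eval A q)⁻¹ * q) = 1 := by simp [hA]
  refine ⟨C (eval A q)⁻¹ * q, ?_, hA', fun B hB => by simp [hB]⟩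
  have hle : (C (eval A q)⁻¹ * q).totalDegree ≤ 1 :=
    (totalDegree_mul _ _).trans (by simpa using hq)
  refine le_antisymm hle (Nat.one_le_iff_ne_zero.mpr fun h0 => ?_)
  rw [totalDegree_eq_zero_iff_eq_C] at h0
  have ha' : eval a (C (eval A q)⁻¹ * q) = 0 := by simp [ha]
  rw [h0, eval_C] at hA' ha'
  exact one_ne_zero (hA'.symm.trans ha')

/-- The polynomial `u (x - a₀) + v (y - a₁)` has total degree at most one. -/
lemma totalDegree_linear_le (u v : ℝ) (a : Pt) :
    (C u * (X 0 - C (a 0)) + C v * (X 1 - C (a 1)) : BivPoly).totalDegree ≤ 1 := by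
  have h : ∀ (u : ℝ) (i : Fin 2), (C u * (X i - C (a i)) : BivPoly).totalDegree ≤ 1 := by
    intro u i
    refine (totalDegree_mul _ _).trans ?_
    rw [totalDegree_C, zero_add]
    exact (totalDegree_sub_C_le _ _).trans (totalDegree_X i).le
  exact (totalDegree_add _ _).trans (max_le (h u 0) (h v 1))

/-- Two nonzero plane vectors with vanishing determinant span the same line. -/
lemma span_singleton_eq_of_det_eq_zero {v w : Pt} (hv : v ≠ 0) (hw : w ≠ 0)
    (h : v 0 * w 1 - v 1 * w 0 = 0) : Submodule.span ℝ {v} = Submodule.span ℝ {w} := by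
  have key : ∀ {v w : Pt}, v ≠ 0 → v 0 * w 1 - v 1 * w 0 = 0 →
      Submodule.span ℝ {w} ≤ Submodule.span ℝ {v} := by
    intro v w hv h
    rw [Submodule.span_singleton_le_iff_mem, Submodule.mem_span_singleton]
    by_cases h0 : v 0 = 0
    · have h1 : v 1 ≠ 0 := fun h1 => hv (by ext i; fin_cases i <;> simp [h0, h1])
      have hw0 : w 0 = 0 := by simpa [h0, h1] using h
      refine ⟨w 1 / v 1, ?_⟩
      ext i
      fin_cases i <;> simp [h0, h1, hw0]
    · refine ⟨w 0 / v 0, ?_⟩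
      ext i
      fin_cases i
      · simp [h0]
      · simp only [Fin.mk_one, Pi.smul_apply, smul_eq_mul]
        field_simp
        linarith
  exact le_antisymm (key hw (by linarith)) (key hv h)

/-- If `a` and `b` are distinct from `A`, and either coincide or are seen from `A` in different
directions, then some line through `a` and `b` misses `A`. -/
lemma exists_line_through_avoiding {A a b : Pt} (ha : a ≠ A) (hb : b ≠ A)
    (hab : a = b ∨ Submodule.span ℝ {a - A} ≠ Submodule.span ℝ {b - A}) :
    ∃ p : BivPoly, p.totalDegree = 1 ∧ eval A p = 1 ∧ eval a p = 0 ∧ eval b p = 0 := by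
  suffices ∃ u v : ℝ, u * (A 0 - a 0) + v * (A 1 - a 1) ≠ 0 ∧
      u * (b 0 - a 0) + v * (b 1 - a 1) = 0 by
    obtain ⟨u, v, hA, hb⟩ := this
    obtain ⟨p, hp, hpA, hp0⟩ := exists_totalDegree_eq_one_eval_eq_one (A := A) (a := a)
      (totalDegree_linear_le u v a) (by simp) (by simpa using hA)
    exact ⟨p, hp, hpA, hp0 a (by simp), hp0 b (by simpa using hb)⟩
  rcases hab with rfl | hab
  · refine ⟨A 0 - a 0, A 1 - a 1, fun h => ha ?_, by simp⟩
    have h0 : A 0 - a 0 = 0 := by nlinarith [sq_nonneg (A 0 - a 0), sq_nonneg (A 1 - a 1)]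
    have h1 : A 1 - a 1 = 0 := by nlinarith [sq_nonneg (A 0 - a 0), sq_nonneg (A 1 - a 1)]
    ext i
    fin_cases i
    · exact (sub_eq_zero.mp h0).symm
    · exact (sub_eq_zero.mp h1).symm
  · refine ⟨b 1 - a 1, -(b 0 - a 0), fun h => hab ?_, by ring⟩
    refine span_singleton_eq_of_det_eq_zero (sub_ne_zero.mpr ha) (sub_ne_zero.mpr hb) ?_
    simp only [Pi.sub_apply]
    linarith

/-- If at most `2 n` points other than `A` are given, at most `n` of them in any direction from
`A`, then they can be covered by at most `n` lines missing `A`. -/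
lemma exists_lines_covering_avoiding (A : Pt) (n : ℕ) (Y : Finset Pt) (hA : A ∉ Y)
    (hcard : Y.card ≤ 2 * n)
    (hc : ∀ k, (Y.filter (fun B => Submodule.span ℝ {B - A} = k)).card ≤ n) :
    ∃ L : Multiset BivPoly, (∀ q ∈ L, q.totalDegree = 1) ∧ L.card ≤ n ∧
      eval A L.prod = 1 ∧ ∀ B ∈ Y, eval B L.prod = 0 := by
  induction n generalizing Y with
  | zero =>
    obtain rfl : Y = ∅ := Finset.card_eq_zero.mp (by omega)
    exact ⟨0, by simp⟩
  | succ n ih =>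
    rcases Y.eq_empty_or_nonempty with rfl | hY
    · exact ⟨0, by simp⟩
    obtain ⟨a, ha, b, hb, hab, hcard', hc'⟩ :=
      exists_pair_card_filter_erase_le (fun B => Submodule.span ℝ {B - A}) n Y hY hcard hc
    obtain ⟨L, hL, hLn, hLA, hLY⟩ := ih ((Y.erase a).erase b)
      (fun h => hA (Finset.mem_of_mem_erase (Finset.mem_of_mem_erase h))) hcard' hc'
    obtain ⟨p, hp, hpA, hpa, hpb⟩ := exists_line_through_avoiding
      (ne_of_mem_of_not_mem ha hA) (ne_of_mem_of_not_mem hb hA) hab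
    refine ⟨p ::ₘ L, ?_, by simpa using hLn, by simp [hpA, hLA], fun B hB => ?_⟩
    · intro q hq
      rcases Multiset.mem_cons.mp hq with rfl | hq
      exacts [hp, hL q hq]
    · rw [Multiset.prod_cons, map_mul]
      by_cases hBa : B = a
      · rw [hBa, hpa, zero_mul]
      by_cases hBb : B = b
      · rw [hBb, hpb, zero_mul]
      rw [hLY B (by simp [hBa, hBb, hB]), mul_zero]

/-- If no `n+1` nodes of `X \ {A}` are collinear together with `A` and `#X ≤ 2n+1`,
then `A` has an `n`-fundamental polynomial which is a product of degree-1 polynomials. -/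
theorem fundamental_product_of_lines_of_not_collinear (n : ℕ) (hn : 1 ≤ n)
    (X : Finset Pt) (hcard : X.card ≤ 2 * n + 1) (A : Pt) (hA : A ∈ X)
    (hcol : ¬ ∃ S ⊆ X.erase A, n + 1 ≤ S.card ∧ Collinear ℝ (insert A (S : Set Pt))) :
    ∃ p : BivPoly, IsFundamental n X A p ∧ IsProductOfLines p := by
  obtain ⟨L, hL, hLn, hLA, hLX⟩ := exists_lines_covering_avoiding A n (X.erase A) (by simp)
    (by rw [Finset.card_erase_of_mem hA]; omega) (by
      intro k
      by_contra! hk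
      refine hcol ⟨_, Finset.filter_subset _ _, hk, ?_⟩
      obtain ⟨B, hB⟩ := Finset.card_pos.mp (Nat.zero_lt_of_lt hk)
      rw [collinear_iff_of_mem (Set.mem_insert A _)]
      refine ⟨B - A, fun p hp => ?_⟩
      rcases hp with rfl | hp
      · exact ⟨0, by simp⟩
      · rw [Finset.mem_coe, Finset.mem_filter] at hp
        rw [Finset.mem_filter] at hB
        have hmem : p - A ∈ Submodule.span ℝ {B - A} := by
          rw [hB.2, ← hp.2]
          exact Submodule.mem_span_singleton_self _
        obtain ⟨r, hr⟩ := Submodule.mem_span_singleton.mp hmem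
        exact ⟨r, by rw [hr]; simp⟩)
  refine ⟨L.prod, ⟨?_, hLA, fun B hB hBA => hLX B (Finset.mem_erase.mpr ⟨hBA, hB⟩)⟩, L, hL, rfl⟩
  refine (totalDegree_multiset_prod L).trans ?_
  rw [Multiset.map_congr rfl hL]
  simpa using hLn
end
end

section
/- Let n ≥ 1 and let X be a finite set of nodes in ℝ² that is n-independent and satisfies #X ≤ 2n + ⌊n/2⌋ + 1. Then for each node A ∈ X there exists an n-fundamental polynomial of A which is a product of polynomials each of total degree 1 or 2 (a product of lines and conics). -/
open MvPolynomial
open scoped Classical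

noncomputable section

/-- `p` is a product of finitely many polynomials each of total degree `1` or `2`. -/
def IsProductOfLinesAndConics (p : BivPoly) : Prop :=
  ∃ L : Multiset BivPoly, (∀ q ∈ L, q.totalDegree = 1 ∨ q.totalDegree = 2) ∧ p = L.prod


/-! ### Partitioning a set into independent classes of several matroids -/

section Partition

variable {α ι : Type*} [DecidableEq α] [DecidableEq ι] [Fintype ι]

/-- The matroid union criterion, for normalized monotone submodular functions bounded by the
cardinality. -/
theorem exists_partition_of_card_le_sum_rank (r : ι → Finset α → ℕ)
    (hmono : ∀ i S T, S ⊆ T → r i S ≤ r i T)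
    (hsub : ∀ i S T, r i (S ∪ T) + r i (S ∩ T) ≤ r i S + r i T)
    (hle : ∀ i S, r i S ≤ S.card) (Y : Finset α)
    (hY : ∀ S ⊆ Y, S.card ≤ ∑ i, r i S) :
    ∃ c : α → Finset ι, (∀ y ∈ Y, ∃ i, c y = {i}) ∧
      ∀ i, r i (Y.filter fun y => i ∈ c y) = (Y.filter fun y => i ∈ c y).card := by
  let P : Finset (α × ι) → Prop := fun R =>
    ∀ S ⊆ Y, S.card ≤ ∑ i, r i (S.filter fun y => (y, i) ∈ R)
  have hP : P (Y ×ˢ Finset.univ) := by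
    intro S hS
    refine (hY S hS).trans (Finset.sum_le_sum fun i _ => hmono _ _ _ ?_)
    intro y hy
    simp [hy, hS hy]
  obtain ⟨R, -, hR⟩ := exists_minimal_le_of_wellFoundedLT P _ hP
  have hempty : ∀ i, r i ∅ = 0 := fun i => by simpa using hle i ∅
  have hremove : ∀ y i, (y, i) ∈ R → ∃ S ⊆ Y, y ∈ S ∧
      ∑ l, r l (S.filter fun z => (z, l) ∈ R.erase (y, i)) < S.card := by
    intro y i hyi
    have hnot : ¬ P (R.erase (y, i)) := fun h =>
      Finset.notMem_erase (y, i) R (hR.le_of_le h (Finset.erase_subset _ _) hyi)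
    simp only [P, not_forall, not_le] at hnot
    obtain ⟨S, hS, hlt⟩ := hnot
    refine ⟨S, hS, ?_, hlt⟩
    by_contra hyS
    refine absurd (hR.prop S hS) (not_le.mpr (lt_of_le_of_lt ?_ hlt))
    refine Finset.sum_le_sum fun l _ => hmono _ _ _ ?_
    intro z hz
    simp only [Finset.mem_filter, Finset.mem_erase, ne_eq, Prod.mk.injEq] at hz ⊢
    exact ⟨hz.1, fun h => hyS (h.1 ▸ hz.1), hz.2⟩
  have huniq : ∀ y i j, (y, i) ∈ R → (y, j) ∈ R → i = j := by
    intro y i j hi hj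
    by_contra hij
    obtain ⟨S, hS, hyS, hSlt⟩ := hremove y i hi
    obtain ⟨T, hT, hyT, hTlt⟩ := hremove y j hj
    have hunion := hR.prop (S ∪ T) (Finset.union_subset hS hT)
    have hinter := hR.prop ((S ∩ T).erase y)
      ((Finset.erase_subset _ _).trans (Finset.inter_subset_left.trans hS))
    rw [Finset.card_erase_of_mem (Finset.mem_inter.2 ⟨hyS, hyT⟩)] at hinter
    have hcard := Finset.card_union_add_card_inter S T
    have hpos : 0 < (S ∩ T).card := Finset.card_pos.2 ⟨y, Finset.mem_inter.2 ⟨hyS, hyT⟩⟩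
    have hsum : ∑ l, r l ((S ∪ T).filter fun z => (z, l) ∈ R) +
        ∑ l, r l (((S ∩ T).erase y).filter fun z => (z, l) ∈ R) ≤
        ∑ l, r l (S.filter fun z => (z, l) ∈ R.erase (y, i)) +
        ∑ l, r l (T.filter fun z => (z, l) ∈ R.erase (y, j)) := by
      rw [← Finset.sum_add_distrib, ← Finset.sum_add_distrib]
      refine Finset.sum_le_sum fun l _ => le_trans ?_ (hsub l _ _)
      refine add_le_add (hmono _ _ _ ?_) (hmono _ _ _ ?_)
      · intro z hz
        simp only [Finset.mem_filter, Finset.mem_erase, Finset.mem_union, ne_eq,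
          Prod.mk.injEq] at hz ⊢
        by_cases hzy : z = y
        · subst hzy
          by_cases hli : l = i
          · exact Or.inr ⟨hyT, fun h => hij (hli.symm.trans h.2), hz.2⟩
          · exact Or.inl ⟨hyS, fun h => hli h.2, hz.2⟩
        · exact hz.1.imp (fun h => ⟨h, fun h => hzy h.1, hz.2⟩)
            (fun h => ⟨h, fun h => hzy h.1, hz.2⟩)
      · intro z hz
        simp only [Finset.mem_filter, Finset.mem_erase, Finset.mem_inter, ne_eq,
          Prod.mk.injEq] at hz ⊢
        exact ⟨⟨hz.1.2.1, fun h => hz.1.1 h.1, hz.2⟩, ⟨hz.1.2.2, fun h => hz.1.1 h.1, hz.2⟩⟩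
    omega
  let c : α → Finset ι := fun y => Finset.univ.filter fun i => (y, i) ∈ R
  have hc : ∀ y ∈ Y, ∃ i, c y = {i} := by
    intro y hy
    have h1 := hR.prop {y} (Finset.singleton_subset_iff.2 hy)
    have : ∃ i, (y, i) ∈ R := by
      by_contra hno
      push Not at hno
      simp [Finset.filter_singleton, hno, hempty] at h1
    obtain ⟨i, hi⟩ := this
    refine ⟨i, Finset.ext fun j => ?_⟩
    simp only [c, Finset.mem_filter, Finset.mem_univ, true_and, Finset.mem_singleton]
    exact ⟨fun hj => huniq y j i hj hi, fun h => h ▸ hi⟩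
  refine ⟨c, hc, ?_⟩
  have htotal : ∑ i, (Y.filter fun y => i ∈ c y).card = Y.card := by
    have := Finset.sum_card_bipartiteAbove_eq_sum_card_bipartiteBelow (s := Y)
      (t := (Finset.univ : Finset ι)) (fun y i => i ∈ c y)
    rw [show ∑ i, (Y.filter fun y => i ∈ c y).card = _ from this.symm, Finset.card_eq_sum_ones]
    refine Finset.sum_congr rfl fun y hy => ?_
    obtain ⟨i, hi⟩ := hc y hy
    exact Finset.card_eq_one.2 ⟨i, by ext; simp [Finset.bipartiteAbove, hi]⟩
  have hge := hR.prop Y subset_rfl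
  have hsum : ∑ i, r i (Y.filter fun y => i ∈ c y) = ∑ i, (Y.filter fun y => i ∈ c y).card := by
    refine le_antisymm (Finset.sum_le_sum fun i _ => hle _ _) ?_
    rw [htotal]
    simpa [c] using hge
  exact fun i => (Finset.sum_eq_sum_iff_of_le fun i _ => hle i _).1 hsum i (Finset.mem_univ i)

end Partition

/-! ### Ranks of families of vectors -/

section Rank

variable {α V : Type*} [AddCommGroup V] [Module ℝ V]

/-- The dimension of the span of the vectors `u y` with `y ∈ S`. -/
def spanRank (u : α → V) (S : Finset α) : ℕ :=
  Module.finrank ℝ (Submodule.span ℝ (u '' (S : Set α)))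

theorem spanRank_mono [FiniteDimensional ℝ V] (u : α → V) {S T : Finset α} (h : S ⊆ T) :
    spanRank u S ≤ spanRank u T :=
  Submodule.finrank_mono (Submodule.span_mono (Set.image_mono (Finset.coe_subset.2 h)))

theorem spanRank_union_add_inter_le [DecidableEq α] [FiniteDimensional ℝ V] (u : α → V) (S T : Finset α) :
    spanRank u (S ∪ T) + spanRank u (S ∩ T) ≤ spanRank u S + spanRank u T := by
  unfold spanRank
  rw [← Submodule.finrank_sup_add_finrank_inf_eq (Submodule.span ℝ (u '' (S : Set α))),
    Finset.coe_union, Set.image_union, Submodule.span_union]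
  refine Nat.add_le_add_left (Submodule.finrank_mono (le_inf ?_ ?_)) _ <;>
  · refine Submodule.span_mono (Set.image_mono ?_)
    simp

theorem spanRank_le_card (u : α → V) (S : Finset α) : spanRank u S ≤ S.card := by
  unfold spanRank
  rw [← Finset.coe_image]
  exact (finrank_span_finset_le_card _).trans Finset.card_image_le

theorem spanRank_add_one_le_insert [DecidableEq α] [FiniteDimensional ℝ V] (u : α → V) (φ : V →ₗ[ℝ] ℝ)
    (T : Finset α) (y : α) (hT : ∀ t ∈ T, φ (u t) = 0) (hy : φ (u y) ≠ 0) :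
    spanRank u T + 1 ≤ spanRank u (insert y T) := by
  refine Submodule.finrank_lt_finrank_of_lt (lt_of_le_of_ne ?_ ?_)
  · exact Submodule.span_mono (Set.image_mono (by simp))
  · intro heq
    have hmem : u y ∈ Submodule.span ℝ (u '' (T : Set α)) := by
      rw [heq]
      exact Submodule.subset_span ⟨y, by simp, rfl⟩
    have hle : Submodule.span ℝ (u '' (T : Set α)) ≤ LinearMap.ker φ := by
      rw [Submodule.span_le]
      rintro _ ⟨t, ht, rfl⟩
      exact hT t ht
    exact hy (hle hmem)

/-- Functionals on independent vectors can be prescribed arbitrarily. -/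
theorem exists_functional_eq_of_spanRank_eq_card (u : α → V) (S : Finset α)
    (h : spanRank u S = S.card) (a : ℝ) : ∃ φ : V →ₗ[ℝ] ℝ, ∀ y ∈ S, φ (u y) = a := by
  have hli : LinearIndependent ℝ (fun y : S => u y) := by
    rw [linearIndependent_iff_card_eq_finrank_span]
    simp only [Fintype.card_coe, Set.finrank]
    rw [← h, spanRank, Set.image_eq_range]
    rfl
  obtain ⟨φ, hφ⟩ := LinearMap.exists_extend
    ((Module.Basis.span hli).constr ℝ (fun _ => a))
  refine ⟨φ, fun y hy => ?_⟩
  have h1 := LinearMap.congr_fun hφ (Module.Basis.span hli ⟨y, hy⟩)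
  rw [Module.Basis.constr_basis] at h1
  simpa [Module.Basis.span_apply] using h1

theorem exists_functional_of_spanRank_lt (u : α → V) (S : Finset α)
    (h : spanRank u S < Module.finrank ℝ V) :
    ∃ φ : V →ₗ[ℝ] ℝ, φ ≠ 0 ∧ ∀ y ∈ S, φ (u y) = 0 := by
  have hlt : Submodule.span ℝ (u '' (S : Set α)) < ⊤ := by
    rw [lt_top_iff_ne_top]
    intro htop
    rw [spanRank, htop, finrank_top] at h
    exact lt_irrefl _ h
  obtain ⟨φ, hφ, hker⟩ := Submodule.exists_le_ker_of_lt_top _ hlt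
  exact ⟨φ, hφ, fun y hy => hker (Submodule.subset_span ⟨y, hy, rfl⟩)⟩

end Rank

/-! ### Substituting rational curves into a bivariate polynomial -/

/-- The polynomial `g ^ n * f (a / g, b / g)`, for `f` of total degree at most `n`. -/
def homSubst (n : ℕ) (f : BivPoly) (a b g : Polynomial ℝ) : Polynomial ℝ :=
  ∑ m ∈ f.support, Polynomial.C (f.coeff m) * (a ^ m 0 * b ^ m 1 * g ^ (n - (m 0 + m 1)))

theorem add_le_of_mem_support {n : ℕ} {f : BivPoly} (hf : f.totalDegree ≤ n) {m : Fin 2 →₀ ℕ}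
    (hm : m ∈ f.support) : m 0 + m 1 ≤ n := by
  have := (le_totalDegree hm).trans hf
  rwa [Finsupp.sum_fintype _ _ (fun _ => rfl), Fin.sum_univ_two] at this

theorem homSubst_eval {n : ℕ} {f : BivPoly} (hf : f.totalDegree ≤ n) {a b g : Polynomial ℝ}
    {t s : ℝ} {x : Pt} (ha : a.eval t = s * x 0) (hb : b.eval t = s * x 1) (hg : g.eval t = s) :
    (homSubst n f a b g).eval t = s ^ n * eval x f := by
  rw [homSubst, Polynomial.eval_finsetSum, eval_eq', Finset.mul_sum]
  refine Finset.sum_congr rfl fun m hm => ?_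
  obtain ⟨d, hd⟩ := Nat.exists_eq_add_of_le (add_le_of_mem_support hf hm)
  have hsub : n - (m 0 + m 1) = d := by omega
  simp only [Polynomial.eval_mul, Polynomial.eval_C, Polynomial.eval_pow, ha, hb, hg,
    Fin.prod_univ_two, hsub]
  rw [hd]
  ring

theorem homSubst_natDegree_le {n d : ℕ} {f : BivPoly} (hf : f.totalDegree ≤ n)
    {a b g : Polynomial ℝ} (ha : a.natDegree ≤ d) (hb : b.natDegree ≤ d) (hg : g.natDegree ≤ d) :
    (homSubst n f a b g).natDegree ≤ n * d := by
  refine Polynomial.natDegree_sum_le_of_forall_le _ _ fun m hm => ?_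
  obtain ⟨e, he⟩ := Nat.exists_eq_add_of_le (add_le_of_mem_support hf hm)
  have hsub : n - (m 0 + m 1) = e := by omega
  refine (Polynomial.natDegree_C_mul_le _ _).trans ?_
  rw [hsub, he, add_mul, add_mul]
  exact Polynomial.natDegree_mul_le_of_le (Polynomial.natDegree_mul_le_of_le
    (Polynomial.natDegree_pow_le_of_le _ ha) (Polynomial.natDegree_pow_le_of_le _ hb))
    (Polynomial.natDegree_pow_le_of_le _ hg)

theorem homSubst_coeff {n d : ℕ} {f : BivPoly} (hf : f.totalDegree ≤ n)
    {a b g : Polynomial ℝ} (ha : a.natDegree ≤ d) (hb : b.natDegree ≤ d) (hg : g.natDegree ≤ d) :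
    (homSubst n f a b g).coeff (n * d) = ∑ m ∈ f.support, f.coeff m *
      (a.coeff d ^ m 0 * b.coeff d ^ m 1 * g.coeff d ^ (n - (m 0 + m 1))) := by
  rw [homSubst, Polynomial.finsetSum_coeff]
  refine Finset.sum_congr rfl fun m hm => ?_
  obtain ⟨e, he⟩ := Nat.exists_eq_add_of_le (add_le_of_mem_support hf hm)
  have hsub : n - (m 0 + m 1) = e := by omega
  have ha' := Polynomial.natDegree_pow_le_of_le (m 0) ha
  have hb' := Polynomial.natDegree_pow_le_of_le (m 1) hb
  have hg' := Polynomial.natDegree_pow_le_of_le e hg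
  rw [Polynomial.coeff_C_mul, hsub, he, add_mul, add_mul,
    Polynomial.coeff_mul_add_eq_of_natDegree_le (Polynomial.natDegree_mul_le_of_le ha' hb') hg',
    Polynomial.coeff_mul_add_eq_of_natDegree_le ha' hb', Polynomial.coeff_pow_of_natDegree_le ha,
    Polynomial.coeff_pow_of_natDegree_le hb, Polynomial.coeff_pow_of_natDegree_le hg]

/-- The leading coefficient of `homSubst`, when the leading coefficients of `a`, `b`, `g` are
proportional to `(x 0, x 1, 1)`. -/
theorem homSubst_coeff_eq_eval {n d : ℕ} {f : BivPoly} (hf : f.totalDegree ≤ n)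
    {a b g : Polynomial ℝ} (ha : a.natDegree ≤ d) (hb : b.natDegree ≤ d) (hg : g.natDegree ≤ d)
    {s : ℝ} {x : Pt} (ha' : a.coeff d = s * x 0) (hb' : b.coeff d = s * x 1)
    (hg' : g.coeff d = s) :
    (homSubst n f a b g).coeff (n * d) = s ^ n * eval x f := by
  rw [homSubst_coeff hf ha hb hg, eval_eq', Finset.mul_sum]
  refine Finset.sum_congr rfl fun m hm => ?_
  obtain ⟨e, he⟩ := Nat.exists_eq_add_of_le (add_le_of_mem_support hf hm)
  have hsub : n - (m 0 + m 1) = e := by omega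
  rw [ha', hb', hg', hsub, he, Fin.prod_univ_two]
  ring

theorem card_le_natDegree_of_injOn {G : Polynomial ℝ} (hG : G ≠ 0) {α : Type*} (S : Finset α)
    (τ : α → ℝ) (hτ : Set.InjOn τ S) (hS : ∀ y ∈ S, G.eval (τ y) = 0) : S.card ≤ G.natDegree := by
  refine (Finset.card_le_card_of_injOn τ (t := G.roots.toFinset) ?_ hτ).trans
    ((Multiset.toFinset_card_le _).trans G.card_roots')
  intro y hy
  simpa [hG] using hS y hy

/-- The restriction `t ↦ f (x + t v)` of `f` to a line. -/
def lineSubst (n : ℕ) (f : BivPoly) (x v : Pt) : Polynomial ℝ :=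
  homSubst n f (Polynomial.C (v 0) * Polynomial.X + Polynomial.C (x 0))
    (Polynomial.C (v 1) * Polynomial.X + Polynomial.C (x 1)) 1

theorem lineSubst_eval {n : ℕ} {f : BivPoly} (hf : f.totalDegree ≤ n) (x v : Pt) (t : ℝ) :
    (lineSubst n f x v).eval t = eval (x + t • v) f := by
  rw [lineSubst, homSubst_eval hf (x := x + t • v) (s := 1)]
  · simp
  · simp; ring
  · simp; ring
  · simp

theorem lineSubst_natDegree_le {n : ℕ} {f : BivPoly} (hf : f.totalDegree ≤ n) (x v : Pt) :
    (lineSubst n f x v).natDegree ≤ n := by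
  simpa [lineSubst] using homSubst_natDegree_le hf (d := 1) (Polynomial.natDegree_linear_le)
    (Polynomial.natDegree_linear_le) (by simp)

/-- The coefficient of `tⁿ` in `f (x + t v)` only depends on the direction `v`. -/
theorem lineSubst_coeff_congr {n : ℕ} {f : BivPoly} (hf : f.totalDegree ≤ n) (x x' v : Pt) :
    (lineSubst n f x v).coeff n = (lineSubst n f x' v).coeff n := by
  have key : ∀ x, (lineSubst n f x v).coeff n = ∑ m ∈ f.support, f.coeff m *
      (v 0 ^ m 0 * v 1 ^ m 1 * (1 : Polynomial ℝ).coeff 1 ^ (n - (m 0 + m 1))) := by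
    intro x
    have := homSubst_coeff hf (d := 1)
      (Polynomial.natDegree_linear_le (a := v 0) (b := x 0))
      (Polynomial.natDegree_linear_le (a := v 1) (b := x 1))
      (g := (1 : Polynomial ℝ)) (by simp)
    rw [mul_one] at this
    rw [lineSubst, this]
    simp
  rw [key, key]

theorem card_le_natDegree_lineSubst {n : ℕ} {f : BivPoly} (hf : f.totalDegree ≤ n) {A x v : Pt}
    (h0 : lineSubst n f x v ≠ 0) (S : Finset Pt) (hS : ∀ y ∈ S, eval (A + y) f = 0)
    (hline : ∀ y ∈ S, ∃ t : ℝ, A + y = x + t • v) :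
    S.card ≤ (lineSubst n f x v).natDegree := by
  choose! τ hτ using hline
  refine card_le_natDegree_of_injOn h0 S τ ?_ ?_
  · intro y hy z hz h
    have : A + y = A + z := by rw [hτ y hy, hτ z hz, h]
    exact add_left_cancel this
  · intro y hy
    rw [lineSubst_eval hf, ← hτ y hy, hS y hy]

theorem sq_add_sq_ne_zero {p q : ℝ} (h : p ≠ 0 ∨ q ≠ 0) : p ^ 2 + q ^ 2 ≠ 0 := by
  rcases h with h | h <;> positivity

theorem exists_eq_smul_of_central_line {p q : ℝ} (hpq : p ≠ 0 ∨ q ≠ 0) {y : Pt}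
    (hy : p * y 0 + q * y 1 = 0) : ∃ t : ℝ, y = t • ![-q, p] := by
  have hN := sq_add_sq_ne_zero hpq
  refine ⟨(-q * y 0 + p * y 1) / (p ^ 2 + q ^ 2), ?_⟩
  ext i
  fin_cases i
  · simp
    field_simp
    linear_combination p * hy
  · simp
    field_simp
    linear_combination q * hy

theorem exists_eq_add_smul_of_line {p q : ℝ} (hpq : p ≠ 0 ∨ q ≠ 0) {y : Pt}
    (hy : p * y 0 + q * y 1 = 1) :
    ∃ t : ℝ, y = ![p / (p ^ 2 + q ^ 2), q / (p ^ 2 + q ^ 2)] + t • ![-q, p] := by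
  have hN := sq_add_sq_ne_zero hpq
  obtain ⟨t, ht⟩ := exists_eq_smul_of_central_line hpq
    (y := y - ![p / (p ^ 2 + q ^ 2), q / (p ^ 2 + q ^ 2)]) (by
      simp
      field_simp
      linear_combination (p ^ 2 + q ^ 2) * hy)
  exact ⟨t, by rw [← ht]; abel⟩

/-- A line through `A` contains at most `n` zeros of `f`. -/
theorem card_le_of_central_line {n : ℕ} {f : BivPoly} (hf : f.totalDegree ≤ n) {A : Pt}
    (hA : eval A f ≠ 0) {p q : ℝ} (hpq : p ≠ 0 ∨ q ≠ 0) (S : Finset Pt)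
    (hS : ∀ y ∈ S, eval (A + y) f = 0) (hline : ∀ y ∈ S, p * y 0 + q * y 1 = 0) :
    S.card ≤ n := by
  refine (card_le_natDegree_lineSubst hf (x := A) (v := ![-q, p]) ?_ S hS fun y hy => ?_).trans
    (lineSubst_natDegree_le hf _ _)
  · intro h0
    have := lineSubst_eval hf A ![-q, p] 0
    rw [h0] at this
    apply hA
    simpa using this.symm
  · obtain ⟨t, ht⟩ := exists_eq_smul_of_central_line hpq (hline y hy)
    exact ⟨t, by rw [← ht]⟩

/-- If `f` has more than `n` zeros on a line not through `A`, then outside that line it has at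
most `n - 1` zeros on each line through `A`. -/
theorem card_lt_of_central_line_of_line {n : ℕ} {f : BivPoly} (hf : f.totalDegree ≤ n) {A : Pt}
    (hA : eval A f ≠ 0) {p q : ℝ} (T : Finset Pt) (hT : ∀ y ∈ T, eval (A + y) f = 0)
    (hTline : ∀ y ∈ T, p * y 0 + q * y 1 = 1) (hTcard : n < T.card)
    {p' q' : ℝ} (hpq' : p' ≠ 0 ∨ q' ≠ 0) (S : Finset Pt) (hS : ∀ y ∈ S, eval (A + y) f = 0)
    (hSline : ∀ y ∈ S, p' * y 0 + q' * y 1 = 0) (hST : ∀ y ∈ S, p * y 0 + q * y 1 ≠ 1) :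
    S.card < n := by
  have hpq : p ≠ 0 ∨ q ≠ 0 := by
    by_contra h
    push Not at h
    obtain ⟨y, hy⟩ := Finset.card_pos.1 (by omega : 0 < T.card)
    have := hTline y hy
    simp [h.1, h.2] at this
  set o : Pt := ![p / (p ^ 2 + q ^ 2), q / (p ^ 2 + q ^ 2)] with ho
  have hN := sq_add_sq_ne_zero hpq
  have hzero : lineSubst n f (A + o) ![-q, p] = 0 := by
    by_contra h0
    have h1 := card_le_natDegree_lineSubst hf h0 T hT fun y hy => by
      obtain ⟨t, ht⟩ := exists_eq_add_smul_of_line hpq (hTline y hy)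
      exact ⟨t, by rw [add_assoc, ← ht]⟩
    have h2 := lineSubst_natDegree_le hf (A + o) ![-q, p]
    omega
  have hvanish : ∀ y : Pt, p * y 0 + q * y 1 = 1 → eval (A + y) f = 0 := by
    intro y hy
    obtain ⟨t, ht⟩ := exists_eq_add_smul_of_line hpq hy
    rw [ht, ← add_assoc, ← lineSubst_eval hf, hzero, Polynomial.eval_zero]
  by_cases hpar : p * q' = q * p'
  · have hne : lineSubst n f A ![-q', p'] ≠ 0 := by
      intro h0
      have := lineSubst_eval hf A ![-q', p'] 0
      rw [h0] at this
      apply hA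
      simpa using this.symm
    have hcard := card_le_natDegree_lineSubst hf hne S hS fun y hy => by
      obtain ⟨t, ht⟩ := exists_eq_smul_of_central_line hpq' (hSline y hy)
      exact ⟨t, by rw [← ht]⟩
    have hzero' : lineSubst n f (A + o) ![-q', p'] = 0 := by
      apply Polynomial.funext
      intro t
      rw [lineSubst_eval hf, Polynomial.eval_zero, add_assoc]
      apply hvanish
      simp [ho]
      field_simp
      linear_combination (-t * (p ^ 2 + q ^ 2)) * hpar
    have hcoeff := lineSubst_coeff_congr hf A (A + o) ![-q', p']
    rw [hzero', Polynomial.coeff_zero] at hcoeff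
    have hdeg := lineSubst_natDegree_le hf A ![-q', p']
    refine lt_of_le_of_ne (hcard.trans hdeg) fun h => ?_
    have : (lineSubst n f A ![-q', p']).natDegree = n := by omega
    exact hne (Polynomial.leadingCoeff_eq_zero.1 (by rw [Polynomial.leadingCoeff, this, hcoeff]))
  · have hc : -p * q' + q * p' ≠ 0 := fun h => hpar (by linear_combination -h)
    set w : Pt := (-p * q' + q * p')⁻¹ • ![-q', p'] with hw
    have hwline : p * w 0 + q * w 1 = 1 := by
      change p * ((-p * q' + q * p')⁻¹ * -q') + q * ((-p * q' + q * p')⁻¹ * p') = 1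
      linear_combination inv_mul_cancel₀ hc
    have hwS : w ∉ S := fun h => hST w h hwline
    have := card_le_of_central_line hf hA hpq' (insert w S) (by
      intro y hy
      rcases Finset.mem_insert.1 hy with rfl | hy
      · exact hvanish _ hwline
      · exact hS y hy) (by
      intro y hy
      rcases Finset.mem_insert.1 hy with rfl | hy
      · simp [hw]; ring
      · exact hSline y hy)
    rw [Finset.card_insert_of_notMem hwS] at this
    omega

theorem exists_factor_of_binary_quadratic {a b c : ℝ} {w : Pt} (hw : w ≠ 0)
    (h : a * w 0 ^ 2 + b * (w 0 * w 1) + c * w 1 ^ 2 = 0) :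
    ∃ m k : ℝ, a = -w 1 * m ∧ b = w 0 * m - w 1 * k ∧ c = w 0 * k := by
  by_cases h0 : w 0 = 0
  · have h1 : w 1 ≠ 0 := fun h1 => hw (by ext i; fin_cases i <;> simp [h0, h1])
    refine ⟨-a / w 1, -b / w 1, ?_, ?_, ?_⟩
    · field_simp
    · rw [h0]; field_simp; ring
    · simp [h0, h1] at h
      simp [h0, h]
  · refine ⟨(b + w 1 * (c / w 0)) / w 0, c / w 0, ?_, ?_, ?_⟩
    · field_simp
      linear_combination h
    · field_simp
      ring
    · field_simp

/-- A nondegenerate conic through `A`, whose tangent direction at `A` is not asymptotic,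
contains at most `2n` zeros of `f`. -/
theorem card_le_of_nondegenerate_conic {n : ℕ} {f : BivPoly} (hf : f.totalDegree ≤ n) {A : Pt}
    (hA : eval A f ≠ 0) {l m a b c : ℝ} (hlm : l ≠ 0 ∨ m ≠ 0)
    (hQ : a * m ^ 2 - b * (l * m) + c * l ^ 2 ≠ 0) (S : Finset Pt)
    (hS : ∀ y ∈ S, eval (A + y) f = 0)
    (hconic : ∀ y ∈ S, l * y 0 + m * y 1 + a * y 0 ^ 2 + b * (y 0 * y 1) + c * y 1 ^ 2 = 0) :
    S.card ≤ n * 2 := by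
  have hN := sq_add_sq_ne_zero hlm
  set N := l ^ 2 + m ^ 2 with hNdef
  have hS0 : ∀ y ∈ S, y ≠ 0 → l * y 0 + m * y 1 ≠ 0 := by
    intro y hy hy0 hL
    obtain ⟨t, ht⟩ := exists_eq_smul_of_central_line hlm hL
    have h1 := hconic y hy
    rw [hL, ht] at h1
    simp at h1
    have h2 : t ^ 2 * (a * m ^ 2 - b * (l * m) + c * l ^ 2) = 0 := by linear_combination h1
    rcases mul_eq_zero.1 h2 with h3 | h3
    · apply hy0
      rw [ht, pow_eq_zero_iff (two_ne_zero) |>.1 h3, zero_smul]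
    · exact hQ h3
  have hSne : ∀ y ∈ S, l * y 0 + m * y 1 ≠ 0 := by
    intro y hy
    refine hS0 y hy ?_
    rintro rfl
    apply hA
    simpa using hS 0 hy
  set g : Polynomial ℝ := Polynomial.C (a * m ^ 2 - b * (l * m) + c * l ^ 2) * Polynomial.X ^ 2 +
    Polynomial.C (-2 * a * l * m + b * (l ^ 2 - m ^ 2) + 2 * c * l * m) * Polynomial.X +
    Polynomial.C (a * l ^ 2 + b * (l * m) + c * m ^ 2) with hg
  set X₀ : Polynomial ℝ := Polynomial.C (A 0) * g -
    (Polynomial.C (-N * m) * Polynomial.X + Polynomial.C (N * l)) with hX₀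
  set X₁ : Polynomial ℝ := Polynomial.C (A 1) * g -
    (Polynomial.C (N * l) * Polynomial.X + Polynomial.C (N * m)) with hX₁
  have hgdeg : g.natDegree ≤ 2 := Polynomial.natDegree_quadratic_le
  have hlin : ∀ u v : ℝ,
      (Polynomial.C u * Polynomial.X + Polynomial.C v : Polynomial ℝ).natDegree ≤ 2 :=
    fun u v => Polynomial.natDegree_linear_le.trans one_le_two
  have hX₀deg : X₀.natDegree ≤ 2 := Polynomial.natDegree_sub_le_of_le
    ((Polynomial.natDegree_C_mul_le _ _).trans hgdeg) (hlin _ _)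
  have hX₁deg : X₁.natDegree ≤ 2 := Polynomial.natDegree_sub_le_of_le
    ((Polynomial.natDegree_C_mul_le _ _).trans hgdeg) (hlin _ _)
  have hgcoeff : g.coeff 2 = a * m ^ 2 - b * (l * m) + c * l ^ 2 := by
    simp only [hg, Polynomial.coeff_add, Polynomial.coeff_C_mul, Polynomial.coeff_X_pow,
      Polynomial.coeff_X, Polynomial.coeff_C]
    simp
  have hcoeff := homSubst_coeff_eq_eval hf hX₀deg hX₁deg hgdeg (x := A) (s := g.coeff 2)
    (by rw [hX₀]; simp [mul_comm])
    (by rw [hX₁]; simp [mul_comm]) rfl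
  have hne : homSubst n f X₀ X₁ g ≠ 0 := by
    intro h0
    rw [h0, Polynomial.coeff_zero, hgcoeff] at hcoeff
    exact mul_ne_zero (pow_ne_zero _ hQ) hA hcoeff.symm
  set τ : Pt → ℝ := fun y => (-m * y 0 + l * y 1) / (l * y 0 + m * y 1) with hτ
  have hgτ : ∀ y ∈ S, g.eval (τ y) = -N ^ 2 / (l * y 0 + m * y 1) := by
    intro y hy
    have hL := hSne y hy
    simp only [hg, hτ, Polynomial.eval_add, Polynomial.eval_mul, Polynomial.eval_C,
      Polynomial.eval_pow, Polynomial.eval_X, hNdef]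
    field_simp
    linear_combination (l ^ 2 + m ^ 2) ^ 2 * hconic y hy
  refine (card_le_natDegree_of_injOn hne S τ ?_ ?_).trans
    (homSubst_natDegree_le hf hX₀deg hX₁deg hgdeg)
  · intro y hy z hz hyz
    have hLy := hSne y hy
    have hLz := hSne z hz
    have hL : l * y 0 + m * y 1 = l * z 0 + m * z 1 := by
      have h1 := hgτ y hy
      rw [hyz, hgτ z hz] at h1
      field_simp at h1
      linarith
    have hM : -m * y 0 + l * y 1 = -m * z 0 + l * z 1 := by
      simp only [hτ] at hyz
      rw [hL] at hyz
      field_simp at hyz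
      linarith
    have e0 : N * (y 0 - z 0) = 0 := by rw [hNdef]; linear_combination l * hL - m * hM
    have e1 : N * (y 1 - z 1) = 0 := by rw [hNdef]; linear_combination m * hL + l * hM
    ext i
    fin_cases i
    · exact sub_eq_zero.1 ((mul_eq_zero.1 e0).resolve_left hN)
    · exact sub_eq_zero.1 ((mul_eq_zero.1 e1).resolve_left hN)
  · intro y hy
    have hL := hSne y hy
    rw [homSubst_eval hf (x := A + y) (s := g.eval (τ y)), hS y hy, mul_zero]
    · rw [hX₀, Polynomial.eval_sub, Polynomial.eval_mul, hgτ y hy]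
      simp [hτ]
      field_simp
      rw [hNdef]; ring
    · rw [hX₁, Polynomial.eval_sub, Polynomial.eval_mul, hgτ y hy]
      simp [hτ]
      field_simp
      rw [hNdef]; ring
    · rfl

theorem card_le_add_of_forall_or {α : Type*} (S : Finset α) (P Q : α → Prop)
    (h : ∀ y ∈ S, P y ∨ Q y) : S.card ≤ (S.filter P).card + (S.filter Q).card := by
  refine (Finset.card_le_card fun y hy => ?_).trans (Finset.card_union_le _ _)
  simpa [hy] using h y hy

section Counting

variable {n : ℕ} {f : BivPoly} {A : Pt} {Y : Finset Pt}

/-- A conic through `A` contains at most `2n` zeros of `f`, provided that lines not through `A`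
contain at most `n` of them. -/
theorem card_le_of_conic (hf : f.totalDegree ≤ n) (hA : eval A f ≠ 0)
    (hY : ∀ y ∈ Y, eval (A + y) f = 0)
    (hline : ∀ p q : ℝ, (Y.filter fun y => p * y 0 + q * y 1 = 1).card ≤ n)
    {l m a b c : ℝ} (hne : ¬(l = 0 ∧ m = 0 ∧ a = 0 ∧ b = 0 ∧ c = 0)) {S : Finset Pt} (hSY : S ⊆ Y)
    (hconic : ∀ y ∈ S, l * y 0 + m * y 1 + a * y 0 ^ 2 + b * (y 0 * y 1) + c * y 1 ^ 2 = 0) :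
    S.card ≤ n * 2 := by
  have hS : ∀ y ∈ S, eval (A + y) f = 0 := fun y hy => hY y (hSY hy)
  have hcentral : ∀ p q : ℝ, (p ≠ 0 ∨ q ≠ 0) →
      (S.filter fun y => p * y 0 + q * y 1 = 0).card ≤ n := fun p q hpq =>
    card_le_of_central_line hf hA hpq _ (fun y hy => hS y (Finset.mem_filter.1 hy).1)
      (fun y hy => (Finset.mem_filter.1 hy).2)
  by_cases hlm : l ≠ 0 ∨ m ≠ 0
  · by_cases hQ : a * m ^ 2 - b * (l * m) + c * l ^ 2 = 0
    · have hw : (![-m, l] : Pt) ≠ 0 := by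
        intro h
        have h0 := congrFun h 0
        have h1 := congrFun h 1
        simp at h0 h1
        exact hlm.elim (fun h => h h1) (fun h => h h0)
      obtain ⟨s, t, h1, h2, h3⟩ := exists_factor_of_binary_quadratic (a := a) (b := b) (c := c) hw
        (by simp; linear_combination hQ)
      simp at h1 h2 h3
      have hcard := card_le_add_of_forall_or S (fun y => l * y 0 + m * y 1 = 0)
        (fun y => s * y 0 + t * y 1 = 1) (fun y hy => by
          have h4 : (l * y 0 + m * y 1) * (s * y 0 + t * y 1 - 1) = 0 := by
            have := hconic y hy
            rw [h1, h2, h3] at this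
            linear_combination -this
          exact (mul_eq_zero.1 h4).imp id sub_eq_zero.1)
      have h5 := hcentral l m hlm
      have h6 := (Finset.card_le_card (Finset.filter_subset_filter _ hSY)).trans (hline s t)
      omega
    · exact card_le_of_nondegenerate_conic hf hA hlm hQ S hS hconic
  · push Not at hlm
    obtain ⟨rfl, rfl⟩ := hlm
    rcases S.eq_empty_or_nonempty with rfl | ⟨w, hw⟩
    · simp
    have hw0 : w ≠ 0 := by
      rintro rfl
      exact hA (by simpa using hS 0 hw)
    obtain ⟨s, t, h1, h2, h3⟩ := exists_factor_of_binary_quadratic (a := a) (b := b) (c := c) hw0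
      (by linear_combination hconic w hw)
    have hst : s ≠ 0 ∨ t ≠ 0 := by
      by_contra h
      push Not at h
      exact hne ⟨rfl, rfl, by simp [h1, h.1], by simp [h2, h.1, h.2], by simp [h3, h.2]⟩
    have hw1 : -w 1 ≠ 0 ∨ w 0 ≠ 0 := by
      by_contra h
      push Not at h
      exact hw0 (by ext i; fin_cases i <;> simp_all)
    have hcard := card_le_add_of_forall_or S (fun y => -w 1 * y 0 + w 0 * y 1 = 0)
      (fun y => s * y 0 + t * y 1 = 0) (fun y hy => by
        rw [← mul_eq_zero]
        have := hconic y hy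
        rw [h1, h2, h3] at this
        linear_combination this)
    have h5 := hcentral _ _ hw1
    have h6 := hcentral _ _ hst
    omega

end Counting

/-- The quadratic Veronese coordinates, without the constant one. -/
def veronese (y : Pt) : Fin 5 → ℝ := ![y 0, y 1, y 0 ^ 2, y 0 * y 1, y 1 ^ 2]

theorem exists_coeff_of_functional {k : ℕ} (φ : (Fin k → ℝ) →ₗ[ℝ] ℝ) :
    ∃ c : Fin k → ℝ, ∀ v, φ v = ∑ i, c i * v i :=
  ⟨_, fun v => (φ.pi_apply_eq_sum_univ v).trans
    (Finset.sum_congr rfl fun _ _ => mul_comm _ _)⟩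

/-- The functional `v ↦ ∑ i, c i * v i`. -/
def functionalOfCoeff {k : ℕ} (c : Fin k → ℝ) : (Fin k → ℝ) →ₗ[ℝ] ℝ :=
  ∑ i, c i • LinearMap.proj i

theorem functionalOfCoeff_apply {k : ℕ} (c v : Fin k → ℝ) :
    functionalOfCoeff c v = ∑ i, c i * v i := by
  simp [functionalOfCoeff, LinearMap.sum_apply]

/-! ### Lower bounds for ranks -/

theorem dot_self_ne_zero {P : Pt} (hP : P ≠ 0) : P 0 * P 0 + P 1 * P 1 ≠ 0 := by
  intro h
  apply hP
  have h0 : P 0 = 0 := by nlinarith [sq_nonneg (P 0), sq_nonneg (P 1)]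
  have h1 : P 1 = 0 := by nlinarith [sq_nonneg (P 0), sq_nonneg (P 1)]
  ext i
  fin_cases i <;> assumption

theorem one_le_spanRank_id {S : Finset Pt} {P : Pt} (hP : P ∈ S) (hP0 : P ≠ 0) :
    1 ≤ spanRank id S := by
  refine le_trans ?_ (spanRank_mono id (Finset.singleton_subset_iff.2 hP))
  have := spanRank_add_one_le_insert id (functionalOfCoeff P) ∅ P (by simp) (by
    rw [functionalOfCoeff_apply, Fin.sum_univ_two]
    exact dot_self_ne_zero hP0)
  exact le_trans (by omega) this

theorem two_le_spanRank_id {S : Finset Pt} {P Q : Pt} (hP : P ∈ S) (hQ : Q ∈ S)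
    (hPQ : -P 1 * Q 0 + P 0 * Q 1 ≠ 0) : 2 ≤ spanRank id S := by
  have hP0 : P ≠ 0 := by
    rintro rfl
    simp at hPQ
  have h1 := one_le_spanRank_id (Finset.mem_singleton_self P) hP0
  have h2 := spanRank_add_one_le_insert id (functionalOfCoeff ![-P 1, P 0]) {P} Q
    (by
      intro t ht
      rw [Finset.mem_singleton.1 ht, functionalOfCoeff_apply, Fin.sum_univ_two]
      simp
      ring)
    (by
      rw [functionalOfCoeff_apply, Fin.sum_univ_two]
      simpa using hPQ)
  have h3 := spanRank_mono id (S := {Q, P}) (T := S) (by simp [Finset.insert_subset_iff, hP, hQ])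
  omega

/-- A product of a linear form and an affine form separating `y` from `T` raises the rank. -/
theorem spanRank_veronese_add_one_le (l₀ l₁ a₀ a₁ a₂ : ℝ) (T : Finset Pt) (y : Pt)
    (hT : ∀ t ∈ T, (l₀ * t 0 + l₁ * t 1) * (a₀ + a₁ * t 0 + a₂ * t 1) = 0)
    (hl : l₀ * y 0 + l₁ * y 1 ≠ 0) (ha : a₀ + a₁ * y 0 + a₂ * y 1 ≠ 0) :
    spanRank veronese T + 1 ≤ spanRank veronese (insert y T) := by
  have key : ∀ t : Pt, functionalOfCoeff ![l₀ * a₀, l₁ * a₀, l₀ * a₁, l₀ * a₂ + l₁ * a₁, l₁ * a₂]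
      (veronese t) = (l₀ * t 0 + l₁ * t 1) * (a₀ + a₁ * t 0 + a₂ * t 1) := by
    intro t
    rw [functionalOfCoeff_apply, Fin.sum_univ_five]
    simp [veronese]
    ring
  refine spanRank_add_one_le_insert _ _ T y (fun t ht => (key t).trans (hT t ht)) ?_
  rw [key]
  exact mul_ne_zero hl ha

theorem dot_sub_ne_zero {P Q : Pt} (h : Q ≠ P) :
    -((Q 0 - P 0) * P 0 + (Q 1 - P 1) * P 1) + (Q 0 - P 0) * Q 0 + (Q 1 - P 1) * Q 1 ≠ 0 := by
  have := dot_self_ne_zero (sub_ne_zero.2 h)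
  simp only [Pi.sub_apply] at this
  intro h'
  exact this (by linear_combination h')

theorem one_le_spanRank_veronese {P : Pt} (hP : P ≠ 0) : 1 ≤ spanRank veronese {P} :=
  le_trans (by omega) (spanRank_veronese_add_one_le (P 0) (P 1) 1 0 0 ∅ P (by simp)
    (dot_self_ne_zero hP) (by simp))

theorem two_le_spanRank_veronese {P Q : Pt} (hP : P ≠ 0) (hQ : Q ≠ 0) (hQP : Q ≠ P) :
    2 ≤ spanRank veronese {Q, P} := by
  have h1 := one_le_spanRank_veronese hP
  have h2 := spanRank_veronese_add_one_le (Q 0) (Q 1) _ _ _ {P} Q (by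
    intro t ht
    rw [Finset.mem_singleton.1 ht]
    ring) (dot_self_ne_zero hQ) (dot_sub_ne_zero hQP)
  omega

theorem three_le_spanRank_veronese {P Q R : Pt} (hR : R ≠ 0) (hRP : R ≠ P) (hRQ : R ≠ Q)
    (hPQ : -P 1 * Q 0 + P 0 * Q 1 ≠ 0) : 3 ≤ spanRank veronese {R, Q, P} := by
  have hP0 : P ≠ 0 := by
    rintro rfl
    simp at hPQ
  have hQ0 : Q ≠ 0 := by
    rintro rfl
    simp at hPQ
  have hQP : Q ≠ P := by
    rintro rfl
    exact hPQ (by ring)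
  have h2 := two_le_spanRank_veronese hP0 hQ0 hQP
  suffices h3 : spanRank veronese {Q, P} + 1 ≤ spanRank veronese {R, Q, P} by omega
  by_cases hPR : -P 1 * R 0 + P 0 * R 1 = 0
  · refine spanRank_veronese_add_one_le (-Q 1) (Q 0) _ _ _ _ R ?_ ?_ (dot_sub_ne_zero hRP)
    · intro t ht
      simp only [Finset.mem_insert, Finset.mem_singleton] at ht
      rcases ht with rfl | rfl <;> ring
    · intro hQR
      apply hR
      ext i
      fin_cases i
      · exact (mul_eq_zero.1 (show (-P 1 * Q 0 + P 0 * Q 1) * R 0 = 0 by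
          linear_combination Q 0 * hPR - P 0 * hQR)).resolve_left hPQ
      · exact (mul_eq_zero.1 (show (-P 1 * Q 0 + P 0 * Q 1) * R 1 = 0 by
          linear_combination Q 1 * hPR - P 1 * hQR)).resolve_left hPQ
  · refine spanRank_veronese_add_one_le (-P 1) (P 0) _ _ _ _ R ?_ hPR (dot_sub_ne_zero hRQ)
    intro t ht
    simp only [Finset.mem_insert, Finset.mem_singleton] at ht
    rcases ht with rfl | rfl <;> ring

theorem four_le_spanRank_veronese_of_central {P Q R R' : Pt} (hQ0 : Q ≠ 0) (hQP : Q ≠ P)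
    (hPQ : -P 1 * Q 0 + P 0 * Q 1 = 0) (hPR : -P 1 * R 0 + P 0 * R 1 ≠ 0)
    (hPR' : -P 1 * R' 0 + P 0 * R' 1 ≠ 0) (hRR' : R' ≠ R) :
    4 ≤ spanRank veronese {R', R, Q, P} := by
  have hP0 : P ≠ 0 := by
    rintro rfl
    simp at hPR
  have h2 := two_le_spanRank_veronese hP0 hQ0 hQP
  have h3 := spanRank_veronese_add_one_le (-P 1) (P 0) 1 0 0 {Q, P} R (by
    intro t ht
    simp only [Finset.mem_insert, Finset.mem_singleton] at ht
    rcases ht with rfl | rfl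
    · rw [hPQ, zero_mul]
    · ring) hPR (by simp)
  have h4 := spanRank_veronese_add_one_le (-P 1) (P 0) _ _ _ {R, Q, P} R' (by
    intro t ht
    simp only [Finset.mem_insert, Finset.mem_singleton] at ht
    rcases ht with rfl | rfl | rfl
    · ring
    · rw [hPQ, zero_mul]
    · ring) hPR' (dot_sub_ne_zero hRR')
  omega

theorem four_le_spanRank_veronese_of_noncollinear {O P Q R : Pt}
    (hOP : -O 1 * P 0 + O 0 * P 1 ≠ 0) (hOQ : -O 1 * Q 0 + O 0 * Q 1 ≠ 0)
    (hOR : -O 1 * R 0 + O 0 * R 1 ≠ 0) (hQP : Q ≠ P)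
    (hPQR : (-P 1 * Q 0 + P 0 * Q 1) + -(Q 1 - P 1) * R 0 + (Q 0 - P 0) * R 1 ≠ 0) :
    4 ≤ spanRank veronese {R, Q, P, O} := by
  have hO0 : O ≠ 0 := by
    rintro rfl
    simp at hOP
  have h1 := one_le_spanRank_veronese hO0
  have h2 := spanRank_veronese_add_one_le (-O 1) (O 0) 1 0 0 {O} P (by
    intro t ht
    rw [Finset.mem_singleton.1 ht]
    ring) hOP (by simp)
  have h3 := spanRank_veronese_add_one_le (-O 1) (O 0) _ _ _ {P, O} Q (by
    intro t ht
    simp only [Finset.mem_insert, Finset.mem_singleton] at ht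
    rcases ht with rfl | rfl <;> ring) hOQ (dot_sub_ne_zero hQP)
  have h4 := spanRank_veronese_add_one_le (-O 1) (O 0) _ _ _ {Q, P, O} R (by
    intro t ht
    simp only [Finset.mem_insert, Finset.mem_singleton] at ht
    rcases ht with rfl | rfl | rfl <;> ring) hOR hPQR
  omega

/-! ### The cardinality conditions for the partition -/

theorem card_le_mul_spanRank_id {e : ℕ} {S : Finset Pt} (h0 : ∀ y ∈ S, y ≠ 0)
    (hcentral : ∀ p q : ℝ, (p ≠ 0 ∨ q ≠ 0) → (∀ y ∈ S, p * y 0 + q * y 1 = 0) → S.card ≤ e)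
    (hcard : S.card ≤ 2 * e) : S.card ≤ e * spanRank id S := by
  rcases S.eq_empty_or_nonempty with rfl | ⟨P, hP⟩
  · simp
  by_cases h : ∀ y ∈ S, -P 1 * y 0 + P 0 * y 1 = 0
  · have h1 := hcentral (-P 1) (P 0) (by
      by_contra h'
      push Not at h'
      exact h0 P hP (by ext i; fin_cases i <;> simp_all)) h
    exact h1.trans (Nat.le_mul_of_pos_right _ (one_le_spanRank_id hP (h0 P hP)))
  · push Not at h
    obtain ⟨Q, hQ, hPQ⟩ := h
    have h2 := two_le_spanRank_id hP hQ hPQ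
    nlinarith

/-- The condition for partitioning the zeros of `f` into `k` classes separated from `A` by conics
and `e` classes separated from `A` by lines. -/
theorem card_le_mul_spanRank_add {k e : ℕ} {f : BivPoly} {A : Pt} {Y : Finset Pt}
    (hf : f.totalDegree ≤ 2 * k + e) (hA : eval A f ≠ 0)
    (hY : ∀ y ∈ Y, eval (A + y) f = 0)
    (hline : ∀ p q : ℝ, (Y.filter fun y => p * y 0 + q * y 1 = 1).card ≤ 2 * k + e)
    (hcard : Y.card ≤ 5 * k + 2 * e) {S : Finset Pt} (hSY : S ⊆ Y) :
    S.card ≤ k * spanRank veronese S + e * spanRank id S := by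
  have hS : ∀ y ∈ S, eval (A + y) f = 0 := fun y hy => hY y (hSY hy)
  have h0 : ∀ y ∈ S, y ≠ 0 := by
    rintro y hy rfl
    exact hA (by simpa using hS 0 hy)
  rcases S.eq_empty_or_nonempty with rfl | ⟨P, hP⟩
  · simp
  have hPdir : -P 1 ≠ 0 ∨ P 0 ≠ 0 := by
    by_contra h'
    push Not at h'
    exact h0 P hP (by ext i; fin_cases i <;> simp_all)
  have hr1 : 1 ≤ spanRank veronese S := (one_le_spanRank_veronese (h0 P hP)).trans
    (spanRank_mono _ (Finset.singleton_subset_iff.2 hP))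
  have hr2 : ∀ Q ∈ S, Q ≠ P → 2 ≤ spanRank veronese S := fun Q hQ hQP =>
    (two_le_spanRank_veronese (h0 P hP) (h0 Q hQ) hQP).trans
      (spanRank_mono _ (by simp [Finset.insert_subset_iff, hP, hQ]))
  by_cases hcent : ∀ y ∈ S, -P 1 * y 0 + P 0 * y 1 = 0
  · have hn := card_le_of_central_line hf hA hPdir S hS hcent
    have hr' := one_le_spanRank_id hP (h0 P hP)
    by_cases hone : ∀ Q ∈ S, Q = P
    · have hc1 : S.card ≤ 1 := Finset.card_le_one.2 fun a ha b hb => by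
        rw [hone a ha, hone b hb]
      have : k * 1 + e * 1 ≤ k * spanRank veronese S + e * spanRank id S := by gcongr
      omega
    · push Not at hone
      obtain ⟨Q, hQ, hQP⟩ := hone
      have hr := hr2 Q hQ hQP
      have : k * 2 + e * 1 ≤ k * spanRank veronese S + e * spanRank id S := by gcongr
      omega
  push Not at hcent
  obtain ⟨Q, hQ, hPQ⟩ := hcent
  have hQP : Q ≠ P := by
    rintro rfl
    exact hPQ (by ring)
  have hr' := two_le_spanRank_id hP hQ hPQ
  have hr := hr2 Q hQ hQP
  have hreduce : ∀ r ≤ spanRank veronese S, S.card ≤ k * r + e * 2 →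
      S.card ≤ k * spanRank veronese S + e * spanRank id S := by
    intro r hr hle
    refine hle.trans ?_
    gcongr
  have hSle := (Finset.card_le_card hSY).trans hcard
  rcases Nat.eq_zero_or_pos k with hk | hk
  · exact hreduce 0 (Nat.zero_le _) (by omega)
  by_cases hcol : ∀ y ∈ S,
      (-P 1 * Q 0 + P 0 * Q 1) + -(Q 1 - P 1) * y 0 + (Q 0 - P 0) * y 1 = 0
  · refine hreduce 2 hr ?_
    have h1 : S.card ≤ 2 * k + e := by
      refine (Finset.card_le_card fun y hy => ?_).trans (hline
        ((Q 1 - P 1) / (-P 1 * Q 0 + P 0 * Q 1)) (-(Q 0 - P 0) / (-P 1 * Q 0 + P 0 * Q 1)))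
      refine Finset.mem_filter.2 ⟨hSY hy, ?_⟩
      rw [div_mul_eq_mul_div, div_mul_eq_mul_div, ← add_div, div_eq_one_iff_eq hPQ]
      linear_combination -hcol y hy
    omega
  push Not at hcol
  obtain ⟨R, hR, hPQR⟩ := hcol
  have hRP : R ≠ P := by
    rintro rfl
    exact hPQR (by ring)
  have hRQ : R ≠ Q := by
    rintro rfl
    exact hPQR (by ring)
  have hr3 : 3 ≤ spanRank veronese S := (three_le_spanRank_veronese (h0 R hR) hRP hRQ hPQ).trans
    (spanRank_mono _ (by simp [Finset.insert_subset_iff, hP, hQ, hR]))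
  rcases Nat.lt_or_ge 4 (spanRank veronese S) with h5 | h5
  · exact hreduce 5 h5 (by omega)
  have hconic : S.card ≤ (2 * k + e) * 2 := by
    obtain ⟨φ, hφ, hφS⟩ := exists_functional_of_spanRank_lt veronese S (by
      rw [Module.finrank_fin_fun]
      omega)
    obtain ⟨c, hc⟩ := exists_coeff_of_functional φ
    refine card_le_of_conic hf hA hY hline (l := c 0) (m := c 1) (a := c 2) (b := c 3) (c := c 4)
      ?_ hSY ?_
    · rintro ⟨e0, e1, e2, e3, e4⟩
      apply hφ
      ext1 i
      ext
      simp [hc, Fin.sum_univ_five, e0, e1, e2, e3, e4]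
    · intro y hy
      have := hφS y hy
      rw [hc, Fin.sum_univ_five] at this
      simpa [veronese] using this
  by_cases h4 : 4 ≤ spanRank veronese S
  · exact hreduce 4 h4 (by omega)
  refine hreduce 3 hr3 ?_
  by_cases hpair : ∃ U ∈ S, ∃ W ∈ S, W ≠ U ∧ -U 1 * W 0 + U 0 * W 1 = 0
  · obtain ⟨U, hU, W, hW, hWU, hUW⟩ := hpair
    have hoff : (S.filter fun y => ¬ -U 1 * y 0 + U 0 * y 1 = 0).card ≤ 1 := by
      refine Finset.card_le_one.2 fun a ha b hb => ?_
      by_contra hab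
      rw [Finset.mem_filter] at ha hb
      refine h4 ((four_le_spanRank_veronese_of_central (h0 W hW) hWU hUW ha.2 hb.2
        (Ne.symm hab)).trans (spanRank_mono _ ?_))
      simp [Finset.insert_subset_iff, hU, hW, ha.1, hb.1]
    have hon : (S.filter fun y => -U 1 * y 0 + U 0 * y 1 = 0).card ≤ 2 * k + e := by
      refine card_le_of_central_line hf hA ?_ _ (fun y hy => hS y (Finset.mem_filter.1 hy).1)
        (fun y hy => (Finset.mem_filter.1 hy).2)
      by_contra h'
      push Not at h'
      exact h0 U hU (by ext i; fin_cases i <;> simp_all)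
    have := S.card_filter_add_card_filter_not fun y => -U 1 * y 0 + U 0 * y 1 = 0
    omega
  · push Not at hpair
    have h3 : S.card ≤ 3 := by
      by_contra h3
      have hsub : ¬ S ⊆ {R, Q, P} := fun h =>
        h3 ((Finset.card_le_card h).trans Finset.card_le_three)
      obtain ⟨O, hO, hO'⟩ := Finset.not_subset.1 hsub
      simp only [Finset.mem_insert, Finset.mem_singleton, not_or] at hO'
      refine h4 ((four_le_spanRank_veronese_of_noncollinear
        (hpair O hO P hP (Ne.symm hO'.2.2)) (hpair O hO Q hQ (Ne.symm hO'.2.1))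
        (hpair O hO R hR (Ne.symm hO'.1)) hQP hPQR).trans (spanRank_mono _ ?_))
      simp [Finset.insert_subset_iff, hP, hQ, hR, hO]
    omega

/-! ### Assembling the product -/

theorem isProductOfLinesAndConics_one : IsProductOfLinesAndConics 1 :=
  ⟨0, by simp, by simp⟩

theorem IsProductOfLinesAndConics.mul {p q : BivPoly} (hp : IsProductOfLinesAndConics p)
    (hq : IsProductOfLinesAndConics q) : IsProductOfLinesAndConics (p * q) := by
  obtain ⟨L, hL, rfl⟩ := hp
  obtain ⟨M, hM, rfl⟩ := hq
  refine ⟨L + M, fun r hr => ?_, by simp⟩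
  exact (Multiset.mem_add.1 hr).elim (hL r) (hM r)

theorem isProductOfLinesAndConics_of_totalDegree_le {p : BivPoly} {A : Pt}
    (hp : p.totalDegree ≤ 2) (hA : eval A p = 1) : IsProductOfLinesAndConics p := by
  by_cases h0 : p.totalDegree = 0
  · rw [totalDegree_eq_zero_iff_eq_C] at h0
    rw [h0, eval_C] at hA
    rw [h0, hA, C_1]
    exact isProductOfLinesAndConics_one
  · exact ⟨{p}, by simp; omega, by simp⟩

theorem exists_conic_of_spanRank_eq_card (A : Pt) (S : Finset Pt)
    (h : spanRank veronese S = S.card) :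
    ∃ q : BivPoly, q.totalDegree ≤ 2 ∧ eval A q = 1 ∧ ∀ y ∈ S, eval (A + y) q = 0 := by
  obtain ⟨φ, hφ⟩ := exists_functional_eq_of_spanRank_eq_card veronese S h (-1)
  obtain ⟨c, hc⟩ := exists_coeff_of_functional φ
  let Z : Fin 2 → BivPoly := fun i => X i - C (A i)
  have hZ : ∀ i, (Z i).totalDegree ≤ 1 := fun i =>
    (totalDegree_sub_C_le _ _).trans (totalDegree_X i).le
  have hZZ : ∀ i j, (Z i * Z j).totalDegree ≤ 2 := fun i j =>
    (totalDegree_mul _ _).trans (add_le_add (hZ i) (hZ j))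
  have hterm : ∀ (a : ℝ) (p : BivPoly), p.totalDegree ≤ 2 → (C a * p).totalDegree ≤ 2 :=
    fun a p hp => (totalDegree_mul _ _).trans (by rw [totalDegree_C]; omega)
  have hadd : ∀ p q : BivPoly, p.totalDegree ≤ 2 → q.totalDegree ≤ 2 →
      (p + q).totalDegree ≤ 2 := fun p q hp hq => (totalDegree_add _ _).trans (max_le hp hq)
  refine ⟨C 1 + C (c 0) * Z 0 + C (c 1) * Z 1 + C (c 2) * (Z 0 * Z 0) + C (c 3) * (Z 0 * Z 1) +
    C (c 4) * (Z 1 * Z 1), ?_, ?_, ?_⟩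
  · refine hadd _ _ (hadd _ _ (hadd _ _ (hadd _ _ (hadd _ _ ?_ ?_) ?_) ?_) ?_) ?_
    · rw [totalDegree_C]; omega
    · exact hterm _ _ ((hZ _).trans one_le_two)
    · exact hterm _ _ ((hZ _).trans one_le_two)
    · exact hterm _ _ (hZZ _ _)
    · exact hterm _ _ (hZZ _ _)
    · exact hterm _ _ (hZZ _ _)
  · simp [Z]
  · intro y hy
    have := hφ y hy
    rw [hc, Fin.sum_univ_five] at this
    simp [veronese] at this
    simp [Z]
    linear_combination this

theorem totalDegree_affine_le (A : Pt) (a b : ℝ) :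
    (C 1 + C a * (X 0 - C (A 0)) + C b * (X 1 - C (A 1)) : BivPoly).totalDegree ≤ 1 := by
  have hterm : ∀ (s : ℝ) (i : Fin 2), (C s * (X i - C (A i)) : BivPoly).totalDegree ≤ 1 :=
    fun s i => (totalDegree_mul _ _).trans (by
      have := totalDegree_sub_C_le (X i : BivPoly) (A i)
      rw [totalDegree_X] at this
      rw [totalDegree_C]
      omega)
  refine (totalDegree_add _ _).trans (max_le ((totalDegree_add _ _).trans (max_le ?_ ?_)) ?_)
  · rw [totalDegree_C]; omega
  · exact hterm _ _
  · exact hterm _ _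

theorem exists_line_of_spanRank_eq_card (A : Pt) (S : Finset Pt)
    (h : spanRank id S = S.card) :
    ∃ q : BivPoly, q.totalDegree ≤ 1 ∧ eval A q = 1 ∧ ∀ y ∈ S, eval (A + y) q = 0 := by
  obtain ⟨φ, hφ⟩ := exists_functional_eq_of_spanRank_eq_card id S h (-1)
  obtain ⟨c, hc⟩ := exists_coeff_of_functional φ
  refine ⟨C 1 + C (c 0) * (X 0 - C (A 0)) + C (c 1) * (X 1 - C (A 1)), totalDegree_affine_le A _ _,
    ?_, ?_⟩
  · simp
  · intro y hy
    have := hφ y hy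
    rw [hc, Fin.sum_univ_two] at this
    simp at this
    simp
    linear_combination this

/-- Covering a set that satisfies the partition condition by `k` conics and `e` lines that avoid
`A`. -/
theorem exists_product_of_card_le_spanRank (k e : ℕ) (A : Pt) (Y : Finset Pt)
    (hY : ∀ S ⊆ Y, S.card ≤ k * spanRank veronese S + e * spanRank id S) :
    ∃ p : BivPoly, p.totalDegree ≤ 2 * k + e ∧ eval A p = 1 ∧ (∀ y ∈ Y, eval (A + y) p = 0) ∧
      IsProductOfLinesAndConics p := by
  let r : Fin k ⊕ Fin e → Finset Pt → ℕ :=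
    Sum.elim (fun _ => spanRank veronese) (fun _ => spanRank id)
  obtain ⟨c, hc, hr⟩ := exists_partition_of_card_le_sum_rank r
    (by rintro (i | i) S T h <;> exact spanRank_mono _ h)
    (by rintro (i | i) S T <;> exact spanRank_union_add_inter_le _ S T)
    (by rintro (i | i) S <;> exact spanRank_le_card _ S) Y
    (by
      intro S hS
      simpa [r] using hY S hS)
  let d : Fin k ⊕ Fin e → ℕ := Sum.elim (fun _ => 2) (fun _ => 1)
  have hq : ∀ i, ∃ q : BivPoly, q.totalDegree ≤ d i ∧ eval A q = 1 ∧
      ∀ y ∈ Y.filter (fun y => i ∈ c y), eval (A + y) q = 0 := by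
    rintro (i | i)
    · exact exists_conic_of_spanRank_eq_card A _ (hr (Sum.inl i))
    · exact exists_line_of_spanRank_eq_card A _ (hr (Sum.inr i))
  choose q hdeg hqA hqY using hq
  refine ⟨∏ i, q i, ?_, ?_, ?_, ?_⟩
  · refine (totalDegree_finsetProd _ _).trans ((Finset.sum_le_sum fun i _ => hdeg i).trans ?_)
    simp [d, mul_comm]
  · simp [map_prod, hqA]
  · intro y hy
    obtain ⟨i, hi⟩ := hc y hy
    rw [map_prod]
    exact Finset.prod_eq_zero (Finset.mem_univ i)
      (hqY i y (Finset.mem_filter.2 ⟨hy, by simp [hi]⟩))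
  · refine Finset.prod_induction _ _ (fun _ _ => IsProductOfLinesAndConics.mul)
      isProductOfLinesAndConics_one fun i _ => ?_
    refine isProductOfLinesAndConics_of_totalDegree_le ((hdeg i).trans ?_) (hqA i)
    rcases i with i | i <;> simp [d]

theorem exists_product_of_fundamental {n : ℕ} (hn : 1 ≤ n) {f : BivPoly} {A : Pt}
    {Y : Finset Pt} (hf : f.totalDegree ≤ n) (hA : eval A f ≠ 0)
    (hY : ∀ y ∈ Y, eval (A + y) f = 0) (hcard : Y.card ≤ 2 * n + n / 2) :
    ∃ p : BivPoly, p.totalDegree ≤ n ∧ eval A p = 1 ∧ (∀ y ∈ Y, eval (A + y) p = 0) ∧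
      IsProductOfLinesAndConics p := by
  by_cases hline : ∀ p q : ℝ, (Y.filter fun y => p * y 0 + q * y 1 = 1).card ≤ n
  · have hn2 : 2 * (n / 2) + n % 2 = n := Nat.div_add_mod n 2
    obtain ⟨p, hp, h⟩ := exists_product_of_card_le_spanRank (n / 2) (n % 2) A Y fun S hS =>
      card_le_mul_spanRank_add (by omega) hA hY (by rwa [hn2]) (by omega) hS
    exact ⟨p, by omega, h⟩
  · push Not at hline
    obtain ⟨a, b, hab⟩ := hline
    have hsplit := Y.card_filter_add_card_filter_not fun y => a * y 0 + b * y 1 = 1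
    obtain ⟨p, hp, hpA, hpY, hprod⟩ := exists_product_of_card_le_spanRank 0 (n - 1) A
      (Y.filter fun y => ¬ a * y 0 + b * y 1 = 1) fun S hS => by
        rw [zero_mul, zero_add]
        have hSY : ∀ y ∈ S, y ∈ Y := fun y hy => (Finset.mem_filter.1 (hS hy)).1
        refine card_le_mul_spanRank_id ?_ ?_ ?_
        · rintro y hy rfl
          exact hA (by simpa using hY 0 (hSY 0 hy))
        · intro p q hpq hSline
          have := card_lt_of_central_line_of_line hf hA _
            (fun y hy => hY y (Finset.mem_filter.1 hy).1)
            (fun y hy => (Finset.mem_filter.1 hy).2) hab hpq S (fun y hy => hY y (hSY y hy))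
            hSline (fun y hy => (Finset.mem_filter.1 (hS hy)).2)
          omega
        · have := Finset.card_le_card hS
          omega
    let ℓ : BivPoly := C 1 + C (-a) * (X 0 - C (A 0)) + C (-b) * (X 1 - C (A 1))
    have hℓ : ℓ.totalDegree ≤ 1 := totalDegree_affine_le A _ _
    have hℓA : eval A ℓ = 1 := by simp [ℓ]
    refine ⟨ℓ * p, (totalDegree_mul _ _).trans (by omega), by rw [map_mul, hℓA, hpA, one_mul],
      fun y hy => ?_, (isProductOfLinesAndConics_of_totalDegree_le (hℓ.trans one_le_two) hℓA).mul
        hprod⟩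
    rw [map_mul]
    by_cases h : a * y 0 + b * y 1 = 1
    · rw [mul_eq_zero]
      left
      simp [ℓ]
      linear_combination -h
    · rw [hpY y (Finset.mem_filter.2 ⟨hy, h⟩), mul_zero]

/-- Every node of an `n`-independent set of at most `2n + ⌊n/2⌋ + 1` nodes has an
`n`-fundamental polynomial which is a product of polynomials of degree 1 or 2. -/
theorem fundamental_product_of_lines_and_conics (n : ℕ) (hn : 1 ≤ n) (X : Finset Pt)
    (hind : IsIndependent n X) (hcard : X.card ≤ 2 * n + n / 2 + 1) :
    ∀ A ∈ X, ∃ p : BivPoly, IsFundamental n X A p ∧ IsProductOfLinesAndConics p := by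
  intro A hAX
  obtain ⟨f, hf, hfA, hfX⟩ := hind A hAX
  obtain ⟨p, hp, hpA, hpY, hprod⟩ := exists_product_of_fundamental hn hf (A := A)
    (Y := (X.erase A).image fun B => B - A) (by rw [hfA]; exact one_ne_zero) (by
      intro y hy
      obtain ⟨B, hB, rfl⟩ := Finset.mem_image.1 hy
      rw [add_sub_cancel]
      exact hfX B (Finset.mem_of_mem_erase hB) (Finset.ne_of_mem_erase hB)) (by
      refine Finset.card_image_le.trans ?_
      rw [Finset.card_erase_of_mem hAX]
      omega)
  refine ⟨p, ⟨hp, hpA, fun B hB hBA => ?_⟩, hprod⟩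
  have := hpY (B - A) (Finset.mem_image_of_mem _ (Finset.mem_erase.2 ⟨hBA, hB⟩))
  rwa [add_sub_cancel] at this
end
end

section
/- For every n ≥ 3 there exists an n-independent set X of nodes in ℝ² with #X = 2n + ⌊n/2⌋ + 2 and a node A ∈ X such that no n-fundamental polynomial of A is a product of polynomials each of total degree 1 or 2; i.e., the conclusion of the previous theorem fails in general for n-independent node sets with at least 2n + ⌊n/2⌋ + 2 nodes. -/
open MvPolynomial
open scoped Classical

noncomputable section

/-- The point with parameter `t` on the cubic curve `y = x³`. -/
def cubicPt (t : ℝ) : Pt := ![t, t ^ 3]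

lemma cubicPt_injective : Function.Injective cubicPt := fun s t h => by
  simpa [cubicPt] using congrFun h 0

/-- The restriction of a bivariate polynomial to the curve `y = x³`. -/
def restrictCubic (q : BivPoly) : Polynomial ℝ :=
  ∑ m ∈ q.support, Polynomial.monomial (m 0 + 3 * m 1) (q.coeff m)

lemma eval_restrictCubic (q : BivPoly) (t : ℝ) :
    (restrictCubic q).eval t = eval (cubicPt t) q := by
  rw [restrictCubic, Polynomial.eval_finsetSum, eval_eq']
  refine Finset.sum_congr rfl fun m _ => ?_
  simp [cubicPt, Fin.prod_univ_two, pow_add, pow_mul]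

lemma coeff_restrictCubic (q : BivPoly) (e : ℕ) :
    (restrictCubic q).coeff e =
      ∑ m ∈ q.support, if m 0 + 3 * m 1 = e then q.coeff m else 0 := by
  simp [restrictCubic, Polynomial.finsetSum_coeff, Polynomial.coeff_monomial]

lemma add_le_totalDegree {q : BivPoly} {m : Fin 2 →₀ ℕ} (hm : m ∈ q.support) :
    m 0 + m 1 ≤ q.totalDegree := by
  have h := le_totalDegree hm
  rwa [Finsupp.sum_fintype _ _ (fun _ => rfl), Fin.sum_univ_two] at h

/-- A conic restricted to the cubic does not vanish identically. -/
lemma restrictCubic_ne_zero {q : BivPoly} (hq : q ≠ 0) (hd : q.totalDegree ≤ 2) :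
    restrictCubic q ≠ 0 := by
  obtain ⟨m, hm⟩ := (support_nonempty (p := q)).2 hq
  intro h
  have hc := coeff_restrictCubic q (m 0 + 3 * m 1)
  rw [h, Polynomial.coeff_zero, Finset.sum_eq_single_of_mem m hm, if_pos rfl] at hc
  · exact mem_support_iff.1 hm hc.symm
  · intro k hk hkm
    refine if_neg fun he => hkm ?_
    have h₁ := add_le_totalDegree hk
    have h₂ := add_le_totalDegree hm
    ext i
    fin_cases i <;> simp <;> omega

lemma natDegree_restrictCubic_le (q : BivPoly) :
    (restrictCubic q).natDegree ≤ 3 * q.totalDegree := by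
  refine Polynomial.natDegree_sum_le_of_forall_le _ _ fun m hm => ?_
  refine (Polynomial.natDegree_monomial_le _).trans ?_
  have := add_le_totalDegree hm
  omega

lemma coeff_restrictCubic_eq_zero {q : BivPoly} {e : ℕ} (he : e + 1 = 3 * q.totalDegree) :
    (restrictCubic q).coeff e = 0 := by
  rw [coeff_restrictCubic]
  refine Finset.sum_eq_zero fun m hm => if_neg ?_
  have := add_le_totalDegree hm
  omega

/-- A nonzero polynomial of degree at most `m + 1` without a term of degree `m` has at most
`m` positive roots. -/
lemma card_positive_roots_le {Q : Polynomial ℝ} (hQ : Q ≠ 0) {m : ℕ}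
    (hdeg : Q.natDegree ≤ m + 1) (hcoeff : Q.coeff m = 0) {T : Finset ℝ}
    (hpos : ∀ t ∈ T, 0 < t) (hroot : ∀ t ∈ T, Q.eval t = 0) : T.card ≤ m := by
  by_contra! hlt
  have hle : T.val ≤ Q.roots := (Multiset.le_iff_subset T.nodup).2 fun t ht =>
    (Polynomial.mem_roots hQ).2 (hroot t ht)
  have hcard : Q.roots.card ≤ Q.natDegree := Q.card_roots'
  have hTr : T.card ≤ Q.roots.card := Multiset.card_le_card hle
  have hT : T.val = Q.roots := Multiset.eq_of_le_of_card_le hle (by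
    change _ ≤ T.card; omega)
  have hnat : Q.natDegree = m + 1 := by omega
  have hsplit : Q.Splits := Polynomial.splits_iff_card_roots.2 (by omega)
  have hnext := hsplit.nextCoeff_eq_neg_sum_roots_mul_leadingCoeff
  rw [Polynomial.nextCoeff_of_natDegree_pos (by omega), hnat, Nat.add_sub_cancel, hcoeff,
    ← hT] at hnext
  have hsum : 0 < T.val.sum := by
    rw [Finset.sum_val]
    exact Finset.sum_pos hpos (Finset.card_pos.1 (by omega))
  have := mul_ne_zero (Polynomial.leadingCoeff_ne_zero.2 hQ) hsum.ne'
  grind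

/-- A line passes through at most two, and a conic through at most five, points of the cubic
with positive parameter. -/
lemma two_mul_card_le_of_line_or_conic {q : BivPoly} (hq : q ≠ 0)
    (hd : q.totalDegree = 1 ∨ q.totalDegree = 2) {T : Finset ℝ} (hpos : ∀ t ∈ T, 0 < t)
    (hroot : ∀ t ∈ T, eval (cubicPt t) q = 0) : 2 * T.card ≤ 5 * q.totalDegree := by
  have h := card_positive_roots_le (m := 3 * q.totalDegree - 1)
    (restrictCubic_ne_zero hq (by omega))
    ((natDegree_restrictCubic_le q).trans (by omega))
    (coeff_restrictCubic_eq_zero (by omega)) hpos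
    (fun t ht => (eval_restrictCubic q t).trans (hroot t ht))
  omega

/-- A nonzero product of lines and conics of total degree `d` passes through at most `5d/2`
points of the cubic with positive parameter. -/
lemma two_mul_card_le_of_prod (L : Multiset BivPoly)
    (hL : ∀ q ∈ L, q.totalDegree = 1 ∨ q.totalDegree = 2) (hne : L.prod ≠ 0) (T : Finset ℝ)
    (hpos : ∀ t ∈ T, 0 < t) (hroot : ∀ t ∈ T, eval (cubicPt t) L.prod = 0) :
    2 * T.card ≤ 5 * L.prod.totalDegree := by
  induction L using Multiset.induction_on generalizing T with
  | empty =>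
    have : T = ∅ := Finset.eq_empty_of_forall_notMem fun t ht => by simpa using hroot t ht
    simp [this]
  | cons q L ih =>
    rw [Multiset.prod_cons] at hne hroot ⊢
    have hq := left_ne_zero_of_mul hne
    have hP := right_ne_zero_of_mul hne
    have h₁ := two_mul_card_le_of_line_or_conic hq (hL q (Multiset.mem_cons_self q L))
      (T := T.filter fun t => eval (cubicPt t) q = 0)
      (fun t ht => hpos t (Finset.mem_filter.1 ht).1) (fun t ht => (Finset.mem_filter.1 ht).2)
    have h₂ := ih (fun r hr => hL r (Multiset.mem_cons_of_mem hr)) hP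
      (T.filter fun t => ¬ eval (cubicPt t) q = 0)
      (fun t ht => hpos t (Finset.mem_filter.1 ht).1) (fun t ht => by
        obtain ⟨ht, hne⟩ := Finset.mem_filter.1 ht
        have := hroot t ht
        rw [map_mul] at this
        exact (mul_eq_zero.1 this).resolve_left hne)
    have h₃ := Finset.card_filter_add_card_filter_not (s := T)
      (fun t => eval (cubicPt t) q = 0)
    rw [totalDegree_mul_of_isDomain hq hP]
    omega

/-- A univariate polynomial of degree at most `3n` without a term of degree `3n - 1` is the
restriction to the cubic of a bivariate polynomial of total degree at most `n`. -/
lemma exists_eval_cubicPt_eq {n : ℕ} {Q : Polynomial ℝ} (hdeg : Q.natDegree ≤ 3 * n)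
    (hcoeff : Q.coeff (3 * n - 1) = 0) :
    ∃ p : BivPoly, p.totalDegree ≤ n ∧ ∀ t, eval (cubicPt t) p = Q.eval t := by
  refine ⟨∑ e ∈ Q.support, C (Q.coeff e) * (X 0 ^ (e % 3) * X 1 ^ (e / 3)), ?_, fun t => ?_⟩
  · refine totalDegree_finsetSum_le fun e he => ?_
    have h₁ : e ≤ 3 * n := (Polynomial.le_natDegree_of_mem_supp e he).trans hdeg
    have h₂ : e ≠ 3 * n - 1 := by
      rintro rfl
      exact Polynomial.mem_support_iff.1 he hcoeff
    refine (totalDegree_mul _ _).trans ?_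
    rw [totalDegree_C, zero_add]
    refine (totalDegree_mul _ _).trans ?_
    rw [totalDegree_X_pow, totalDegree_X_pow]
    omega
  · rw [map_sum, Polynomial.eval_eq_sum, Polynomial.sum]
    refine Finset.sum_congr rfl fun e _ => ?_
    simp only [map_mul, eval_C, map_pow, eval_X, cubicPt, Matrix.cons_val_zero,
      Matrix.cons_val_one, ← pow_mul, ← pow_add, Nat.mod_add_div]

/-- At most `3n` points of the cubic with positive parameters are `n`-independent. -/
lemma isIndependent_image_cubicPt {n : ℕ} {T : Finset ℝ} (hT : T.card ≤ 3 * n)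
    (hpos : ∀ t ∈ T, 0 < t) : IsIndependent n (T.image cubicPt) := by
  intro A hA
  obtain ⟨a, ha, rfl⟩ := Finset.mem_image.1 hA
  have hcard : (T.erase a).card + 1 = T.card := Finset.card_erase_add_one ha
  set s : ℝ := (T.erase a).val.sum with hs
  have hs0 : 0 ≤ s := Multiset.sum_nonneg fun t ht => (hpos t (Finset.mem_of_mem_erase ht)).le
  set M : Multiset ℝ := (-s) ::ₘ (Multiset.replicate (3 * n - T.card) 0 + (T.erase a).val)
    with hM
  have hMcard : M.card = 3 * n := by
    rw [hM, Multiset.card_cons, Multiset.card_add, Multiset.card_replicate, Finset.card_val]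
    omega
  have hMsum : M.sum = 0 := by
    rw [hM, Multiset.sum_cons, Multiset.sum_add, ← hs, Multiset.sum_replicate, smul_zero,
      zero_add, neg_add_cancel]
  have hMa : a ∉ M := by
    have ha0 := hpos a ha
    simp only [hM, Multiset.mem_cons, Multiset.mem_add, Multiset.mem_replicate,
      Finset.mem_val, Finset.mem_erase]
    rintro (h | ⟨-, h⟩ | ⟨h, -⟩)
    · linarith
    · exact ha0.ne' h
    · exact h rfl
  set Q : Polynomial ℝ := (M.map fun t => Polynomial.X - Polynomial.C t).prod with hQ
  have hdeg : Q.natDegree = 3 * n := by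
    rw [hQ, Polynomial.natDegree_multiset_prod_X_sub_C_eq_card, hMcard]
  have hcoeff : Q.coeff (3 * n - 1) = 0 := by
    have hnext := Polynomial.multiset_prod_X_sub_C_nextCoeff M
    rwa [← hQ, Polynomial.nextCoeff_of_natDegree_pos (by omega), hdeg, hMsum, neg_zero] at hnext
  have hroot : ∀ t, Q.eval t = 0 ↔ t ∈ M := fun t => by
    rw [← Polynomial.IsRoot.def, ← Polynomial.mem_roots
      (Polynomial.monic_multisetProd_X_sub_C M).ne_zero,
      Polynomial.roots_multiset_prod_X_sub_C]
  obtain ⟨p, hp, heval⟩ := exists_eval_cubicPt_eq hdeg.le hcoeff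
  have hQa : Q.eval a ≠ 0 := fun h => hMa ((hroot a).1 h)
  refine ⟨C (Q.eval a)⁻¹ * p, (totalDegree_mul _ _).trans (by simpa using hp), ?_, ?_⟩
  · rw [map_mul, eval_C, heval, inv_mul_cancel₀ hQa]
  · intro B hB hBA
    obtain ⟨b, hb, rfl⟩ := Finset.mem_image.1 hB
    have hbM : b ∈ M := by
      have : b ∈ (T.erase a).val := Finset.mem_erase.2 ⟨fun h => hBA (by rw [h]), hb⟩
      simp only [hM, Multiset.mem_cons, Multiset.mem_add, this, or_true]
    rw [map_mul, heval, (hroot b).2 hbM, mul_zero]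

/-- For every `n ≥ 3` there is an `n`-independent set of `2n + ⌊n/2⌋ + 2` nodes with a
node none of whose `n`-fundamental polynomials is a product of polynomials of degree
1 or 2. -/
theorem exists_independent_no_line_conic_product (n : ℕ) (hn : 3 ≤ n) :
    ∃ (X : Finset Pt) (A : Pt), A ∈ X ∧ X.card = 2 * n + n / 2 + 2 ∧ IsIndependent n X ∧
      ∀ p : BivPoly, IsFundamental n X A p → ¬ IsProductOfLinesAndConics p := by
  set N := 2 * n + n / 2 + 2 with hN
  set T : Finset ℝ := (Finset.range N).image fun k : ℕ => (k : ℝ) + 1 with hT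
  have hcard : T.card = N := by
    rw [hT, Finset.card_image_of_injective _ fun i j h => by simpa using h, Finset.card_range]
  have hpos : ∀ t ∈ T, 0 < t := fun t ht => by
    obtain ⟨k, -, rfl⟩ := Finset.mem_image.1 ht
    positivity
  have hone : (1 : ℝ) ∈ T := Finset.mem_image.2 ⟨0, Finset.mem_range.2 (by omega), by simp⟩
  refine ⟨T.image cubicPt, cubicPt 1, Finset.mem_image_of_mem _ hone,
    (Finset.card_image_of_injective _ cubicPt_injective).trans hcard,
    isIndependent_image_cubicPt (by omega) hpos, ?_⟩
  rintro p ⟨hdeg, hA, hzero⟩ ⟨L, hL, rfl⟩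
  have hne : L.prod ≠ 0 := by
    intro h
    simp [h] at hA
  have h := two_mul_card_le_of_prod L hL hne (T.erase 1)
    (fun t ht => hpos t (Finset.mem_of_mem_erase ht))
    (fun t ht => hzero _ (Finset.mem_image_of_mem _ (Finset.mem_of_mem_erase ht))
      (cubicPt_injective.ne (Finset.ne_of_mem_erase ht)))
  rw [Finset.card_erase_of_mem hone, hcard] at h
  omega
end
end

section
/- Let n ≥ 1, let X be a finite set of nodes in ℝ² with #X ≤ 2n + ⌊n/2⌋ + 1, and let A ∈ X. Then the following three statements are equivalent: (i) the node A has an n-fundamental polynomial; (ii) the node A has an n-fundamental polynomial which is a product of polynomials each of total degree 1 or 2; (iii) all three of the following hold: (a) no n+1 nodes of X \ {A} are collinear together with A; (b) if n+1 nodes of X \ {A} are collinear, lying on a line α, then no n nodes of X \ ({A} ∪ α) are collinear together with A; (c) no 2n+1 nodes of X \ {A} lie together with A on an irreducible conic (the zero set of an irreducible bivariate polynomial of total degree 2). -/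
open MvPolynomial
open scoped Classical

noncomputable section

/-- Condition (a): no `n+1` nodes of `X \ {A}` are collinear together with `A`. -/
def CondA (n : ℕ) (X : Finset Pt) (A : Pt) : Prop :=
  ¬ ∃ S ⊆ X.erase A, n + 1 ≤ S.card ∧ Collinear ℝ (insert A (S : Set Pt))

/-- Condition (b): if `n+1` nodes of `X \ {A}` lie on an affine line `α`, then no `n`
nodes of `X \ ({A} ∪ α)` are collinear together with `A`. -/
def CondB (n : ℕ) (X : Finset Pt) (A : Pt) : Prop :=
  ∀ α : AffineSubspace ℝ Pt, Module.finrank ℝ α.direction = 1 →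
    (∃ S ⊆ X.erase A, n + 1 ≤ S.card ∧ (S : Set Pt) ⊆ (α : Set Pt)) →
    ¬ ∃ T ⊆ X.erase A, n ≤ T.card ∧ (∀ B ∈ T, B ∉ α) ∧
      Collinear ℝ (insert A (T : Set Pt))

/-- Condition (c): no `2n+1` nodes of `X \ {A}` lie together with `A` on an irreducible
conic, i.e. on the zero set of an irreducible polynomial of total degree `2`. -/
def CondC (n : ℕ) (X : Finset Pt) (A : Pt) : Prop :=
  ¬ ∃ q : BivPoly, Irreducible q ∧ q.totalDegree = 2 ∧ eval A q = 0 ∧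
    2 * n + 1 ≤ ((X.erase A).filter (fun B => eval B q = 0)).card

/-- Rado's theorem on independent transversals, for finite families of vectors. -/
theorem exists_linearIndependent_transversal {K W E ι : Type*} [Field K] [AddCommGroup W]
    [Module K W] [FiniteDimensional K W] [Fintype E] (w : E → ι → W) (R : E → Finset ι)
    (h : ∀ S : Finset E, S.card ≤
      Module.finrank K (Submodule.span K {x | ∃ e ∈ S, ∃ i ∈ R e, w e i = x})) :
    ∃ c : E → ι, LinearIndependent K (fun e => w e (c e)) := by
  induction hN : ∑ e, (R e).card using Nat.strong_induction_on generalizing R with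
  | _ N ih =>
  by_cases hone : ∀ e, (R e).card ≤ 1
  · have hne : ∀ e, ∃ i, R e = {i} := by
      intro e
      refine Finset.card_eq_one.1 (le_antisymm (hone e) ?_)
      by_contra hlt
      have h0 : R e = ∅ := by
        rw [← Finset.card_eq_zero]; omega
      have := h {e}
      simp [h0] at this
    choose c hc using hne
    refine ⟨c, ?_⟩
    rw [linearIndependent_iff_card_le_finrank_span]
    have := h Finset.univ
    rw [Finset.card_univ] at this
    have hset : {x | ∃ e ∈ Finset.univ, ∃ i ∈ R e, w e i = x} =
        Set.range (fun e => w e (c e)) := by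
      ext x
      simp [hc]
    rwa [hset] at this
  · push Not at hone
    obtain ⟨e, he⟩ := hone
    obtain ⟨i, hi, j, hj, hij⟩ := Finset.one_lt_card.1 he
    have key : ∀ k ∈ R e, (∀ S : Finset E, S.card ≤ Module.finrank K
        (Submodule.span K {x | ∃ e' ∈ S, ∃ i ∈ Function.update R e ((R e).erase k) e',
          w e' i = x})) →
        ∃ c : E → ι, LinearIndependent K (fun e => w e (c e)) := by
      intro k hk hS
      refine ih _ ?_ _ hS rfl
      rw [← hN]
      refine Finset.sum_lt_sum (fun e' _ => ?_) ⟨e, Finset.mem_univ _, ?_⟩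
      · by_cases h' : e' = e
        · subst h'; simpa using Finset.card_erase_le
        · simp [h']
      · simpa using Finset.card_erase_lt_of_mem hk
    have fails : ∀ k, (¬ ∀ S : Finset E, S.card ≤ Module.finrank K
        (Submodule.span K {x | ∃ e' ∈ S, ∃ i ∈ Function.update R e ((R e).erase k) e',
          w e' i = x})) →
        ∃ P : Finset E, e ∉ P ∧ ∃ U : Submodule K W, Module.finrank K U ≤ P.card ∧
          (∀ e' ∈ P, ∀ i ∈ R e', w e' i ∈ U) ∧ ∀ i ∈ R e, i ≠ k → w e i ∈ U := by
      intro k hk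
      push Not at hk
      obtain ⟨S, hS⟩ := hk
      have heS : e ∈ S := by
        by_contra heS
        refine absurd (h S) (not_le.2 ?_)
        have hset : {x | ∃ e' ∈ S, ∃ i ∈ R e', w e' i = x} =
            {x | ∃ e' ∈ S, ∃ i ∈ Function.update R e ((R e).erase k) e', w e' i = x} := by
          ext x
          refine exists_congr fun e' => and_congr_right fun he' => ?_
          have : e' ≠ e := fun h => heS (h ▸ he')
          simp [this]
        rwa [hset]
      refine ⟨S.erase e, by simp, Submodule.span K {x | ∃ e' ∈ S,
        ∃ i ∈ Function.update R e ((R e).erase k) e', w e' i = x}, ?_, ?_, ?_⟩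
      · rw [Finset.card_erase_of_mem heS]; omega
      · intro e' he' i hi
        have hne : e' ≠ e := Finset.ne_of_mem_erase he'
        exact Submodule.subset_span ⟨e', Finset.mem_of_mem_erase he', i,
          by simpa [hne] using hi, rfl⟩
      · intro i hi hik
        exact Submodule.subset_span ⟨e, heS, i, by simp [hik, hi], rfl⟩
    by_contra hcon
    obtain ⟨P, heP, U, hU, hPU, heU⟩ := fails i (fun hS => hcon (key i hi hS))
    obtain ⟨Q, heQ, V, hV, hQV, heV⟩ := fails j (fun hS => hcon (key j hj hS))
    have h1 := h (insert e (P ∪ Q))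
    have h2 := h (P ∩ Q)
    have h3 := Submodule.finrank_sup_add_finrank_inf_eq U V
    have h4 := Finset.card_union_add_card_inter P Q
    rw [Finset.card_insert_of_notMem (by simp [heP, heQ])] at h1
    have h5 := Submodule.finrank_mono (R := K) (s := Submodule.span K
      {x | ∃ e' ∈ insert e (P ∪ Q), ∃ i ∈ R e', w e' i = x}) (t := U ⊔ V) (by
        rw [Submodule.span_le]
        rintro x ⟨e', he', l, hl, rfl⟩
        rcases Finset.mem_insert.1 he' with rfl | he'
        · by_cases hli : l = i
          · exact Submodule.mem_sup_right (heV l hl (by rw [hli]; exact hij))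
          · exact Submodule.mem_sup_left (heU l hl hli)
        · rcases Finset.mem_union.1 he' with he' | he'
          · exact Submodule.mem_sup_left (hPU _ he' _ hl)
          · exact Submodule.mem_sup_right (hQV _ he' _ hl))
    have h6 := Submodule.finrank_mono (R := K) (s := Submodule.span K
      {x | ∃ e' ∈ P ∩ Q, ∃ i ∈ R e', w e' i = x}) (t := U ⊓ V) (by
        rw [Submodule.span_le]
        rintro x ⟨e', he', l, hl, rfl⟩
        rw [Finset.mem_inter] at he'
        exact ⟨hPU _ he'.1 _ hl, hQV _ he'.2 _ hl⟩)
    omega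

/-- If `φ i` (`i : ι`) are finitely many vector configurations on `E` whose ranks satisfy the
matroid union condition, then `E` is coloured by `ι` so that on each colour class some functional is
constantly `1`. -/
theorem exists_coloring_functional {K V E ι : Type*} [Field K] [AddCommGroup V]
    [Module K V] [FiniteDimensional K V] [Fintype E] [Fintype ι] (φ : ι → E → V)
    (h : ∀ S : Finset E, S.card ≤
      ∑ i, Module.finrank K (Submodule.span K (φ i '' (S : Set E)))) :
    ∃ f : ι → Module.Dual K V, ∀ e, ∃ i, f i (φ i e) = 1 := by
  obtain ⟨c, hc⟩ := exists_linearIndependent_transversal (K := K) (W := ι → V)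
    (fun e i => Pi.single i (φ i e)) (fun _ => Finset.univ) (by
      intro S
      refine (h S).trans ?_
      rw [← Module.finrank_pi_fintype]
      have hle : Submodule.pi Set.univ (fun i => Submodule.span K (φ i '' (S : Set E))) ≤
          Submodule.span K {x | ∃ e ∈ S, ∃ i ∈ (Finset.univ : Finset ι),
            (Pi.single i (φ i e) : ι → V) = x} := by
        intro x hx
        rw [← Finset.univ_sum_single x]
        refine Submodule.sum_mem _ fun i _ => ?_
        have hxi := hx i (Set.mem_univ i)
        have := Submodule.mem_map_of_mem (f := LinearMap.single K (fun _ => V) i) hxi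
        rw [Submodule.map_span] at this
        refine Submodule.span_mono ?_ this
        rintro _ ⟨_, ⟨e, he, rfl⟩, rfl⟩
        exact ⟨e, he, i, Finset.mem_univ _, rfl⟩
      let g : (∀ i, Submodule.span K (φ i '' (S : Set E))) →ₗ[K] (ι → V) :=
        LinearMap.pi fun i => (Submodule.subtype _).comp (LinearMap.proj i)
      have hg : Function.Injective g := by
        intro a b hab
        ext i
        exact congrFun hab i
      rw [← LinearMap.finrank_range_of_inj hg]
      refine Submodule.finrank_mono (le_trans ?_ hle)
      rintro _ ⟨a, rfl⟩ i _
      exact (a i).2)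
  obtain ⟨F, hF⟩ : ∃ F : Module.Dual K (ι → V), ∀ e, F (Pi.single (c e) (φ (c e) e)) = 1 := by
    refine ⟨(Module.Basis.extend hc.linearIndepOn_id).constr K (fun _ => 1), fun e => ?_⟩
    have := (Module.Basis.extend hc.linearIndepOn_id).constr_basis K (fun _ => (1 : K))
      ⟨_, hc.linearIndepOn_id.subset_extend _ ⟨e, rfl⟩⟩
    simpa using this
  exact ⟨fun i => F.comp (LinearMap.single K (fun _ => V) i), fun e => ⟨c e, hF e⟩⟩

/-- The values at `(x, y)` of the monomials of degree one, padded with zeros. -/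
def linVec (x y : ℝ) : Fin 5 → ℝ := ![x, y, 0, 0, 0]

/-- The values at `(x, y)` of the nonconstant monomials of degree at most two. -/
def quadVec (x y : ℝ) : Fin 5 → ℝ := ![x, y, x ^ 2, x * y, y ^ 2]

/-- The rank of the vectors `φ e`, `e ∈ S`. -/
def rankOn {E : Type*} (φ : E → Fin 5 → ℝ) (S : Finset E) : ℕ :=
  Module.finrank ℝ (Submodule.span ℝ (φ '' (S : Set E)))

/-- The linear functional with given coefficients. -/
def coordFun (a : Fin 5 → ℝ) : Module.Dual ℝ (Fin 5 → ℝ) := Fintype.linearCombination ℝ a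

theorem coordFun_apply (a v : Fin 5 → ℝ) :
    coordFun a v = a 0 * v 0 + a 1 * v 1 + a 2 * v 2 + a 3 * v 3 + a 4 * v 4 := by
  simp [coordFun, Fintype.linearCombination_apply, Fin.sum_univ_five]
  ring

theorem dual_eq_coordFun (f : Module.Dual ℝ (Fin 5 → ℝ)) :
    f = coordFun (fun i => f (Pi.single i 1)) := by
  refine (Pi.basisFun ℝ (Fin 5)).ext fun i => ?_
  simp [coordFun, Fintype.linearCombination_apply, Pi.single_apply]

section Rank

variable {E : Type*}

theorem rankOn_step (φ : E → Fin 5 → ℝ) {S T : Finset E} {b : E} (hST : S ⊆ T) (hb : b ∈ T)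
    (f : Module.Dual ℝ (Fin 5 → ℝ)) (hS : ∀ s ∈ S, f (φ s) = 0) (hfb : f (φ b) ≠ 0) :
    rankOn φ S + 1 ≤ rankOn φ T := by
  refine Submodule.finrank_lt_finrank_of_lt (lt_of_le_of_ne
    (Submodule.span_mono (Set.image_mono (Finset.coe_subset.2 hST))) fun heq => ?_)
  have hmem : φ b ∈ Submodule.span ℝ (φ '' (S : Set E)) := by
    rw [heq]; exact Submodule.subset_span ⟨b, hb, rfl⟩
  have hle : Submodule.span ℝ (φ '' (S : Set E)) ≤ LinearMap.ker f := by
    rw [Submodule.span_le]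
    rintro _ ⟨s, hs, rfl⟩
    exact hS s hs
  exact hfb (hle hmem)

variable (x y : E → ℝ)

theorem rankOn_lin_step {S T : Finset E} {b : E} (hST : S ⊆ T) (hb : b ∈ T) (p q : ℝ)
    (hS : ∀ s ∈ S, p * x s + q * y s = 0) (hfb : p * x b + q * y b ≠ 0) :
    rankOn (fun e => linVec (x e) (y e)) S + 1 ≤ rankOn (fun e => linVec (x e) (y e)) T := by
  refine rankOn_step _ hST hb (coordFun ![p, q, 0, 0, 0]) (fun s hs => ?_) ?_
  · simpa [coordFun_apply, linVec] using hS s hs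
  · simpa [coordFun_apply, linVec] using hfb

theorem rankOn_quad_step {S T : Finset E} {b : E} (hST : S ⊆ T) (hb : b ∈ T) (p q p' q' r' : ℝ)
    (hS : ∀ s ∈ S, p * x s + q * y s = 0 ∨ p' * x s + q' * y s + r' = 0)
    (hb1 : p * x b + q * y b ≠ 0) (hb2 : p' * x b + q' * y b + r' ≠ 0) :
    rankOn (fun e => quadVec (x e) (y e)) S + 1 ≤
      rankOn (fun e => quadVec (x e) (y e)) T := by
  have hval : ∀ s, coordFun ![p * r', q * r', p * p', p * q' + q * p', q * q']
      (quadVec (x s) (y s)) = (p * x s + q * y s) * (p' * x s + q' * y s + r') := by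
    intro s
    simp [coordFun_apply, quadVec]
    ring
  refine rankOn_step _ hST hb
    (coordFun ![p * r', q * r', p * p', p * q' + q * p', q * q']) (fun s hs => ?_) ?_
  · rw [hval, mul_eq_zero]; exact hS s hs
  · rw [hval]; exact mul_ne_zero hb1 hb2

theorem self_pairing_ne_zero {s t : ℝ} (h : s ≠ 0 ∨ t ≠ 0) : s * s + t * t ≠ 0 := by
  rw [Ne, mul_self_add_mul_self_eq_zero]
  tauto

theorem one_le_rankOn_lin {S : Finset E} {b : E} (hb : b ∈ S) (h0 : x b ≠ 0 ∨ y b ≠ 0) :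
    1 ≤ rankOn (fun e => linVec (x e) (y e)) S := by
  have := rankOn_lin_step x y (Finset.empty_subset S) hb (x b) (y b) (by simp)
    (self_pairing_ne_zero h0)
  omega

theorem one_le_rankOn_quad {S : Finset E} {b : E} (hb : b ∈ S) (h0 : x b ≠ 0 ∨ y b ≠ 0) :
    1 ≤ rankOn (fun e => quadVec (x e) (y e)) S := by
  have := rankOn_quad_step x y (Finset.empty_subset S) hb (x b) (y b) 0 0 1 (by simp)
    (self_pairing_ne_zero h0) (by simp)
  omega

/-- The squared distance of two distinct points is nonzero; this is the value at the second point
of a linear form defining a line through the first. -/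
theorem line_through_avoid {a b : E} (hinj : ∀ e e', x e = x e' → y e = y e' → e = e')
    (hab : a ≠ b) :
    (x b - x a) * x b + (y b - y a) * y b + -((x b - x a) * x a + (y b - y a) * y a) ≠ 0 := by
  intro h
  have h' : (x b - x a) ^ 2 + (y b - y a) ^ 2 = 0 := by linarith
  refine hab (hinj _ _ ?_ ?_) <;> nlinarith [sq_nonneg (x b - x a), sq_nonneg (y b - y a)]

theorem two_le_rankOn_quad (hinj : ∀ e e', x e = x e' → y e = y e' → e = e')
    (hne : ∀ e, x e ≠ 0 ∨ y e ≠ 0) {S : Finset E} {a b : E} (ha : a ∈ S) (hb : b ∈ S)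
    (hab : a ≠ b) :
    2 ≤ rankOn (fun e => quadVec (x e) (y e)) S := by
  have h1 := one_le_rankOn_quad x y (Finset.mem_singleton_self a) (hne a)
  have := rankOn_quad_step x y (Finset.singleton_subset_iff.2 ha) hb (x b) (y b)
    (x b - x a) (y b - y a) (-((x b - x a) * x a + (y b - y a) * y a)) (by simp)
    (self_pairing_ne_zero (hne b))
    (line_through_avoid x y hinj hab)
  omega

theorem three_le_rankOn_quad (hinj : ∀ e e', x e = x e' → y e = y e' → e = e')
    (hne : ∀ e, x e ≠ 0 ∨ y e ≠ 0) {S : Finset E} {a b c : E} (ha : a ∈ S) (hb : b ∈ S)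
    (hc : c ∈ S) (hac : a ≠ c) (hbc : b ≠ c) (hab : y a * x b + -x a * y b ≠ 0) :
    3 ≤ rankOn (fun e => quadVec (x e) (y e)) S := by
  have h2 := two_le_rankOn_quad x y hinj hne (S := {a, c}) (by simp) (by simp) hac
  have := rankOn_quad_step x y (S := {a, c}) (by simp [Finset.insert_subset_iff, ha, hc]) hb
    (y a) (-x a) (x b - x c) (y b - y c) (-((x b - x c) * x c + (y b - y c) * y c))
    (by simp; left; ring) hab
    (line_through_avoid x y hinj hbc.symm)
  omega

theorem four_le_rankOn_quad (hinj : ∀ e e', x e = x e' → y e = y e' → e = e')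
    (hne : ∀ e, x e ≠ 0 ∨ y e ≠ 0) {S : Finset E} (hS : S.Nonempty)
    (hnot : ∀ p q r : ℝ, (p ≠ 0 ∨ q ≠ 0) → ∀ z : E, ∃ s ∈ S, s ≠ z ∧
      p * x s + q * y s + r ≠ 0) :
    4 ≤ rankOn (fun e => quadVec (x e) (y e)) S := by
  obtain ⟨b, hb⟩ := hS
  have hb0 : y b ≠ 0 ∨ -x b ≠ 0 := by simpa [or_comm] using hne b
  obtain ⟨c, hc, -, hcb⟩ := hnot (y b) (-x b) 0 hb0 b
  obtain ⟨d, hd, hdc, hdb⟩ := hnot (y b) (-x b) 0 hb0 c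
  rw [add_zero] at hcb hdb
  have hbd : b ≠ d := by
    rintro rfl
    exact hdb (by ring)
  have h3 := three_le_rankOn_quad x y hinj hne (S := {b, c, d}) (by simp) (by simp) (by simp)
    hbd hdc.symm hcb
  have hsub : {b, c, d} ⊆ S := by simp [Finset.insert_subset_iff, hb, hc, hd]
  have hcd : y c - y d ≠ 0 ∨ x d - x c ≠ 0 := by
    by_contra! h
    exact hdc (hinj _ _ (by linarith [h.2]) (by linarith [h.1]))
  obtain ⟨z, hz, hzb, hzcd⟩ := hnot (y c - y d) (x d - x c)
    (-((y c - y d) * x c + (x d - x c) * y c)) hcd b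
  by_cases hzL : y b * x z + -x b * y z = 0
  · have := rankOn_quad_step x y hsub hz (y c) (-x c) (y b - y d) (x d - x b)
      (-((y b - y d) * x b + (x d - x b) * y b)) ?_ ?_ ?_
    · omega
    · simp only [Finset.mem_insert, Finset.mem_singleton]
      rintro s (rfl | rfl | rfl)
      · right; ring
      · left; ring
      · right; ring
    · intro h
      have h1 : x z * (y b * x c + -x b * y c) = 0 := by
        linear_combination x c * hzL - x b * h
      have h2 : y z * (y b * x c + -x b * y c) = 0 := by
        linear_combination y c * hzL - y b * h
      rcases hne z with h' | h'
      · exact (mul_ne_zero h' hcb) h1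
      · exact (mul_ne_zero h' hcb) h2
    · intro h
      have h1 : (x z - x b) * (y b * x d + -x b * y d) = 0 := by
        linear_combination (x d - x b) * hzL + x b * h
      have h2 : (y z - y b) * (y b * x d + -x b * y d) = 0 := by
        linear_combination (y d - y b) * hzL + y b * h
      refine hzb (hinj _ _ ?_ ?_)
      · exact sub_eq_zero.1 ((mul_eq_zero.1 h1).resolve_right hdb)
      · exact sub_eq_zero.1 ((mul_eq_zero.1 h2).resolve_right hdb)
  · have := rankOn_quad_step x y hsub hz (y b) (-x b) _ _ _ ?_ hzL hzcd
    · omega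
    · simp only [Finset.mem_insert, Finset.mem_singleton]
      rintro s (rfl | rfl | rfl)
      · left; ring
      · right; ring
      · right; ring

theorem two_le_rankOn_lin (hne : ∀ e, x e ≠ 0 ∨ y e ≠ 0) {S : Finset E} (hS : S.Nonempty)
    (hnot : ∀ p q : ℝ, (p ≠ 0 ∨ q ≠ 0) → ∃ s ∈ S, p * x s + q * y s ≠ 0) :
    2 ≤ rankOn (fun e => linVec (x e) (y e)) S := by
  obtain ⟨b, hb⟩ := hS
  obtain ⟨c, hc, hcb⟩ := hnot (y b) (-x b) (by simpa [or_comm] using hne b)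
  have h1 := one_le_rankOn_lin x y (Finset.mem_singleton_self b) (hne b)
  have := rankOn_lin_step x y (Finset.singleton_subset_iff.2 hb) hc (y b) (-x b)
    (by simp; ring) hcb
  omega

theorem exists_conic_of_rankOn_lt {S : Finset E}
    (h : rankOn (fun e => quadVec (x e) (y e)) S < 5) :
    ∃ a : Fin 5 → ℝ, a ≠ 0 ∧ ∀ s ∈ S, coordFun a (quadVec (x s) (y s)) = 0 := by
  have hlt : Submodule.span ℝ ((fun e => quadVec (x e) (y e)) '' (S : Set E)) < ⊤ := by
    refine lt_top_iff_ne_top.2 fun htop => ?_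
    rw [rankOn, htop, finrank_top] at h
    simp at h
  obtain ⟨f, hf, hle⟩ := Submodule.exists_le_ker_of_lt_top _ hlt
  rw [dual_eq_coordFun f] at hf hle
  refine ⟨_, fun h0 => hf ?_, fun s hs => hle (Submodule.subset_span ⟨s, hs, rfl⟩)⟩
  rw [h0]
  ext v
  simp [coordFun_apply]

/-- The matroid union condition for `n / 2` copies of the quadratic configuration and `n % 2`
copies of the linear one. -/
theorem card_le_rank_sum [Fintype E] (hinj : ∀ e e', x e = x e' → y e = y e' → e = e')
    (hne : ∀ e, x e ≠ 0 ∨ y e ≠ 0) {n : ℕ} (hn : 1 ≤ n)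
    (hcard : Fintype.card E ≤ 2 * n + n / 2)
    (hline : ∀ (p q r : ℝ), (p ≠ 0 ∨ q ≠ 0) → ∀ S : Finset E,
      (∀ s ∈ S, p * x s + q * y s + r = 0) → S.card ≤ n)
    (hconic : ∀ a : Fin 5 → ℝ, a ≠ 0 → ∀ S : Finset E,
      (∀ s ∈ S, coordFun a (quadVec (x s) (y s)) = 0) → S.card ≤ 2 * n)
    (S : Finset E) :
    S.card ≤ n / 2 * rankOn (fun e => quadVec (x e) (y e)) S +
      n % 2 * rankOn (fun e => linVec (x e) (y e)) S := by
  set r₂ := rankOn (fun e => quadVec (x e) (y e)) S with hr₂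
  set r₁ := rankOn (fun e => linVec (x e) (y e)) S with hr₁
  have bound : ∀ i j : ℕ, i ≤ r₂ → j ≤ r₁ → S.card ≤ n / 2 * i + n % 2 * j →
      S.card ≤ n / 2 * r₂ + n % 2 * r₁ := fun i j hi hj h => h.trans (by gcongr)
  rcases S.eq_empty_or_nonempty with rfl | hS
  · simp
  have hpair : 2 ≤ S.card → 2 ≤ r₂ := by
    intro h
    obtain ⟨a, ha, b, hb, hab⟩ := Finset.one_lt_card.1 h
    exact two_le_rankOn_quad x y hinj hne ha hb hab
  obtain ⟨b, hb⟩ := id hS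
  by_cases hL : ∃ p q : ℝ, (p ≠ 0 ∨ q ≠ 0) ∧ ∀ s ∈ S, p * x s + q * y s = 0
  · obtain ⟨p, q, hpq, hs⟩ := hL
    have h1 := hline p q 0 hpq S (by simpa using hs)
    have hlin := one_le_rankOn_lin x y hb (hne b)
    by_cases h2 : 2 ≤ S.card
    · exact bound 2 1 (hpair h2) hlin (by omega)
    · exact bound 1 1 (one_le_rankOn_quad x y hb (hne b)) hlin (by omega)
  push Not at hL
  have hlin : 2 ≤ r₁ := two_le_rankOn_lin x y hne hS hL
  by_cases hLz : ∃ p q r : ℝ, (p ≠ 0 ∨ q ≠ 0) ∧ ∃ z : E, ∀ s ∈ S, s ≠ z →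
      p * x s + q * y s + r = 0
  · obtain ⟨p, q, r, hpq, z, hz⟩ := hLz
    have h1 := hline p q r hpq (S.erase z)
      (fun s hs => hz s (Finset.mem_of_mem_erase hs) (Finset.ne_of_mem_erase hs))
    have h2 := Finset.pred_card_le_card_erase (a := z) (s := S)
    by_cases h3 : 3 ≤ S.card
    · refine bound 3 2 ?_ hlin (by omega)
      obtain ⟨c, hc, hcb⟩ := hL (y b) (-x b) (by simpa [or_comm] using hne b)
      obtain ⟨d, hd⟩ : ((S.erase b).erase c).Nonempty := by
        rw [← Finset.card_pos]
        have h4 := Finset.pred_card_le_card_erase (a := b) (s := S)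
        have h5 := Finset.pred_card_le_card_erase (a := c) (s := S.erase b)
        omega
      simp only [Finset.mem_erase] at hd
      exact three_le_rankOn_quad x y hinj hne hb hc hd.2.2 hd.2.1.symm hd.1.symm hcb
    · by_cases h2 : 2 ≤ S.card
      · exact bound 2 2 (hpair h2) hlin (by omega)
      · exact bound 1 2 (one_le_rankOn_quad x y hb (hne b)) hlin (by omega)
  push Not at hLz
  have h4 : 4 ≤ r₂ := four_le_rankOn_quad x y hinj hne hS hLz
  by_cases h5 : 5 ≤ r₂
  · have := Finset.card_le_univ S
    exact bound 5 2 h5 hlin (by omega)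
  · obtain ⟨a, ha, hs⟩ := exists_conic_of_rankOn_lt x y (not_le.1 h5)
    have := hconic a ha S hs
    exact bound 4 2 h4 hlin (by omega)

end Rank

/-! ### Lines in the plane -/

theorem exists_parametrization_of_line {p q : ℝ} (r : ℝ) (hpq : p ≠ 0 ∨ q ≠ 0) :
    ∃ (P v : Pt), v ≠ 0 ∧ ∀ B : Pt, (∃ t : ℝ, B = t • v + P) ↔ p * B 0 + q * B 1 + r = 0 := by
  have hN : p ^ 2 + q ^ 2 ≠ 0 := by
    simpa only [sq] using self_pairing_ne_zero hpq
  refine ⟨![-(r * p) / (p ^ 2 + q ^ 2), -(r * q) / (p ^ 2 + q ^ 2)], ![-q, p], ?_,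
    fun B => ⟨?_, ?_⟩⟩
  · intro h
    have h0 := congrFun h 0
    have h1 := congrFun h 1
    simp at h0 h1
    tauto
  · rintro ⟨t, rfl⟩
    simp
    field_simp
    ring
  · intro h
    refine ⟨(-q * B 0 + p * B 1) / (p ^ 2 + q ^ 2), ?_⟩
    ext i
    fin_cases i
    · simp
      field_simp
      linear_combination p * h
    · simp
      field_simp
      linear_combination q * h

theorem collinear_of_line {p q r : ℝ} (hpq : p ≠ 0 ∨ q ≠ 0) {s : Set Pt}
    (hs : ∀ B ∈ s, p * B 0 + q * B 1 + r = 0) : Collinear ℝ s := by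
  obtain ⟨P, v, -, h⟩ := exists_parametrization_of_line r hpq
  exact (collinear_iff_exists_forall_eq_smul_vadd (k := ℝ) s).2
    ⟨P, v, fun B hB => (h B).2 (hs B hB)⟩

/-! ### Polynomials of degree at most two -/

theorem coeff_pair_eq_zero {q : BivPoly} {i j : ℕ} (h : q.totalDegree < i + j) :
    coeff (Finsupp.single 0 i + Finsupp.single 1 j) q = 0 := by
  by_contra hne
  have := le_totalDegree (mem_support_iff.2 hne)
  rw [Finsupp.sum_add_index' (by simp) (by simp)] at this
  simp at this
  omega

theorem sum_range_monomial_eq {N : ℕ} {q : BivPoly} (hq : q.totalDegree ≤ N) :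
    q = ∑ i ∈ Finset.range (N + 1), ∑ j ∈ Finset.range (N + 1),
      C (coeff (Finsupp.single 0 i + Finsupp.single 1 j) q) * (X 0 ^ i * X 1 ^ j) := by
  ext d
  have hd : d = Finsupp.single 0 (d 0) + Finsupp.single 1 (d 1) := by
    ext k
    fin_cases k <;> simp
  have hmon : ∀ i j : ℕ, (X 0 ^ i * X 1 ^ j : BivPoly) =
      monomial (Finsupp.single 0 i + Finsupp.single 1 j) 1 := by
    intro i j
    simp [X_pow_eq_monomial, monomial_mul]
  have hiff : ∀ i j : ℕ, (Finsupp.single 0 i + Finsupp.single 1 j = d) ↔ (i = d 0 ∧ j = d 1) := by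
    intro i j
    constructor
    · rintro rfl
      simp
    · rintro ⟨rfl, rfl⟩
      exact hd.symm
  simp only [coeff_sum, coeff_C_mul, hmon, coeff_monomial, hiff, ite_and, mul_ite, mul_one,
    mul_zero]
  by_cases h : d 0 < N + 1 ∧ d 1 < N + 1
  · simp [h.1, h.2, ← hd]
  · have h0 : coeff d q = 0 := by
      rw [hd]
      exact coeff_pair_eq_zero (by omega)
    rw [h0]
    symm
    refine Finset.sum_eq_zero fun i hi => Finset.sum_eq_zero fun j hj => ?_
    simp only [Finset.mem_range] at hi hj
    split_ifs <;> first | rfl | omega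

theorem eq_of_totalDegree_le_two {q : BivPoly} (hq : q.totalDegree ≤ 2) :
    ∃ a b c d e f : ℝ, q = C a + C b * X 0 + C c * X 1 + C d * X 0 ^ 2 + C e * (X 0 * X 1) +
      C f * X 1 ^ 2 := by
  have h0 : ∀ i j : ℕ, 2 < i + j →
      coeff (Finsupp.single 0 i + Finsupp.single 1 j) q = 0 := by
    exact fun i j hij => coeff_pair_eq_zero (by omega)
  let k := fun i j : ℕ => coeff (Finsupp.single 0 i + Finsupp.single 1 j) q
  refine ⟨k 0 0, k 1 0, k 0 1, k 2 0, k 1 1, k 0 2, (sum_range_monomial_eq hq).trans ?_⟩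
  simp only [Finset.sum_range_succ, Finset.sum_range_zero]
  rw [h0 1 2 (by norm_num), h0 2 1 (by norm_num), h0 2 2 (by norm_num)]
  simp only [pow_zero, pow_one, map_zero, zero_mul, add_zero, zero_add, mul_one, one_mul]
  ring

theorem eq_of_totalDegree_le_one {q : BivPoly} (hq : q.totalDegree ≤ 1) :
    ∃ a b c : ℝ, q = C a * X 0 + C b * X 1 + C c := by
  have h0 : coeff (Finsupp.single 0 1 + Finsupp.single 1 1) q = 0 :=
    coeff_pair_eq_zero (by omega)
  let k := fun i j : ℕ => coeff (Finsupp.single 0 i + Finsupp.single 1 j) q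
  refine ⟨k 1 0, k 0 1, k 0 0, (sum_range_monomial_eq hq).trans ?_⟩
  simp only [Finset.sum_range_succ, Finset.sum_range_zero]
  rw [h0]
  simp only [pow_zero, pow_one, map_zero, zero_mul, add_zero, zero_add, mul_one, one_mul]
  ring


/-- The polynomial without constant term at `A` with quadratic coefficient vector `a`. -/
def conicPoly (A : Pt) (a : Fin 5 → ℝ) : BivPoly :=
  C (a 0) * (X 0 - C (A 0)) + C (a 1) * (X 1 - C (A 1)) + C (a 2) * (X 0 - C (A 0)) ^ 2 +
    C (a 3) * ((X 0 - C (A 0)) * (X 1 - C (A 1))) + C (a 4) * (X 1 - C (A 1)) ^ 2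

/-- The affine form vanishing at `A` with linear coefficients `a 0`, `a 1`. -/
def linPoly (A : Pt) (a : Fin 5 → ℝ) : BivPoly :=
  C (a 0) * (X 0 - C (A 0)) + C (a 1) * (X 1 - C (A 1))

theorem eval_conicPoly (A B : Pt) (a : Fin 5 → ℝ) :
    eval B (conicPoly A a) = coordFun a (quadVec (B 0 - A 0) (B 1 - A 1)) := by
  simp [conicPoly, coordFun_apply, quadVec]

theorem eval_linPoly (A B : Pt) (a : Fin 5 → ℝ) :
    eval B (linPoly A a) = coordFun a (linVec (B 0 - A 0) (B 1 - A 1)) := by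
  simp [linPoly, coordFun_apply, linVec]

theorem totalDegree_add_le {p q : BivPoly} {d : ℕ} (hp : p.totalDegree ≤ d)
    (hq : q.totalDegree ≤ d) : (p + q).totalDegree ≤ d :=
  (totalDegree_add p q).trans (max_le hp hq)

theorem totalDegree_C_mul_le (c : ℝ) {p : BivPoly} {d : ℕ} (hp : p.totalDegree ≤ d) :
    (C c * p).totalDegree ≤ d :=
  (totalDegree_mul _ _).trans (by simpa using hp)

theorem totalDegree_X_sub_C_le (i : Fin 2) (c : ℝ) : (X i - C c : BivPoly).totalDegree ≤ 1 :=
  (totalDegree_sub _ _).trans (by simp)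

theorem totalDegree_linPoly_le (A : Pt) (a : Fin 5 → ℝ) : (linPoly A a).totalDegree ≤ 1 :=
  totalDegree_add_le (totalDegree_C_mul_le _ (totalDegree_X_sub_C_le _ _))
    (totalDegree_C_mul_le _ (totalDegree_X_sub_C_le _ _))

theorem totalDegree_conicPoly_le (A : Pt) (a : Fin 5 → ℝ) :
    (conicPoly A a).totalDegree ≤ 2 := by
  have hX := totalDegree_X_sub_C_le
  have hmul : ∀ i j : Fin 2, ∀ c d : ℝ,
      ((X i - C c) * (X j - C d) : BivPoly).totalDegree ≤ 2 := fun i j c d =>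
    (totalDegree_mul _ _).trans (add_le_add (hX i c) (hX j d))
  simp only [conicPoly, sq]
  refine totalDegree_add_le (totalDegree_add_le (totalDegree_add_le (totalDegree_add_le ?_ ?_)
    ?_) ?_) ?_ <;> refine totalDegree_C_mul_le _ ?_
  · exact (hX _ _).trans one_le_two
  · exact (hX _ _).trans one_le_two
  · exact hmul _ _ _ _
  · exact hmul _ _ _ _
  · exact hmul _ _ _ _

theorem conicPoly_ne_zero (A : Pt) {a : Fin 5 → ℝ} (ha : a ≠ 0) : conicPoly A a ≠ 0 := by
  intro h
  have hv : ∀ s t : ℝ, a 0 * s + a 1 * t + a 2 * s ^ 2 + a 3 * (s * t) + a 4 * t ^ 2 = 0 := by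
    intro s t
    have := eval_conicPoly A ![A 0 + s, A 1 + t] a
    rw [h] at this
    simpa [coordFun_apply, quadVec] using this.symm
  have h1 := hv 1 0
  have h2 := hv (-1) 0
  have h3 := hv 0 1
  have h4 := hv 0 (-1)
  have h5 := hv 1 1
  apply ha
  ext i
  fin_cases i <;> simp <;> linarith

theorem totalDegree_pos_of_not_isUnit {g : BivPoly} (h0 : g ≠ 0) (hu : ¬ IsUnit g) :
    1 ≤ g.totalDegree := by
  by_contra hlt
  have hg := totalDegree_eq_zero_iff_eq_C.1 (Nat.lt_one_iff.1 (not_le.1 hlt))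
  refine hu ?_
  rw [hg]
  refine IsUnit.map C (isUnit_iff_ne_zero.2 fun hc => h0 ?_)
  rw [hg, hc, C_0]

/-- A set of nodes with few points on each line and on each irreducible conic through `A` has few
points on each conic through `A`. -/
theorem card_le_of_conicPoly {n : ℕ} {A : Pt} {Y : Finset Pt}
    (hline : ∀ p q r : ℝ, (p ≠ 0 ∨ q ≠ 0) → ∀ S ⊆ Y,
      (∀ B ∈ S, p * B 0 + q * B 1 + r = 0) → S.card ≤ n)
    (hirr : ∀ q : BivPoly, Irreducible q → q.totalDegree = 2 → eval A q = 0 →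
      ∀ S ⊆ Y, (∀ B ∈ S, eval B q = 0) → S.card ≤ 2 * n)
    {a : Fin 5 → ℝ} (ha : a ≠ 0) {S : Finset Pt} (hSY : S ⊆ Y)
    (hS : ∀ B ∈ S, eval B (conicPoly A a) = 0) : S.card ≤ 2 * n := by
  set q := conicPoly A a with hq
  have hq0 : q ≠ 0 := conicPoly_ne_zero A ha
  have hdeg : q.totalDegree ≤ 2 := totalDegree_conicPoly_le A a
  have hqA : eval A q = 0 := by simp [hq, eval_conicPoly, coordFun_apply, quadVec]
  have hqu : ¬ IsUnit q := fun h => (h.map (eval A)).ne_zero hqA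
  have hlinear : ∀ g : BivPoly, g ≠ 0 → ¬ IsUnit g → g.totalDegree ≤ 1 →
      ∀ T ⊆ S, (∀ B ∈ T, eval B g = 0) → T.card ≤ n := by
    intro g hg0 hgu hg1 T hTS hT
    obtain ⟨s, t, r, rfl⟩ := eq_of_totalDegree_le_one hg1
    refine hline s t r ?_ T (hTS.trans hSY) fun B hB => ?_
    · by_contra! h
      have h1 := totalDegree_pos_of_not_isUnit hg0 hgu
      simp [h.1, h.2] at h1
    · simpa using hT B hB
  by_cases h1 : q.totalDegree ≤ 1
  · have := hlinear q hq0 hqu h1 S subset_rfl hS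
    omega
  by_cases hqi : Irreducible q
  · exact hirr q hqi (by omega) hqA S hSY hS
  obtain ⟨g, h, hgh, hgu, hhu⟩ : ∃ g h, q = g * h ∧ ¬ IsUnit g ∧ ¬ IsUnit h := by
    by_contra! hcon
    refine hqi ⟨hqu, fun g h hgh => ?_⟩
    by_contra! hu
    exact hu.2 (hcon g h hgh hu.1)
  have hg0 : g ≠ 0 := by rintro rfl; simp [hgh] at hq0
  have hh0 : h ≠ 0 := by rintro rfl; simp [hgh] at hq0
  have hsum : q.totalDegree = g.totalDegree + h.totalDegree := by
    rw [hgh, totalDegree_mul_of_isDomain hg0 hh0]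
  have hg1 := totalDegree_pos_of_not_isUnit hg0 hgu
  have hh1 := totalDegree_pos_of_not_isUnit hh0 hhu
  have hgc := hlinear g hg0 hgu (by omega) (S.filter fun B => eval B g = 0)
    (Finset.filter_subset _ _) fun B hB => (Finset.mem_filter.1 hB).2
  have hhc := hlinear h hh0 hhu (by omega) (S.filter fun B => eval B h = 0)
    (Finset.filter_subset _ _) fun B hB => (Finset.mem_filter.1 hB).2
  have hsub : S ⊆ (S.filter fun B => eval B g = 0) ∪ (S.filter fun B => eval B h = 0) := by
    intro B hB
    have := hS B hB
    rw [hgh, map_mul, mul_eq_zero] at this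
    simpa [hB] using this
  have := (Finset.card_le_card hsub).trans (Finset.card_union_le _ _)
  omega

/-! ### Products of lines and conics -/

theorem exists_fundamental_of_factors {n : ℕ} {X : Finset Pt} {A : Pt} {ι : Type*} [Fintype ι]
    (P : ι → BivPoly) (d : ι → ℕ) (hP : ∀ i, (P i).totalDegree ≤ d i) (hd2 : ∀ i, d i ≤ 2)
    (hd : ∑ i, d i ≤ n) (hA : ∀ i, eval A (P i) = 1)
    (hX : ∀ B ∈ X, B ≠ A → ∃ i, eval B (P i) = 0) :
    ∃ p : BivPoly, IsFundamental n X A p ∧ IsProductOfLinesAndConics p := by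
  refine ⟨∏ i, P i, ⟨?_, ?_, ?_⟩, (Finset.univ.filter fun i => (P i).totalDegree ≠ 0).val.map P,
    ?_, ?_⟩
  · exact (totalDegree_finsetProd _ _).trans ((Finset.sum_le_sum fun i _ => hP i).trans hd)
  · simp [map_prod, hA]
  · intro B hB hBA
    obtain ⟨i, hi⟩ := hX B hB hBA
    rw [map_prod]
    exact Finset.prod_eq_zero (Finset.mem_univ i) hi
  · intro q hq
    obtain ⟨i, hi, rfl⟩ := Multiset.mem_map.1 hq
    have h1 := (Finset.mem_filter.1 (Finset.mem_def.2 hi)).2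
    have h2 := hP i
    have h3 := hd2 i
    omega
  · refine (Finset.prod_filter_of_ne (p := fun i => (P i).totalDegree ≠ 0)
      fun i _ hi h0 => hi ?_).symm
    have h := totalDegree_eq_zero_iff_eq_C.1 h0
    have h1 := hA i
    rw [h, eval_C] at h1
    rw [h, h1, C_1]

theorem totalDegree_one_sub_le {p : BivPoly} {d : ℕ} (hp : p.totalDegree ≤ d) :
    (1 - p).totalDegree ≤ d :=
  (totalDegree_sub _ _).trans (max_le (by simp) hp)

/-- Few nodes on each line and on each conic through `A`. -/
theorem exists_product_of_no_large_line {n : ℕ} (hn : 1 ≤ n) {X : Finset Pt} {A : Pt}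
    (hcard : (X.erase A).card ≤ 2 * n + n / 2)
    (hline : ∀ p q r : ℝ, (p ≠ 0 ∨ q ≠ 0) → ∀ S ⊆ X.erase A,
      (∀ B ∈ S, p * B 0 + q * B 1 + r = 0) → S.card ≤ n)
    (hirr : ∀ q : BivPoly, Irreducible q → q.totalDegree = 2 → eval A q = 0 →
      ∀ S ⊆ X.erase A, (∀ B ∈ S, eval B q = 0) → S.card ≤ 2 * n) :
    ∃ p : BivPoly, IsFundamental n X A p ∧ IsProductOfLinesAndConics p := by
  let E := {B // B ∈ X.erase A}
  let x : E → ℝ := fun e => e.1 0 - A 0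
  let y : E → ℝ := fun e => e.1 1 - A 1
  have himage : ∀ S : Finset E, (S.map (Function.Embedding.subtype _)) ⊆ X.erase A := by
    intro S B hB
    obtain ⟨e, -, rfl⟩ := Finset.mem_map.1 hB
    exact e.2
  have key := card_le_rank_sum x y
    (fun e e' h0 h1 => Subtype.ext (by
      ext i
      fin_cases i
      · simpa [x] using h0
      · simpa [y] using h1))
    (fun e => by
      by_contra! h
      refine Finset.ne_of_mem_erase e.2 ?_
      ext i
      fin_cases i
      · exact sub_eq_zero.1 h.1
      · exact sub_eq_zero.1 h.2)
    hn (by simpa [E] using hcard)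
    (fun p q r hpq S hS => by
      rw [← Finset.card_map (Function.Embedding.subtype _)]
      refine hline p q (r - p * A 0 - q * A 1) hpq _ (himage S) fun B hB => ?_
      obtain ⟨e, he, rfl⟩ := Finset.mem_map.1 hB
      have := hS e he
      simp only [x, y] at this
      simp only [Function.Embedding.subtype_apply]
      linarith)
    (fun a ha S hS => by
      rw [← Finset.card_map (Function.Embedding.subtype _)]
      refine card_le_of_conicPoly hline hirr ha (himage S) fun B hB => ?_
      obtain ⟨e, he, rfl⟩ := Finset.mem_map.1 hB
      rw [eval_conicPoly]
      exact hS e he)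
  obtain ⟨f, hf⟩ := exists_coloring_functional (K := ℝ) (ι := Fin (n / 2) ⊕ Fin (n % 2))
    (Sum.elim (fun _ e => quadVec (x e) (y e)) (fun _ e => linVec (x e) (y e))) (by
      intro S
      refine (key S).trans_eq ?_
      rw [Fintype.sum_sum_type]
      change _ = (∑ _i : Fin (n / 2), rankOn (fun e => quadVec (x e) (y e)) S) +
        ∑ _i : Fin (n % 2), rankOn (fun e => linVec (x e) (y e)) S
      simp)
  let a : Fin (n / 2) ⊕ Fin (n % 2) → Fin 5 → ℝ := fun i j => f i (Pi.single j 1)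
  have hfa : ∀ i, f i = coordFun (a i) := fun i => dual_eq_coordFun _
  refine exists_fundamental_of_factors (ι := Fin (n / 2) ⊕ Fin (n % 2))
    (Sum.elim (fun i => 1 - conicPoly A (a (.inl i))) (fun i => 1 - linPoly A (a (.inr i))))
    (Sum.elim (fun _ => 2) (fun _ => 1)) ?_ ?_ ?_ ?_ ?_
  · rintro (i | i)
    · exact totalDegree_one_sub_le (totalDegree_conicPoly_le _ _)
    · exact totalDegree_one_sub_le (totalDegree_linPoly_le _ _)
  · rintro (i | i) <;> simp
  · simp
    omega
  · rintro (i | i)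
    · simp [eval_conicPoly, coordFun_apply, quadVec]
    · simp [eval_linPoly, coordFun_apply, linVec]
  · intro B hB hBA
    obtain ⟨i, hi⟩ := hf ⟨B, Finset.mem_erase.2 ⟨hBA, hB⟩⟩
    refine ⟨i, ?_⟩
    rw [hfa] at hi
    rcases i with i | i
    · simpa [eval_conicPoly, sub_eq_zero] using hi.symm
    · simpa [eval_linPoly, sub_eq_zero] using hi.symm

/-- If one line off `A` contains many nodes, it is a factor and the other nodes are covered by
lines through at most two of them. -/
theorem exists_product_of_large_line {n : ℕ} (hn : 1 ≤ n) {X : Finset Pt} {A : Pt} {p q r : ℝ}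
    (hA : p * A 0 + q * A 1 + r ≠ 0)
    (hcard : ((X.erase A).filter fun B => p * B 0 + q * B 1 + r ≠ 0).card ≤ 2 * (n - 1))
    (hline : ∀ s t : ℝ, (s ≠ 0 ∨ t ≠ 0) →
      ∀ S ⊆ (X.erase A).filter fun B => p * B 0 + q * B 1 + r ≠ 0,
      (∀ B ∈ S, s * (B 0 - A 0) + t * (B 1 - A 1) = 0) → S.card ≤ n - 1) :
    ∃ p : BivPoly, IsFundamental n X A p ∧ IsProductOfLinesAndConics p := by
  let Y := (X.erase A).filter fun B => p * B 0 + q * B 1 + r ≠ 0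
  let E := {B // B ∈ Y}
  let x : E → ℝ := fun e => e.1 0 - A 0
  let y : E → ℝ := fun e => e.1 1 - A 1
  have hne : ∀ e : E, x e ≠ 0 ∨ y e ≠ 0 := fun e => by
    by_contra! h
    refine Finset.ne_of_mem_erase (Finset.mem_filter.1 e.2).1 ?_
    ext i
    fin_cases i
    · exact sub_eq_zero.1 h.1
    · exact sub_eq_zero.1 h.2
  obtain ⟨f, hf⟩ := exists_coloring_functional (K := ℝ) (ι := Fin (n - 1))
    (fun _ e => linVec (x e) (y e)) (by
      intro S
      suffices h : S.card ≤ (n - 1) * rankOn (fun e => linVec (x e) (y e)) S by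
        simpa [rankOn] using h
      rcases S.eq_empty_or_nonempty with rfl | hS
      · simp
      by_cases hL : ∃ s t : ℝ, (s ≠ 0 ∨ t ≠ 0) ∧ ∀ e ∈ S, s * x e + t * y e = 0
      · obtain ⟨s, t, hst, hs⟩ := hL
        obtain ⟨b, hb⟩ := hS
        have h1 := one_le_rankOn_lin x y hb (hne b)
        refine le_trans ?_ (Nat.mul_le_mul_left _ h1)
        rw [← Finset.card_map (Function.Embedding.subtype _), mul_one]
        refine hline s t hst _ (fun B hB => ?_) (fun B hB => ?_)
        · obtain ⟨e, -, rfl⟩ := Finset.mem_map.1 hB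
          exact e.2
        · obtain ⟨e, he, rfl⟩ := Finset.mem_map.1 hB
          exact hs e he
      · push Not at hL
        refine le_trans ?_ (Nat.mul_le_mul_left _ (two_le_rankOn_lin x y hne hS hL))
        have h1 := Finset.card_le_univ S
        have h2 : Fintype.card E = Y.card := by simp [E]
        have h3 : Y.card ≤ 2 * (n - 1) := hcard
        omega)
  let a : Fin (n - 1) → Fin 5 → ℝ := fun i j => f i (Pi.single j 1)
  have hfa : ∀ i, f i = coordFun (a i) := fun i => dual_eq_coordFun _
  let g : BivPoly := C ((p * A 0 + q * A 1 + r)⁻¹) *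
    (C p * MvPolynomial.X 0 + C q * MvPolynomial.X 1 + C r)
  refine exists_fundamental_of_factors (ι := Option (Fin (n - 1)))
    (fun i => i.elim g (fun i => 1 - linPoly A (a i))) (fun _ => 1) ?_ ?_ ?_ ?_ ?_
  · rintro (_ | i)
    · refine totalDegree_C_mul_le _ (totalDegree_add_le (totalDegree_add_le
        (totalDegree_C_mul_le _ ?_) (totalDegree_C_mul_le _ ?_)) ?_) <;> simp
    · exact totalDegree_one_sub_le (totalDegree_linPoly_le _ _)
  · simp
  · simp
    omega
  · rintro (_ | i)
    · simp [g, hA]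
    · simp [eval_linPoly, coordFun_apply, linVec]
  · intro B hB hBA
    by_cases hBg : p * B 0 + q * B 1 + r = 0
    · exact ⟨none, by simp [g, hBg]⟩
    · obtain ⟨i, hi⟩ := hf ⟨B, Finset.mem_filter.2 ⟨Finset.mem_erase.2 ⟨hBA, hB⟩, hBg⟩⟩
      refine ⟨some i, ?_⟩
      rw [hfa] at hi
      simpa [eval_linPoly, sub_eq_zero] using hi.symm

theorem exists_product_of_conditions {n : ℕ} (hn : 1 ≤ n) {X : Finset Pt}
    (hcard : X.card ≤ 2 * n + n / 2 + 1) {A : Pt} (hA : A ∈ X) (ha : CondA n X A)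
    (hb : CondB n X A) (hc : CondC n X A) :
    ∃ p : BivPoly, IsFundamental n X A p ∧ IsProductOfLinesAndConics p := by
  have hcard' : (X.erase A).card ≤ 2 * n + n / 2 := by
    rw [Finset.card_erase_of_mem hA]
    omega
  have hlineA : ∀ p q r : ℝ, (p ≠ 0 ∨ q ≠ 0) → p * A 0 + q * A 1 + r = 0 → ∀ S ⊆ X.erase A,
      (∀ B ∈ S, p * B 0 + q * B 1 + r = 0) → S.card ≤ n := by
    intro p q r hpq hAl S hSX hS
    by_contra! hlt
    refine ha ⟨S, hSX, hlt, collinear_of_line (r := r) hpq ?_⟩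
    rintro B (rfl | hB)
    · exact hAl
    · exact hS B hB
  by_cases hbig : ∃ p q r : ℝ, (p ≠ 0 ∨ q ≠ 0) ∧ ∃ S ⊆ X.erase A,
      (∀ B ∈ S, p * B 0 + q * B 1 + r = 0) ∧ n + 1 ≤ S.card
  · obtain ⟨p, q, r, hpq, S, hSX, hS, hSn⟩ := hbig
    have hAl : p * A 0 + q * A 1 + r ≠ 0 := fun h => by
      have := hlineA p q r hpq h S hSX hS
      omega
    refine exists_product_of_large_line hn hAl ?_ ?_
    · have h1 := Finset.card_filter_add_card_filter_not (s := X.erase A)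
        (fun B => p * B 0 + q * B 1 + r = 0)
      have h2 : S.card ≤ ((X.erase A).filter fun B => p * B 0 + q * B 1 + r = 0).card :=
        Finset.card_le_card fun B hB => Finset.mem_filter.2 ⟨hSX hB, hS B hB⟩
      simp only [ne_eq]
      omega
    · intro s t hst T hTX hT
      by_contra! hlt
      obtain ⟨P, v, hv, hmem⟩ := exists_parametrization_of_line r hpq
      have hα : ∀ B, B ∈ AffineSubspace.mk' P (Submodule.span ℝ {v}) ↔
          p * B 0 + q * B 1 + r = 0 := by
        intro B
        rw [← hmem, AffineSubspace.mem_mk', Submodule.mem_span_singleton]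
        refine exists_congr fun c => ?_
        rw [vsub_eq_sub, eq_comm, sub_eq_iff_eq_add]
      refine hb (AffineSubspace.mk' P (Submodule.span ℝ {v})) ?_ ⟨S, hSX, hSn, ?_⟩
        ⟨T, hTX.trans (Finset.filter_subset _ _), by omega, ?_, ?_⟩
      · rw [AffineSubspace.direction_mk', finrank_span_singleton hv]
      · exact fun B hB => (hα B).2 (hS B hB)
      · intro B hB h
        exact (Finset.mem_filter.1 (hTX hB)).2 ((hα B).1 h)
      · refine collinear_of_line (r := -(s * A 0 + t * A 1)) hst ?_
        rintro B (rfl | hB)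
        · ring
        · linarith [hT B hB]
  · push Not at hbig
    refine exists_product_of_no_large_line hn hcard' (fun p q r hpq S hSX hS => ?_) ?_
    · exact Nat.lt_succ_iff.1 (hbig p q r hpq S hSX hS)
    · intro q hq hq2 hqA S hSX hS
      by_contra! hlt
      exact hc ⟨q, hq, hq2, hqA, (Nat.succ_le_of_lt hlt).trans
        (Finset.card_le_card fun B hB => Finset.mem_filter.2 ⟨hSX hB, hS B hB⟩)⟩

/-! ### Restrictions to rational curves -/

/-- The degree `n` homogenization of `p`, evaluated at elements of an `ℝ`-algebra. -/
def homEval {R : Type*} [CommRing R] [Algebra ℝ R] (n : ℕ) (p : BivPoly) (x y z : R) : R :=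
  ∑ i ∈ Finset.range (n + 1), ∑ j ∈ Finset.range (n + 1),
    algebraMap ℝ R (coeff (Finsupp.single 0 i + Finsupp.single 1 j) p) *
      (x ^ i * y ^ j * z ^ (n - (i + j)))

theorem homEval_eq_eval {n : ℕ} {p : BivPoly} (hp : p.totalDegree ≤ n) (B : Pt) (z : ℝ) :
    homEval n p (B 0 * z) (B 1 * z) z = z ^ n * eval B p := by
  conv_rhs => rw [sum_range_monomial_eq hp]
  simp only [homEval, map_sum, map_mul, map_pow, eval_C, eval_X, Finset.mul_sum,
    Algebra.algebraMap_self, RingHom.id_apply]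
  refine Finset.sum_congr rfl fun i _ => Finset.sum_congr rfl fun j _ => ?_
  by_cases h : i + j ≤ n
  · have hz : z ^ n = z ^ i * z ^ j * z ^ (n - (i + j)) := by
      rw [← pow_add, ← pow_add, Nat.add_sub_cancel' h]
    rw [hz]
    ring
  · rw [coeff_pair_eq_zero (by omega)]
    ring

theorem eval_homEval (n : ℕ) (p : BivPoly) (x y z : Polynomial ℝ) (t : ℝ) :
    (homEval n p x y z).eval t = homEval n p (x.eval t) (y.eval t) (z.eval t) := by
  simp [homEval, Polynomial.eval_finsetSum, Polynomial.algebraMap_eq]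

theorem natDegree_homEval_le {n D : ℕ} {p : BivPoly} (hp : p.totalDegree ≤ n)
    {x y z : Polynomial ℝ} (hx : x.natDegree ≤ D) (hy : y.natDegree ≤ D) (hz : z.natDegree ≤ D) :
    (homEval n p x y z).natDegree ≤ n * D := by
  refine Polynomial.natDegree_sum_le_of_forall_le _ _ fun i _ =>
    Polynomial.natDegree_sum_le_of_forall_le _ _ fun j _ => ?_
  by_cases h : i + j ≤ n
  · refine (Polynomial.natDegree_C_mul_le _ _).trans ?_
    refine (Polynomial.natDegree_mul_le_of_le (Polynomial.natDegree_mul_le_of_le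
      (Polynomial.natDegree_pow_le_of_le i hx) (Polynomial.natDegree_pow_le_of_le j hy))
      (Polynomial.natDegree_pow_le_of_le _ hz)).trans_eq ?_
    rw [← add_mul, ← add_mul, Nat.add_sub_cancel' h]
  · rw [coeff_pair_eq_zero (by omega)]
    simp

theorem coeff_homEval {n D : ℕ} {p : BivPoly} (hp : p.totalDegree ≤ n)
    {x y z : Polynomial ℝ} (hx : x.natDegree ≤ D) (hy : y.natDegree ≤ D) (hz : z.natDegree ≤ D) :
    (homEval n p x y z).coeff (n * D) = homEval n p (x.coeff D) (y.coeff D) (z.coeff D) := by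
  simp only [homEval, Polynomial.finsetSum_coeff, Polynomial.algebraMap_eq,
    Polynomial.coeff_C_mul, Algebra.algebraMap_self, RingHom.id_apply]
  refine Finset.sum_congr rfl fun i _ => Finset.sum_congr rfl fun j _ => ?_
  by_cases h : i + j ≤ n
  · have hn : n * D = i * D + j * D + (n - (i + j)) * D := by
      rw [← add_mul, ← add_mul, Nat.add_sub_cancel' h]
    have hpow : ∀ {w : Polynomial ℝ} (k : ℕ), w.natDegree ≤ D → (w ^ k).natDegree ≤ k * D :=
      fun k hw => Polynomial.natDegree_pow_le_of_le k hw
    rw [hn, Polynomial.coeff_mul_add_eq_of_natDegree_le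
        (Polynomial.natDegree_mul_le_of_le (hpow i hx) (hpow j hy)) (hpow _ hz),
      Polynomial.coeff_mul_add_eq_of_natDegree_le (hpow i hx) (hpow j hy),
      Polynomial.coeff_pow_of_natDegree_le hx, Polynomial.coeff_pow_of_natDegree_le hy,
      Polynomial.coeff_pow_of_natDegree_le hz]
  · rw [coeff_pair_eq_zero (by omega)]
    simp

/-- The restriction of `p` to the line `t ↦ t • v + P`. -/
def lineRestrict (n : ℕ) (p : BivPoly) (P v : Pt) : Polynomial ℝ :=
  homEval n p (Polynomial.C (v 0) * Polynomial.X + Polynomial.C (P 0))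
    (Polynomial.C (v 1) * Polynomial.X + Polynomial.C (P 1)) 1

theorem eval_lineRestrict {n : ℕ} {p : BivPoly} (hp : p.totalDegree ≤ n) (P v : Pt) (t : ℝ) :
    (lineRestrict n p P v).eval t = eval (t • v + P) p := by
  have h := homEval_eq_eval hp (t • v + P) 1
  rw [one_pow, one_mul] at h
  rw [lineRestrict, eval_homEval, ← h]
  simp only [Polynomial.eval_add, Polynomial.eval_mul, Polynomial.eval_C, Polynomial.eval_X,
    Polynomial.eval_one, Pi.add_apply, Pi.smul_apply, smul_eq_mul, mul_one, mul_comm t]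

theorem natDegree_lineRestrict_le {n : ℕ} {p : BivPoly} (hp : p.totalDegree ≤ n) (P v : Pt) :
    (lineRestrict n p P v).natDegree ≤ n :=
  (natDegree_homEval_le hp (D := 1) Polynomial.natDegree_linear_le
    Polynomial.natDegree_linear_le (by simp)).trans_eq (mul_one n)

theorem coeff_lineRestrict {n : ℕ} {p : BivPoly} (hp : p.totalDegree ≤ n) (P Q v : Pt) :
    (lineRestrict n p P v).coeff n = (lineRestrict n p Q v).coeff n := by
  have h := fun P : Pt => coeff_homEval hp (D := 1)
    (x := Polynomial.C (v 0) * Polynomial.X + Polynomial.C (P 0))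
    (y := Polynomial.C (v 1) * Polynomial.X + Polynomial.C (P 1)) (z := 1)
    (Polynomial.natDegree_linear_le) (Polynomial.natDegree_linear_le) (by simp)
  have hP := h P
  have hQ := h Q
  simp only [mul_one, Polynomial.coeff_add, Polynomial.coeff_C_mul, Polynomial.coeff_X_one,
    Polynomial.coeff_C_succ] at hP hQ
  exact hP.trans hQ.symm

theorem lineRestrict_eq_zero {n m : ℕ} {p : BivPoly} (hp : p.totalDegree ≤ n) {P v : Pt}
    (hdeg : (lineRestrict n p P v).natDegree < m) {S : Finset Pt} (hcard : m ≤ S.card)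
    (hS : ∀ B ∈ S, ∃ t : ℝ, B = t • v + P) (hzero : ∀ B ∈ S, eval B p = 0) :
    lineRestrict n p P v = 0 := by
  choose! τ hτ using hS
  have hinj : Set.InjOn τ S := fun B hB B' hB' h => by rw [hτ B hB, hτ B' hB', h]
  refine Polynomial.eq_zero_of_natDegree_lt_card_of_eval_eq_zero' _ (S.image τ) ?_ ?_
  · intro t ht
    obtain ⟨B, hB, rfl⟩ := Finset.mem_image.1 ht
    rw [eval_lineRestrict hp, ← hτ B hB, hzero B hB]
  · rw [Finset.card_image_of_injOn hinj]
    omega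

theorem IsFundamental.lineRestrict_ne_zero {n : ℕ} {X : Finset Pt} {A : Pt} {p : BivPoly}
    (h : IsFundamental n X A p) (v : Pt) : lineRestrict n p A v ≠ 0 := by
  intro h0
  have h1 := eval_lineRestrict h.1 A v 0
  rw [h0] at h1
  simp [h.2.1] at h1

theorem IsFundamental.eval_eq_zero {n : ℕ} {X : Finset Pt} {A : Pt} {p : BivPoly}
    (h : IsFundamental n X A p) {S : Finset Pt} (hS : S ⊆ X.erase A) {B : Pt} (hB : B ∈ S) :
    eval B p = 0 :=
  h.2.2 B (Finset.mem_of_mem_erase (hS hB)) (Finset.ne_of_mem_erase (hS hB))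

theorem IsFundamental.condA {n : ℕ} {X : Finset Pt} {A : Pt} {p : BivPoly}
    (h : IsFundamental n X A p) : CondA n X A := by
  rintro ⟨S, hSX, hcard, hcol⟩
  obtain ⟨v, hv⟩ := (collinear_iff_of_mem (Set.mem_insert A (S : Set Pt))).1 hcol
  refine h.lineRestrict_ne_zero v (lineRestrict_eq_zero h.1
    (Nat.lt_succ_of_le (natDegree_lineRestrict_le h.1 A v)) hcard
    (fun B hB => hv B (Set.mem_insert_of_mem _ hB)) fun B hB => h.eval_eq_zero hSX hB)

theorem IsFundamental.condB {n : ℕ} {X : Finset Pt} {A : Pt} {p : BivPoly}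
    (h : IsFundamental n X A p) : CondB n X A := by
  rintro α hα ⟨S, hSX, hScard, hSα⟩ ⟨T, hTX, hTcard, hTα, hcol⟩
  obtain ⟨P, hPS⟩ := Finset.card_pos.1 (Nat.succ_pos n |>.trans_le hScard)
  have hPα : P ∈ α := hSα hPS
  obtain ⟨v, hv0, hv⟩ := finrank_eq_one_iff'.1 hα
  have hmem : ∀ t : ℝ, t • (v : Pt) + P ∈ α := fun t =>
    AffineSubspace.vadd_mem_of_mem_direction (α.direction.smul_mem t v.2) hPα
  have hline : ∀ B ∈ α, ∃ t : ℝ, B = t • (v : Pt) + P := by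
    intro B hB
    obtain ⟨t, ht⟩ := hv ⟨B -ᵥ P, AffineSubspace.vsub_mem_direction hB hPα⟩
    refine ⟨t, ?_⟩
    have := congrArg Subtype.val ht
    simp only [Submodule.coe_smul, vsub_eq_sub] at this
    rw [this, sub_add_cancel]
  have hv0' : (v : Pt) ≠ 0 := fun h0 => hv0 (Subtype.ext h0)
  have hαzero : lineRestrict n p P v = 0 := lineRestrict_eq_zero h.1
    (Nat.lt_succ_of_le (natDegree_lineRestrict_le h.1 P v)) hScard
    (fun B hB => hline B (hSα hB)) fun B hB => h.eval_eq_zero hSX hB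
  obtain ⟨w, hw⟩ := (collinear_iff_of_mem (Set.mem_insert A (T : Set Pt))).1 hcol
  replace hw : ∀ B ∈ T, ∃ r : ℝ, B = r • w + A := fun B hB => hw B (Set.mem_insert_of_mem _ hB)
  generalize (v : Pt) = v at *
  by_cases hD : v 0 * w 1 - v 1 * w 0 = 0
  · have hN : v 0 ^ 2 + v 1 ^ 2 ≠ 0 := by
      simpa only [sq] using self_pairing_ne_zero (s := v 0) (t := v 1) (by
        by_contra! h0
        refine hv0' ?_
        ext i
        fin_cases i
        · exact h0.1
        · exact h0.2)
    have hwv : w = ((v 0 * w 0 + v 1 * w 1) / (v 0 ^ 2 + v 1 ^ 2)) • v := by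
      ext i
      fin_cases i
      · simp
        field_simp
        linear_combination (-v 1) * hD
      · simp
        field_simp
        linear_combination v 0 * hD
    have hcoeff : (lineRestrict n p A v).coeff n = 0 := by
      rw [coeff_lineRestrict h.1 A P, hαzero, Polynomial.coeff_zero]
    have hne := h.lineRestrict_ne_zero v
    refine hne (lineRestrict_eq_zero h.1 (m := n) ?_ hTcard (fun B hB => ?_)
      fun B hB => h.eval_eq_zero hTX hB)
    · refine lt_of_le_of_ne (natDegree_lineRestrict_le h.1 A v) fun hd => hne ?_
      rw [← Polynomial.leadingCoeff_eq_zero, Polynomial.leadingCoeff, hd, hcoeff]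
    · obtain ⟨r, hr⟩ := hw B hB
      exact ⟨_, by rw [hr, hwv, smul_smul]⟩
  · let s := ((P 1 - A 1) * v 0 - (P 0 - A 0) * v 1) / (v 0 * w 1 - v 1 * w 0)
    let t := ((P 1 - A 1) * w 0 - (P 0 - A 0) * w 1) / (v 0 * w 1 - v 1 * w 0)
    have hst : s • w + A = t • v + P := by
      ext i
      fin_cases i
      · simp [s, t]
        field_simp
        ring
      · simp [s, t]
        field_simp
        ring
    have hQ : s • w + A ∉ T := fun hQ => hTα _ hQ (hst ▸ hmem t)
    refine h.lineRestrict_ne_zero w (lineRestrict_eq_zero h.1 (m := n + 1)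
      (S := insert (s • w + A) T)
      (Nat.lt_succ_of_le (natDegree_lineRestrict_le h.1 A w)) ?_ ?_ ?_)
    · rw [Finset.card_insert_of_notMem hQ]
      omega
    · intro B hB
      rcases Finset.mem_insert.1 hB with rfl | hB
      · exact ⟨s, rfl⟩
      · exact hw B hB
    · intro B hB
      rcases Finset.mem_insert.1 hB with rfl | hB
      · rw [hst, ← eval_lineRestrict h.1, hαzero, Polynomial.eval_zero]
      · exact h.eval_eq_zero hTX hB

/-! ### Irreducible conics -/

theorem exists_eq_conicPoly {q : BivPoly} {A : Pt} (hq : q.totalDegree ≤ 2) (hA : eval A q = 0) :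
    ∃ a, q = conicPoly A a := by
  obtain ⟨a, b, c, d, e, f, rfl⟩ := eq_of_totalDegree_le_two hq
  refine ⟨![b + 2 * d * A 0 + e * A 1, c + e * A 0 + 2 * f * A 1, d, e, f],
    MvPolynomial.funext fun B => ?_⟩
  rw [eval_conicPoly]
  simp [coordFun_apply, quadVec] at hA ⊢
  linear_combination hA

/-- An irreducible conic contains no line. -/
theorem not_irreducible_conicPoly {A : Pt} {a : Fin 5 → ℝ} {s t : ℝ} (hst : s ≠ 0 ∨ t ≠ 0)
    (hdeg : (conicPoly A a).totalDegree = 2) (h1 : a 0 * s + a 1 * t = 0)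
    (h2 : a 2 * s ^ 2 + a 3 * (s * t) + a 4 * t ^ 2 = 0) : ¬ Irreducible (conicPoly A a) := by
  have hN : s * s + t * t ≠ 0 := self_pairing_ne_zero hst
  let L := linPoly A ![-t, s, 0, 0, 0]
  let H : BivPoly := C ((s * s + t * t) * (a 1 * s - a 0 * t)) +
    linPoly A ![(a 3 * (s ^ 2 - t ^ 2) + 2 * (a 4 - a 2) * s * t) * s -
        (a 2 * t ^ 2 - a 3 * (s * t) + a 4 * s ^ 2) * t,
      (a 3 * (s ^ 2 - t ^ 2) + 2 * (a 4 - a 2) * s * t) * t +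
        (a 2 * t ^ 2 - a 3 * (s * t) + a 4 * s ^ 2) * s, 0, 0, 0]
  have hfac : conicPoly A a = L * (C ((s * s + t * t)⁻¹ ^ 2) * H) := by
    refine MvPolynomial.funext fun B => ?_
    rw [map_mul, map_mul, eval_C, inv_pow, mul_left_comm,
      eq_inv_mul_iff_mul_eq₀ (pow_ne_zero 2 hN)]
    simp only [L, H, map_add, eval_C, eval_conicPoly, eval_linPoly, coordFun_apply,
      quadVec, linVec]
    simp
    generalize B 0 - A 0 = x
    generalize B 1 - A 1 = y
    linear_combination ((s * s + t * t) * (s * x + t * y)) * h1 + (s * x + t * y) ^ 2 * h2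
  intro hirr
  rcases hirr.isUnit_or_isUnit hfac with hu | hu
  · refine (hu.map (eval A)).ne_zero ?_
    simp [L, eval_linPoly, coordFun_apply, linVec]
  · have h0 := (isUnit_iff_totalDegree_of_isReduced.1 hu).2
    have := totalDegree_mul L (C ((s * s + t * t)⁻¹ ^ 2) * H)
    rw [← hfac, h0, hdeg] at this
    have := totalDegree_linPoly_le A ![-t, s, 0, 0, 0]
    simp only [L] at *
    omega

theorem IsFundamental.condC {n : ℕ} {X : Finset Pt} {A : Pt} {p : BivPoly}
    (h : IsFundamental n X A p) : CondC n X A := by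
  rintro ⟨q, hirr, hdeg, hqA, hcard⟩
  obtain ⟨g, rfl⟩ := exists_eq_conicPoly hdeg.le hqA
  set Y := (X.erase A).filter fun B => eval B (conicPoly A g) = 0 with hY
  have hYX : Y ⊆ X.erase A := Finset.filter_subset _ _
  have hconic : ∀ B ∈ Y, g 0 * (B 0 - A 0) + g 1 * (B 1 - A 1) + g 2 * (B 0 - A 0) ^ 2 +
      g 3 * ((B 0 - A 0) * (B 1 - A 1)) + g 4 * (B 1 - A 1) ^ 2 = 0 := by
    intro B hB
    have := (Finset.mem_filter.1 hB).2
    rw [eval_conicPoly] at this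
    simpa [coordFun_apply, quadVec] using this
  have hne : ∀ B ∈ Y, B 0 - A 0 ≠ 0 ∨ B 1 - A 1 ≠ 0 := by
    intro B hB
    by_contra! h0
    refine Finset.ne_of_mem_erase (hYX hB) ?_
    ext i
    fin_cases i
    · exact sub_eq_zero.1 h0.1
    · exact sub_eq_zero.1 h0.2
  have hg : g 0 ≠ 0 ∨ g 1 ≠ 0 := by
    by_contra! h0
    obtain ⟨B, hB⟩ := Finset.card_pos.1 ((Nat.succ_pos _).trans_le hcard)
    refine not_irreducible_conicPoly (hne B hB) hdeg (by simp [h0]) ?_ hirr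
    have := hconic B hB
    rw [h0.1, h0.2] at this
    linarith
  set c := g 0 * g 0 + g 1 * g 1 with hc
  have hc0 : c ≠ 0 := self_pairing_ne_zero hg
  set a := g 2 * g 1 ^ 2 - g 3 * (g 0 * g 1) + g 4 * g 0 ^ 2 with ha
  have ha0 : a ≠ 0 := by
    intro h0
    refine not_irreducible_conicPoly (s := -g 1) (t := g 0) ?_ hdeg (by ring) ?_ hirr
    · simpa using hg.symm
    · linarith
  let b := (g 4 - g 2) * (2 * g 0 * g 1) + g 3 * (g 0 ^ 2 - g 1 ^ 2)
  let d := g 2 * g 0 ^ 2 + g 3 * (g 0 * g 1) + g 4 * g 1 ^ 2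
  let Q : Polynomial ℝ := Polynomial.C a * Polynomial.X ^ 2 + Polynomial.C b * Polynomial.X +
    Polynomial.C d
  let N : ℝ → ℝ → ℝ → Polynomial ℝ := fun e u v =>
    Polynomial.C (a * e) * Polynomial.X ^ 2 + Polynomial.C (b * e - c * u) * Polynomial.X +
      Polynomial.C (d * e - c * v)
  let F := homEval n p (N (A 0) (-g 1) (g 0)) (N (A 1) (g 0) (g 1)) Q
  have hFdeg : F.natDegree ≤ n * 2 := natDegree_homEval_le h.1 Polynomial.natDegree_quadratic_le
    Polynomial.natDegree_quadratic_le Polynomial.natDegree_quadratic_le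
  have hFcoeff : F.coeff (n * 2) = a ^ n := by
    have hq : ∀ e u v : ℝ, (Polynomial.C e * Polynomial.X ^ 2 + Polynomial.C u * Polynomial.X +
      Polynomial.C v).coeff 2 = e := fun e u v => by simp
    have := homEval_eq_eval h.1 A a
    rw [h.2.1, mul_one] at this
    rw [← this, coeff_homEval h.1 Polynomial.natDegree_quadratic_le
      Polynomial.natDegree_quadratic_le Polynomial.natDegree_quadratic_le, hq, hq, hq,
      mul_comm a, mul_comm a]
  let x : Pt → ℝ := fun B => -g 1 * (B 0 - A 0) + g 0 * (B 1 - A 1)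
  let y : Pt → ℝ := fun B => g 0 * (B 0 - A 0) + g 1 * (B 1 - A 1)
  have hB0 : ∀ B : Pt, c * (B 0 - A 0) = -g 1 * x B + g 0 * y B := fun B => by
    simp only [x, y, hc]; ring
  have hB1 : ∀ B : Pt, c * (B 1 - A 1) = g 0 * x B + g 1 * y B := fun B => by
    simp only [x, y, hc]; ring
  have hxy : ∀ B ∈ Y, c ^ 2 * y B + a * x B ^ 2 + b * (x B * y B) + d * y B ^ 2 = 0 := by
    intro B hB
    simp only [x, y, hc, ha, b, d]
    linear_combination (g 0 * g 0 + g 1 * g 1) ^ 2 * hconic B hB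
  have hy0 : ∀ B ∈ Y, y B ≠ 0 := by
    intro B hB h0
    have hx0 : x B = 0 := by
      have := hxy B hB
      rw [h0] at this
      simpa [ha0] using this
    have h3 := hB0 B
    have h4 := hB1 B
    rw [h0, hx0] at h3 h4
    have := hne B hB
    simp [hc0] at h3 h4
    tauto
  have hQ : ∀ B ∈ Y, Q.eval (x B / y B) * y B = -c ^ 2 := by
    intro B hB
    have := hy0 B hB
    simp only [Q, Polynomial.eval_add, Polynomial.eval_mul, Polynomial.eval_C, Polynomial.eval_pow,
      Polynomial.eval_X]
    field_simp
    linear_combination hxy B hB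
  have hinj : Set.InjOn (fun B => x B / y B) Y := by
    intro B hB B' hB' hBB
    simp only at hBB
    have h3 := hQ B hB
    have h4 := hQ B' hB'
    rw [← hBB] at h4
    have hQ0 : Q.eval (x B / y B) ≠ 0 := fun h0 => by
      rw [h0] at h3
      simp [hc0] at h3
    have hyy : y B = y B' := mul_left_cancel₀ hQ0 (h3.trans h4.symm)
    have hxx : x B = x B' := by
      rw [hyy] at hBB
      exact (div_left_inj' (hy0 B' hB')).1 hBB
    ext i
    fin_cases i
    · have h5 := hB0 B
      rw [hxx, hyy, ← hB0 B'] at h5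
      simpa [hc0] using h5
    · have h5 := hB1 B
      rw [hxx, hyy, ← hB1 B'] at h5
      simpa [hc0] using h5
  have hN : ∀ B ∈ Y, ∀ e u v w : ℝ, c * (w - e) = u * x B + v * y B →
      (N e u v).eval (x B / y B) = w * Q.eval (x B / y B) := by
    intro B hB e u v w hw
    have h1 := hQ B hB
    have hy := hy0 B hB
    have hrw : (N e u v).eval (x B / y B) =
        e * Q.eval (x B / y B) - c * (u * (x B / y B) + v) := by
      simp only [N, Q, Polynomial.eval_add, Polynomial.eval_mul, Polynomial.eval_C,
        Polynomial.eval_pow, Polynomial.eval_X]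
      ring
    rw [hrw]
    refine mul_right_cancel₀ (mul_ne_zero hc0 hy) ?_
    have h5 : (u * (x B / y B) + v) * y B = u * x B + v * y B := by field_simp
    linear_combination (-c ^ 2) * h5 + (- c * (w - e)) * h1 + c ^ 2 * hw
  have hF : F = 0 := by
    refine Polynomial.eq_zero_of_natDegree_lt_card_of_eval_eq_zero' _
      (Y.image fun B => x B / y B) ?_ ?_
    · intro t ht
      obtain ⟨B, hB, rfl⟩ := Finset.mem_image.1 ht
      simp only [F, eval_homEval]
      rw [hN B hB _ _ _ _ (hB0 B), hN B hB _ _ _ _ (hB1 B), homEval_eq_eval h.1,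
        h.eval_eq_zero hYX hB, mul_zero]
    · rw [Finset.card_image_of_injOn hinj]
      omega
  rw [hF, Polynomial.coeff_zero] at hFcoeff
  exact pow_ne_zero n ha0 hFcoeff.symm

/-- For a node set of at most `2n + ⌊n/2⌋ + 1` nodes the following are equivalent:
(i) `A` has an `n`-fundamental polynomial; (ii) `A` has an `n`-fundamental polynomial
which is a product of polynomials of degree 1 or 2; (iii) the conditions (a), (b), (c)
hold. -/
theorem fundamental_tfae_lines_conics (n : ℕ) (hn : 1 ≤ n) (X : Finset Pt)
    (hcard : X.card ≤ 2 * n + n / 2 + 1) (A : Pt) (hA : A ∈ X) :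
    ((∃ p : BivPoly, IsFundamental n X A p) ↔
      (∃ p : BivPoly, IsFundamental n X A p ∧ IsProductOfLinesAndConics p)) ∧
    ((∃ p : BivPoly, IsFundamental n X A p) ↔ (CondA n X A ∧ CondB n X A ∧ CondC n X A)) := by
  have hcond : ∀ p, IsFundamental n X A p → CondA n X A ∧ CondB n X A ∧ CondC n X A :=
    fun p hp => ⟨hp.condA, hp.condB, hp.condC⟩
  have hprod : CondA n X A ∧ CondB n X A ∧ CondC n X A →
      ∃ p : BivPoly, IsFundamental n X A p ∧ IsProductOfLinesAndConics p :=
    fun h => exists_product_of_conditions hn hcard hA h.1 h.2.1 h.2.2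
  exact ⟨⟨fun ⟨p, hp⟩ => hprod (hcond p hp), fun ⟨p, hp, _⟩ => ⟨p, hp⟩⟩,
    fun ⟨p, hp⟩ => hcond p hp, fun h => (hprod h).imp fun _ hp => hp.1⟩
end
end
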